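/- arXiv:1009.4169 — 2 statements merged into one kernel-verified Lean document; each statement's English description precedes it below -/
import Mathlib

section
/- Let d ≥ 2 and let E ⊆ ℝ^d be a compact set whose Hausdorff dimension is strictly greater than d − 1. Then the direction set 𝒟(E) has positive surface measure on the unit sphere, i.e. the (d−1)-dimensional Hausdorff measure of 𝒟(E) is strictly positive. -/
open MeasureTheory Metric
open scoped ENNReal

/-- The set of directions determined by a set `A ⊆ ℝ^d`. -/
def directionSet {d : ℕ} (A : Set (EuclideanSpace ℝ (Fin d))) :
    Set (EuclideanSpace ℝ (Fin d)) :=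
  {ω | ∃ x ∈ A, ∃ y ∈ A, x ≠ y ∧ ω = ‖x - y‖⁻¹ • (x - y)}

/-- Dyadic cell of level `k` containing the point `x`. -/
noncomputable def dcell {ι : Type} (k : ℕ) (x : ι → ℝ) : ι → ℤ := fun i => ⌊(2:ℝ)^k * x i⌋

/-- Parent of a dyadic cell. -/
def dpar {ι : Type} (q : ι → ℤ) : ι → ℤ := fun i => q i / 2

lemma dpar_dcell {ι : Type} (k : ℕ) (x : ι → ℝ) : dpar (dcell (k+1) x) = dcell k x := by
  funext i
  simp only [dpar, dcell]
  symm
  rw [Int.floor_eq_iff]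
  have h1 := Int.floor_le ((2:ℝ)^(k+1) * x i)
  have h2 := Int.lt_floor_add_one ((2:ℝ)^(k+1) * x i)
  set z := ⌊(2:ℝ)^(k+1) * x i⌋
  have h3 : 2 * (z/2) ≤ z := by omega
  have h4 : z + 1 ≤ 2 * (z/2) + 2 := by omega
  have h3' : (2:ℝ) * ((z/2 : ℤ):ℝ) ≤ z := by exact_mod_cast h3
  have h4' : (z:ℝ) + 1 ≤ 2 * ((z/2 : ℤ):ℝ) + 2 := by exact_mod_cast h4
  rw [pow_succ] at h1 h2
  constructor <;> nlinarith

lemma dpar_iter_dcell {ι : Type} (k j : ℕ) (x : ι → ℝ) :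
    dpar^[j] (dcell (k+j) x) = dcell k x := by
  induction j with
  | zero => rfl
  | succ j ih => rw [Function.iterate_succ_apply, ← add_assoc, dpar_dcell, ih]

lemma dpar_finite {ι : Type} [Fintype ι] (p : ι → ℤ) : {q : ι → ℤ | dpar q = p}.Finite := by
  classical
  refine (Set.finite_Icc (fun i => 2 * p i) (fun i => 2 * p i + 1)).subset ?_
  rintro q rfl
  constructor <;> intro i <;> simp only [dpar] <;> omega

/-- Content of dyadic cells. -/
noncomputable def cellH {ι : Type} (h : OuterMeasure (ι → ℝ)) (F : Set (ι → ℝ)) (k : ℕ)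
    (q : ι → ℤ) : ℝ≥0∞ := h (F ∩ {x | dcell k x = q})

open Classical in
/-- Mass distribution. -/
noncomputable def cellW {ι : Type} [Fintype ι] (h : OuterMeasure (ι → ℝ)) (F : Set (ι → ℝ)) (k1 : ℕ) :
    ℕ → (ι → ℤ) → ℝ≥0∞
  | 0 => fun q => cellH h F k1 q
  | j+1 => fun q => cellW h F k1 j (dpar q) * (cellH h F (k1+(j+1)) q /
      ∑' q' : ι → ℤ, if dpar q' = dpar q then cellH h F (k1+(j+1)) q' else 0)

open Classical in
lemma cellH_le {ι : Type} [Fintype ι] (h : OuterMeasure (ι → ℝ)) (F : Set (ι → ℝ)) (k : ℕ)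
    (p : ι → ℤ) : cellH h F k p ≤ ∑' q' : ι → ℤ, if dpar q' = p then cellH h F (k+1) q' else 0 := by
  have : F ∩ {x | dcell k x = p} ⊆
      ⋃ q' : ι → ℤ, if dpar q' = p then F ∩ {x | dcell (k+1) x = q'} else ∅ := by
    rintro x ⟨hx, hxp⟩
    rw [Set.mem_iUnion]
    refine ⟨dcell (k+1) x, ?_⟩
    rw [dpar_dcell, if_pos (show dcell k x = p from hxp)]
    exact ⟨hx, rfl⟩
  refine (measure_mono this).trans ((measure_iUnion_le _).trans ?_)
  refine ENNReal.tsum_le_tsum fun q => ?_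
  split_ifs
  · exact le_rfl
  · simp

lemma cellW_le {ι : Type} [Fintype ι] (h : OuterMeasure (ι → ℝ)) (F : Set (ι → ℝ)) (k1 j : ℕ)
    (q : ι → ℤ) : cellW h F k1 j q ≤ cellH h F (k1 + j) q := by
  induction j generalizing q with
  | zero => exact le_rfl
  | succ j ih =>
    simp only [cellW]
    have h1 := (ih (dpar q)).trans (cellH_le h F _ _)
    rw [add_assoc] at h1
    exact le_trans (mul_le_mul_left h1 _) ENNReal.mul_div_le

open Classical in
lemma cellW_sum {ι : Type} [Fintype ι] (h : OuterMeasure (ι → ℝ)) (F : Set (ι → ℝ)) (k1 j : ℕ)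
    (hfin : ∀ q, cellH h F (k1 + (j+1)) q ≠ ⊤) (p : ι → ℤ) :
    (∑' q : ι → ℤ, if dpar q = p then cellW h F k1 (j+1) q else 0) = cellW h F k1 j p := by
  set T := ∑' q' : ι → ℤ, if dpar q' = p then cellH h F (k1+(j+1)) q' else 0 with hT
  have h1 : ∀ q, (if dpar q = p then cellW h F k1 (j+1) q else 0)
      = cellW h F k1 j p * ((if dpar q = p then cellH h F (k1+(j+1)) q else 0) * T⁻¹) := by
    intro q
    split_ifs with hq
    · simp only [cellW, hq, div_eq_mul_inv, hT]
    · simp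
  simp_rw [h1]
  rw [ENNReal.tsum_mul_left, ENNReal.tsum_mul_right, ← hT]
  have hle : cellW h F k1 j p ≤ T := (cellW_le h F k1 j p).trans (cellH_le h F _ _)
  have hTfin : T ≠ ⊤ := by
    rw [hT, tsum_eq_sum (s := (dpar_finite p).toFinset)]
    · refine ENNReal.sum_ne_top.2 fun q _ => ?_
      split_ifs
      · exact hfin q
      · simp
    · intro q hq
      rw [if_neg]
      simpa using hq
  by_cases h0 : T = 0
  · rw [h0] at hle ⊢
    simp [le_antisymm hle zero_le]
  · rw [ENNReal.mul_inv_cancel h0 hTfin, mul_one]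

lemma tsum_fiber {α β : Type*} (f : α → β) (w : α → ℝ≥0∞) [DecidableEq β] :
    (∑' p, ∑' q, if f q = p then w q else 0) = ∑' q, w q := by
  rw [ENNReal.tsum_comm]
  refine tsum_congr fun q => ?_
  rw [tsum_eq_single (f q)]
  · simp
  · intro b hb
    rw [if_neg hb.symm]

open Classical in
lemma cellW_sum_iter {ι : Type} [Fintype ι] (h : OuterMeasure (ι → ℝ)) (F : Set (ι → ℝ)) (k1 k j : ℕ)
    (hfin : ∀ l, k1 ≤ l → ∀ q, cellH h F l q ≠ ⊤) (p : ι → ℤ) :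
    (∑' q : ι → ℤ, if dpar^[j] q = p then cellW h F k1 (k+j) q else 0) = cellW h F k1 k p := by
  induction j with
  | zero => 
    rw [tsum_eq_single p]
    · simp
    · intro b hb
      simp [hb]
  | succ j ih =>
    rw [← ih]
    have : ∀ r : ι → ℤ, (if dpar^[j] r = p then cellW h F k1 (k+j) r else 0)
      = ∑' q, if dpar q = r then (if dpar^[j+1] q = p then cellW h F k1 (k+(j+1)) q else 0) else 0 := by
      intro r
      rw [← cellW_sum h F k1 (k+j) (fun q => hfin _ (by omega) q) r]
      split_ifs with hr
      · refine tsum_congr fun q => ?_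
        split_ifs with h1 h2 h2
        · rfl
        · rw [Function.iterate_succ_apply, h1] at h2
          exact absurd hr h2
        · rfl
      · symm
        rw [ENNReal.tsum_eq_zero]
        intro q
        split_ifs with h1 h2 h2
        · rw [Function.iterate_succ_apply, h1] at h2
          exact absurd h2 hr
        · rfl
        · rfl
    simp_rw [this]
    rw [tsum_fiber]

open Classical in
theorem frostman_discrete {ι : Type} [Fintype ι] (h : OuterMeasure (ι → ℝ)) (F : Set (ι → ℝ))
    (k1 : ℕ) (c : ℕ → ℝ≥0∞) (hc : ∀ k, c k ≠ ⊤) (hfin : ∀ k, k1 ≤ k → ∀ q, cellH h F k q ≤ c k)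
    (q0 : ι → ℤ) (hF : ∀ x ∈ F, dcell k1 x = q0) (hne : F.Nonempty) (n : ℕ) (hn : k1 ≤ n) :
    ∃ (w : (ι → ℤ) → ℝ≥0∞) (x : (ι → ℤ) → (ι → ℝ)), (∀ i, x i ∈ F) ∧ ∑' i, w i = h F ∧
      ∀ k, k1 ≤ k → k ≤ n → ∀ q, (∑' i, if dcell k (x i) = q then w i else 0) ≤ c k := by
  have hfin' : ∀ l, k1 ≤ l → ∀ q, cellH h F l q ≠ ⊤ := fun l hl q =>
    ((hfin l hl q).trans_lt (hc l).lt_top).ne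
  obtain ⟨n, rfl⟩ := Nat.exists_eq_add_of_le hn
  have hx : ∀ q : ι → ℤ, ∃ x ∈ F, cellW h F k1 n q ≠ 0 → dcell (k1+n) x = q := by
    intro q
    by_cases hq : cellW h F k1 n q = 0
    · exact ⟨hne.some, hne.some_mem, fun h => absurd hq h⟩
    · have h1 : cellH h F (k1+n) q ≠ 0 := fun h0 => hq (le_antisymm ((cellW_le h F k1 n q).trans h0.le) zero_le)
      have h2 : (F ∩ {x | dcell (k1+n) x = q}).Nonempty := by
        rw [Set.nonempty_iff_ne_empty]
        intro h0
        apply h1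
        simp [cellH, h0]
      obtain ⟨x, hx1, hx2⟩ := h2
      exact ⟨x, hx1, fun _ => hx2⟩
  choose x hxF hx using hx
  refine ⟨cellW h F k1 n, x, hxF, ?_, ?_⟩
  · have : ∀ j, ∑' q, cellW h F k1 j q = h F := by
      intro j
      induction j with
      | zero =>
        rw [tsum_eq_single q0]
        · simp only [cellW, cellH]
          congr 1
          ext y
          exact ⟨fun hy => hy.1, fun hy => ⟨hy, hF y hy⟩⟩
        · intro q hq
          simp only [cellW, cellH]
          have : F ∩ {x | dcell k1 x = q} = ∅ := by
            ext y
            simp only [Set.mem_inter_iff, Set.mem_ofPred_eq, Set.mem_empty_iff_false, iff_false, not_and]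
            intro hy h2
            exact hq (h2.symm.trans (hF y hy))
          simp [this]
      | succ j ih =>
        rw [← ih, ← tsum_fiber dpar]
        refine tsum_congr fun p => ?_
        exact cellW_sum h F k1 j (hfin' _ (by omega)) p
    exact this n
  · intro k hk hkn q
    obtain ⟨k, rfl⟩ := Nat.exists_eq_add_of_le hk
    obtain ⟨j, rfl⟩ := Nat.exists_eq_add_of_le (show k ≤ n by omega)
    refine le_trans (le_of_eq ?_) ((cellW_le h F k1 k q).trans (hfin _ hk q))
    rw [← cellW_sum_iter h F k1 k j hfin' q]
    refine tsum_congr fun r => ?_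
    by_cases hr : cellW h F k1 (k+j) r = 0
    · simp [hr]
    · have := hx r hr
      rw [← add_assoc] at this
      have h2 := dpar_iter_dcell (k1+k) j (x r)
      rw [this] at h2
      rw [h2]

/-- Projection of `ℝ^(m+1)` to `ℝ^m` along the direction `(1, u)`. -/
def sproj {m : ℕ} (u : Fin m → ℝ) (x : Fin (m+1) → ℝ) : Fin m → ℝ :=
  fun i => x i.succ - u i * x 0

/-- The set of slopes of a set. -/
def slopeSet {m : ℕ} (E : Set (Fin (m+1) → ℝ)) : Set (Fin m → ℝ) :=
  {u | ∃ x ∈ E, ∃ y ∈ E, x ≠ y ∧ sproj u x = sproj u y}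

/-- Adjacent dyadic cells. -/
def adj {ι : Type} (k : ℕ) (x y : ι → ℝ) : Prop := ∀ i, |dcell k x i - dcell k y i| ≤ 1

lemma continuous_sproj {m : ℕ} : Continuous fun p : (Fin m → ℝ) × (Fin (m+1) → ℝ) => sproj p.1 p.2 := by
  unfold sproj
  fun_prop

lemma adj_of_dist {ι : Type} [Fintype ι] (k : ℕ) (x y : ι → ℝ) (h : 2^k * dist x y < 1) :
    adj k x y := by
  intro i
  have h1 : |x i - y i| ≤ dist x y := dist_le_pi_dist x y i
  have h2 : 2^k * |x i - y i| < 1 := lt_of_le_of_lt (by gcongr) h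
  have h3 : |2^k * x i - 2^k * y i| < 1 := by
    rw [← mul_sub, abs_mul, abs_of_pos (by positivity : (0:ℝ) < 2^k)]; exact h2
  rw [abs_lt] at h3
  simp only [dcell]
  have a1 := Int.floor_le ((2:ℝ)^k * x i)
  have a2 := Int.lt_floor_add_one ((2:ℝ)^k * x i)
  have b1 := Int.floor_le ((2:ℝ)^k * y i)
  have b2 := Int.lt_floor_add_one ((2:ℝ)^k * y i)
  have c1 : (⌊(2:ℝ)^k * x i⌋ : ℝ) < ⌊(2:ℝ)^k * y i⌋ + 2 := by linarith
  have c2 : (⌊(2:ℝ)^k * y i⌋ : ℝ) < ⌊(2:ℝ)^k * x i⌋ + 2 := by linarith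
  have c1' : ⌊(2:ℝ)^k * x i⌋ < ⌊(2:ℝ)^k * y i⌋ + 2 := by exact_mod_cast c1
  have c2' : ⌊(2:ℝ)^k * y i⌋ < ⌊(2:ℝ)^k * x i⌋ + 2 := by exact_mod_cast c2
  rw [abs_le]
  constructor <;> omega

lemma dist_of_dcell_eq {ι : Type} (k : ℕ) (x y : ι → ℝ) (h : dcell k x = dcell k y) (i : ι) :
    2^k * |x i - y i| ≤ 1 := by
  have h0 := congrFun h i
  simp only [dcell] at h0
  have a1 := Int.floor_le ((2:ℝ)^k * x i)
  have a2 := Int.lt_floor_add_one ((2:ℝ)^k * x i)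
  have b1 := Int.floor_le ((2:ℝ)^k * y i)
  have b2 := Int.lt_floor_add_one ((2:ℝ)^k * y i)
  rw [h0] at a1 a2
  rw [← abs_of_pos (by positivity : (0:ℝ) < 2^k), ← abs_mul, mul_sub, abs_le]
  constructor <;> linarith

lemma dist_of_dcell_eq' {ι : Type} [Fintype ι] (k : ℕ) (x y : ι → ℝ) (h : dcell k x = dcell k y) :
    2^k * dist x y ≤ 1 := by
  have hp : (0:ℝ) < 2^k := by positivity
  rw [← le_div_iff₀' hp, dist_pi_le_iff (by positivity)]
  intro i
  rw [le_div_iff₀' hp]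
  exact dist_of_dcell_eq k x y h i

open Classical in
lemma adj_energy {ι α : Type} [Fintype ι] [DecidableEq ι] (w : α → ℝ≥0∞) (x : α → ι → ℝ) (k : ℕ) (c : ℝ≥0∞)
    (hc : ∀ q, (∑' i, if dcell k (x i) = q then w i else 0) ≤ c) :
    (∑' i, ∑' j, if adj k (x i) (x j) then w i * w j else 0) ≤
      (Finset.Icc (-1 : ι → ℤ) 1).card * c * ∑' i, w i := by
  rw [← ENNReal.tsum_mul_left]
  refine ENNReal.tsum_le_tsum fun i => ?_
  have h1 : ∀ j, (if adj k (x i) (x j) then w i * w j else 0) ≤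
      w i * ∑ e ∈ Finset.Icc (-1 : ι → ℤ) 1, if dcell k (x j) = dcell k (x i) + e then w j else 0 := by
    intro j
    split_ifs with h
    · gcongr
      have := Finset.single_le_sum (s := Finset.Icc (-1 : ι → ℤ) 1)
        (f := fun e => if dcell k (x j) = dcell k (x i) + e then w j else 0)
        (fun _ _ => zero_le) (a := dcell k (x j) - dcell k (x i)) ?_
      · simpa using this
      · rw [Finset.mem_Icc]
        constructor <;> intro l <;> have := abs_le.1 (h l) <;> simp <;> omega
    · exact zero_le
  refine (ENNReal.tsum_le_tsum h1).trans ?_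
  rw [ENNReal.tsum_mul_left, Summable.tsum_finsetSum (fun _ _ => ENNReal.summable), mul_comm]
  gcongr
  refine (Finset.sum_le_sum (fun e _ => hc _)).trans ?_
  simp

open Classical in
lemma cs_tsum {α β : Type} (w : α → ℝ≥0∞) (g : α → β) (S : Finset β) (hS : ∀ i, g i ∈ S) :
    (∑' i, w i)^2 ≤ S.card * ∑' i, ∑' j, if g i = g j then w i * w j else 0 := by
  have h1 : ∑' i, w i = ∑ b ∈ S, ∑' i, if g i = b then w i else 0 := by
    rw [← Summable.tsum_finsetSum (fun _ _ => ENNReal.summable)]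
    refine tsum_congr fun i => ?_
    rw [Finset.sum_ite_eq, if_pos (hS i)]
  rw [h1]
  have h2 := ENNReal.rpow_sum_le_const_mul_sum_rpow S (fun b => ∑' i, if g i = b then w i else 0)
    (p := 2) (by norm_num)
  norm_num at h2
  refine h2.trans ?_
  gcongr
  calc _ = ∑ b ∈ S, ∑' i, ∑' j, if g i = b then (if g i = g j then w i * w j else 0) else 0 := by
        refine Finset.sum_congr rfl fun b _ => ?_
        rw [sq, ← ENNReal.tsum_mul_right]
        refine tsum_congr fun i => ?_
        rw [← ENNReal.tsum_mul_left]
        refine tsum_congr fun j => ?_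
        split_ifs <;> simp_all
    _ = ∑' i, ∑' j, ∑ b ∈ S, if g i = b then (if g i = g j then w i * w j else 0) else 0 := by
        rw [← Summable.tsum_finsetSum (fun _ _ => ENNReal.summable)]
        refine tsum_congr fun i => ?_
        rw [← Summable.tsum_finsetSum (fun _ _ => ENNReal.summable)]
    _ ≤ _ := by
        refine ENNReal.tsum_le_tsum fun i => ENNReal.tsum_le_tsum fun j => ?_
        rw [Finset.sum_ite_eq, if_pos (hS i)]

lemma vol_bound {m : ℕ} (n k : ℕ) (x y : Fin (m+1) → ℝ) (h : n ≤ k ∨ 1 ≤ 2^(k+1) * dist x y) :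
    volume (Set.Icc (0 : Fin m → ℝ) 1 ∩ {u | dcell n (sproj u x) = dcell n (sproj u y)}) ≤
      ENNReal.ofReal ((8 * 2^k / 2^n)^m) := by
  by_cases hn : n ≤ k + 3
  · calc _ ≤ volume (Set.Icc (0 : Fin m → ℝ) 1) := measure_mono Set.inter_subset_left
      _ = 1 := by rw [Real.volume_Icc_pi]; simp
      _ ≤ _ := by
        rw [ENNReal.one_le_ofReal]
        apply one_le_pow₀
        rw [le_div_iff₀ (by positivity), one_mul]
        calc (2:ℝ)^n ≤ 2^(k+3) := by gcongr; norm_num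
          _ = _ := by ring
  push Not at hn
  have hd : 1 ≤ 2^(k+1) * dist x y := by
    rcases h with h | h
    · omega
    · exact h
  rcases Set.eq_empty_or_nonempty
    (Set.Icc (0 : Fin m → ℝ) 1 ∩ {u | dcell n (sproj u x) = dcell n (sproj u y)}) with h0 | ⟨v, hv, hv2⟩
  · rw [h0]; simp
  have hkn : (2:ℝ)^(k+4) ≤ 2^n := by gcongr; norm_num; omega
  have hK : (0:ℝ) < 2^k := by positivity
  have hN : (0:ℝ) < 2^n := by positivity
  have h4 : (2:ℝ)^(k+4) = 16 * 2^k := by ring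
  rw [h4] at hkn
  have hgap : 1 ≤ 2^(k+2) * |x 0 - y 0| := by
    by_contra hlt
    push Not at hlt
    have : dist x y < 1 / 2^(k+1) := by
      rw [dist_pi_lt_iff (by positivity)]
      intro i
      rw [lt_div_iff₀' (by positivity), Real.dist_eq]
      rw [pow_add] at hlt ⊢
      refine Fin.cases ?_ (fun i => ?_) i
      · nlinarith [abs_nonneg (x 0 - y 0)]
      · have h1 := dist_of_dcell_eq n _ _ hv2 i
        simp only [sproj] at h1
        have h2 : |x i.succ - y i.succ| ≤ |x i.succ - v i * x 0 - (y i.succ - v i * y 0)| + |x 0 - y 0| := by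
          calc |x i.succ - y i.succ| = |(x i.succ - v i * x 0 - (y i.succ - v i * y 0)) + v i * (x 0 - y 0)| := by ring_nf
            _ ≤ _ := abs_add_le _ _
            _ ≤ _ := by
              have h3 : |v i * (x 0 - y 0)| ≤ |x 0 - y 0| := by
                have h5 : 0 ≤ v i := hv.1 i
                rw [abs_mul, abs_of_nonneg h5]
                have := hv.2 i
                simp at this
                nlinarith [abs_nonneg (x 0 - y 0)]
              linarith
        set t := |x i.succ - v i * x 0 - (y i.succ - v i * y 0)|
        have ht : 0 ≤ t := abs_nonneg _
        nlinarith
    rw [lt_div_iff₀' (by positivity)] at this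
    linarith
  have hx0 : 0 < |x 0 - y 0| := by
    by_contra hh
    have : |x 0 - y 0| = 0 := le_antisymm (not_lt.1 hh) (abs_nonneg _)
    rw [this] at hgap
    norm_num at hgap
  have hsub : (Set.Icc (0 : Fin m → ℝ) 1 ∩ {u | dcell n (sproj u x) = dcell n (sproj u y)}) ⊆
      closedBall (fun i => (x i.succ - y i.succ) / (x 0 - y 0)) (4 * 2^k / 2^n) := by
    rintro u ⟨-, hu⟩
    rw [mem_closedBall, dist_pi_le_iff (by positivity)]
    intro i
    have h1 := dist_of_dcell_eq n _ _ hu i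
    simp only [sproj] at h1
    have h2 : |u i - (x i.succ - y i.succ) / (x 0 - y 0)| * |x 0 - y 0| =
      |x i.succ - u i * x 0 - (y i.succ - u i * y 0)| := by
      rw [← abs_mul, sub_mul, div_mul_cancel₀ _ (abs_pos.1 hx0), abs_sub_comm]
      ring_nf
    rw [← h2] at h1
    rw [Real.dist_eq, le_div_iff₀ hN]
    set t := |u i - (x i.succ - y i.succ) / (x 0 - y 0)|
    have ht : 0 ≤ t := abs_nonneg _
    rw [pow_add] at hgap
    have h5 : 0 ≤ 2^n * t := by positivity
    calc t * 2^n = (2^n * t) * 1 := by ring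
      _ ≤ (2^n * t) * (2^k * 2^2 * |x 0 - y 0|) := by gcongr
      _ = (2^n * (t * |x 0 - y 0|)) * (2^k * 4) := by ring
      _ ≤ 1 * (2^k * 4) := by gcongr
      _ = _ := by ring
  refine (measure_mono hsub).trans ?_
  rw [Real.volume_pi_closedBall _ (by positivity)]
  apply le_of_eq
  congr 1
  simp
  congr 1
  ring

/-- Directions along which two far away points have close projections. -/
def badSet {m : ℕ} (E : Set (Fin (m+1) → ℝ)) (k n : ℕ) : Set (Fin m → ℝ) :=
  {u | u ∈ Set.Icc (0 : Fin m → ℝ) 1 ∧ ∃ x ∈ E, ∃ y ∈ E, 1 ≤ 2^k * dist x y ∧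
    2^n * dist (sproj u x) (sproj u y) ≤ 1}

lemma badSet_closed {m : ℕ} (E : Set (Fin (m+1) → ℝ)) (hE : IsCompact E) (k n : ℕ) :
    IsClosed (badSet E k n) := by
  have h1 : IsCompact ((Set.Icc (0 : Fin m → ℝ) 1 ×ˢ E ×ˢ E) ∩ 
    {p : (Fin m → ℝ) × (Fin (m+1) → ℝ) × (Fin (m+1) → ℝ) | 1 ≤ 2^k * dist p.2.1 p.2.2 ∧
      2^n * dist (sproj p.1 p.2.1) (sproj p.1 p.2.2) ≤ 1}) := by
    apply IsCompact.inter_right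
    · exact isCompact_Icc.prod (hE.prod hE)
    · have c1 : Continuous fun p : (Fin m → ℝ) × (Fin (m+1) → ℝ) × (Fin (m+1) → ℝ) => sproj p.1 p.2.1 :=
        continuous_sproj.comp (continuous_fst.prodMk (continuous_fst.comp continuous_snd))
      have c2 : Continuous fun p : (Fin m → ℝ) × (Fin (m+1) → ℝ) × (Fin (m+1) → ℝ) => sproj p.1 p.2.2 :=
        continuous_sproj.comp (continuous_fst.prodMk (continuous_snd.comp continuous_snd))
      have d1 : IsClosed {p : (Fin m → ℝ) × (Fin (m+1) → ℝ) × (Fin (m+1) → ℝ) |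
          1 ≤ 2^k * dist p.2.1 p.2.2} := isClosed_le continuous_const (by fun_prop)
      have d2 : IsClosed {p : (Fin m → ℝ) × (Fin (m+1) → ℝ) × (Fin (m+1) → ℝ) |
          2^n * dist (sproj p.1 p.2.1) (sproj p.1 p.2.2) ≤ 1} :=
        isClosed_le (by fun_prop) continuous_const
      exact d1.inter d2
  have h2 := (h1.image continuous_fst).isClosed
  convert h2 using 1
  ext u
  constructor
  · rintro ⟨hu, x, hx, y, hy, h⟩
    exact ⟨(u, x, y), ⟨⟨hu, hx, hy⟩, h⟩, rfl⟩
  · rintro ⟨⟨u, x, y⟩, ⟨⟨hu, hx, hy⟩, h⟩, rfl⟩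
    exact ⟨hu, x, hx, y, hy, h⟩

lemma badSet_anti {m : ℕ} (E : Set (Fin (m+1) → ℝ)) (k : ℕ) : Antitone (badSet E k) := by
  intro n n' hn u
  rintro ⟨hu, x, hx, y, hy, h, h'⟩
  refine ⟨hu, x, hx, y, hy, h, le_trans ?_ h'⟩
  gcongr
  norm_num

lemma badSet_iInter {m : ℕ} (E : Set (Fin (m+1) → ℝ)) (hE : IsCompact E) (k : ℕ) :
    ⋂ n, badSet E k n ⊆ slopeSet E := by
  intro u hu
  rw [Set.mem_iInter] at hu
  let C : ℕ → Set ((Fin (m+1) → ℝ) × (Fin (m+1) → ℝ)) := fun n =>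
    (E ×ˢ E) ∩ {p | 1 ≤ 2^k * dist p.1 p.2 ∧ 2^n * dist (sproj u p.1) (sproj u p.2) ≤ 1}
  have hC : ∀ n, IsCompact (C n) := by
    intro n
    apply IsCompact.inter_right (hE.prod hE)
    have c1 : Continuous fun p : (Fin (m+1) → ℝ) × (Fin (m+1) → ℝ) => sproj u p.1 :=
      continuous_sproj.comp (continuous_const.prodMk continuous_fst)
    have c2 : Continuous fun p : (Fin (m+1) → ℝ) × (Fin (m+1) → ℝ) => sproj u p.2 :=
      continuous_sproj.comp (continuous_const.prodMk continuous_snd)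
    have d1 : IsClosed {p : (Fin (m+1) → ℝ) × (Fin (m+1) → ℝ) |
        1 ≤ 2^k * dist p.1 p.2} := isClosed_le continuous_const (by fun_prop)
    have d2 : IsClosed {p : (Fin (m+1) → ℝ) × (Fin (m+1) → ℝ) |
        2^n * dist (sproj u p.1) (sproj u p.2) ≤ 1} :=
      isClosed_le (by fun_prop) continuous_const
    exact d1.inter d2
  have hne := IsCompact.nonempty_iInter_of_sequence_nonempty_isCompact_isClosed C ?_ ?_ (hC 0)
    (fun n => (hC n).isClosed)
  · obtain ⟨⟨x, y⟩, hxy⟩ := hne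
    rw [Set.mem_iInter] at hxy
    refine ⟨x, (hxy 0).1.1, y, (hxy 0).1.2, ?_, ?_⟩
    · rintro rfl
      have := (hxy 0).2.1
      norm_num at this
    · by_contra hne
      have hpos : 0 < dist (sproj u x) (sproj u y) := dist_pos.2 hne
      obtain ⟨n, hn⟩ := pow_unbounded_of_one_lt (1 / dist (sproj u x) (sproj u y)) (one_lt_two : (1:ℝ) < 2)
      rw [div_lt_iff₀ hpos] at hn
      have := (hxy n).2.2
      simp only at this
      linarith
  · rintro n ⟨x, y⟩ ⟨h1, h2, h3⟩
    refine ⟨h1, h2, le_trans ?_ h3⟩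
    gcongr
    · norm_num
    · omega
  · intro n
    obtain ⟨-, x, hx, y, hy, h⟩ := hu n
    exact ⟨(x, y), ⟨hx, hy⟩, h⟩

lemma exists_badSet_small {m : ℕ} (E : Set (Fin (m+1) → ℝ)) (hE : IsCompact E)
    (h0 : volume (slopeSet E) = 0) (k : ℕ) : ∃ n, k ≤ n ∧ volume (badSet E k n) ≤ 1/2 := by
  have ht := tendsto_measure_iInter_atTop (μ := (volume : Measure (Fin m → ℝ)))
    (fun n => (badSet_closed E hE k n).measurableSet.nullMeasurableSet) (badSet_anti E k) ⟨0, ?_⟩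
  · rw [measure_mono_null (badSet_iInter E hE k) h0] at ht
    have := (ht.eventually_le_const (u := (1/2 : ℝ≥0∞)) (by simp)).and (Filter.eventually_ge_atTop k)
    obtain ⟨n, h1, h2⟩ := this.exists
    exact ⟨n, h2, h1⟩
  · refine ((measure_mono (t := Set.Icc (0 : Fin m → ℝ) 1) fun u hu => hu.1).trans_lt ?_).ne
    exact isCompact_Icc.measure_lt_top

open Classical in
lemma core_ineq {m : ℕ} (E : Set (Fin (m+1) → ℝ)) (hE : IsCompact E)
    (h0 : volume (slopeSet E) = 0) (L : ℕ) (hL1 : 1 ≤ L) (hL : ∀ x ∈ E, ∀ i, |x i| ≤ L)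
    (k0 : ℕ) (c : ℕ → ℝ≥0∞) (a : ℝ≥0∞) (ha : a ≠ ⊤) (ha0 : a ≠ 0)
    (hfr : ∀ n, k0 ≤ n → ∃ (w : (Fin (m+1) → ℤ) → ℝ≥0∞) (x : (Fin (m+1) → ℤ) → (Fin (m+1) → ℝ)),
      (∀ i, x i ∈ E) ∧ ∑' i, w i = a ∧
      ∀ k, k0 ≤ k → k ≤ n → ∀ q, (∑' i, if dcell k (x i) = q then w i else 0) ≤ c k) :
    a * (1/2) ≤ (Finset.Icc (-1 : Fin (m+1) → ℤ) 1).card * ENNReal.ofReal ((64 * L)^m) *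
      ∑' k, ENNReal.ofReal ((2^(k + k0))^m) * c (k + k0) := by
  obtain ⟨n, hn, hbad⟩ := exists_badSet_small E hE h0 k0
  obtain ⟨w, x, hx, hwa, hw⟩ := hfr n hn
  set Q : Set (Fin m → ℝ) := Set.Icc 0 1 with hQ
  set G := Q \ badSet E k0 n with hG
  have hGm : MeasurableSet G := measurableSet_Icc.diff (badSet_closed E hE k0 n).measurableSet
  have hGv : 1/2 ≤ volume G := by
    have h1 : volume Q = 1 := by rw [hQ, Real.volume_Icc_pi]; simp
    have h2 : volume Q ≤ volume G + volume (badSet E k0 n) := by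
      refine (measure_mono ?_).trans (measure_union_le _ _)
      intro u hu
      by_cases hb : u ∈ badSet E k0 n
      · exact Or.inr hb
      · exact Or.inl ⟨hu, hb⟩
    rw [h1] at h2
    have h3 : (1:ℝ≥0∞) ≤ volume G + 1/2 := h2.trans (by gcongr)
    have h4 := tsub_le_iff_right.2 h3
    have h5 : (1:ℝ≥0∞) - 1/2 = 1/2 := by
      rw [one_div, ENNReal.one_sub_inv_two]
    rwa [h5] at h4
  -- number of cells
  set S : Finset (Fin m → ℤ) := Finset.Icc (fun _ => -(2 * L * 2^n : ℤ)) (fun _ => 2 * L * 2^n) with hS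
  have hScard : (S.card : ℝ≥0∞) ≤ ENNReal.ofReal ((8 * L * 2^n)^m) := by
    have h1 : S.card = (4 * L * 2^n + 1)^m := by
      rw [hS, Pi.card_Icc]
      simp only [Int.card_Icc, Finset.prod_const, Finset.card_univ, Fintype.card_fin]
      congr 1
      have : (2 * (L:ℤ) * 2^n + 1 - -(2 * L * 2^n)) = ((4 * L * 2^n + 1 : ℕ) : ℤ) := by
        push_cast; ring
      rw [this, Int.toNat_natCast]
    rw [h1, ← ENNReal.ofReal_natCast]
    apply ENNReal.ofReal_le_ofReal
    push_cast
    gcongr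
    have h2 : (1:ℝ) ≤ L := by exact_mod_cast hL1
    have h3 : (1:ℝ) ≤ 2^n := one_le_pow₀ (by norm_num)
    nlinarith
  have hSmem : ∀ u ∈ Q, ∀ i, dcell n (sproj u (x i)) ∈ S := by
    intro u hu i
    have hb : ∀ l, |2^n * sproj u (x i) l| ≤ 2 * L * 2^n := by
      intro l
      simp only [sproj]
      rw [abs_mul, abs_of_pos (by positivity : (0:ℝ) < 2^n), mul_comm]
      gcongr
      have e1 := hL _ (hx i) l.succ
      have e2 := hL _ (hx i) 0
      have e3 : 0 ≤ u l := hu.1 l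
      have e4 : u l ≤ 1 := hu.2 l
      calc _ ≤ |x i l.succ| + |u l * x i 0| := abs_sub _ _
        _ ≤ L + 1 * L := by
          rw [abs_mul, abs_of_nonneg e3]
          gcongr
        _ = _ := by ring
    rw [hS, Finset.mem_Icc]
    constructor
    · intro l
      simp only [dcell]
      rw [Int.le_floor]
      push_cast
      exact (abs_le.1 (hb l)).1
    · intro l
      simp only [dcell]
      have := (Int.floor_le (2^n * sproj u (x i) l)).trans (abs_le.1 (hb l)).2
      exact_mod_cast this
  set A : (Fin (m+1) → ℤ) → (Fin (m+1) → ℤ) → Set (Fin m → ℝ) :=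
    fun i j => {u | dcell n (sproj u (x i)) = dcell n (sproj u (x j))} with hA
  have hAm : ∀ i j, MeasurableSet (A i j) := by
    intro i j
    have hm : ∀ y : Fin (m+1) → ℝ, Measurable fun u : Fin m → ℝ => dcell n (sproj u y) := by
      intro y
      unfold dcell sproj
      refine measurable_pi_lambda _ fun l => Int.measurable_floor.comp ?_
      fun_prop
    exact measurableSet_eq_fun (hm _) (hm _)
  -- volume estimates
  have hvol : ∀ i j, volume (A i j ∩ G) ≤ ∑ k ∈ Finset.Ico k0 (n+1),
      if adj k (x i) (x j) then ENNReal.ofReal ((8 * 2^k / 2^n)^m) else 0 := by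
    intro i j
    rcases Set.eq_empty_or_nonempty (A i j ∩ G) with he | ⟨u, huA, huQ, huB⟩
    · rw [he]; simp
    have hadj : adj k0 (x i) (x j) := by
      apply adj_of_dist
      by_contra hlt
      exact huB ⟨huQ, x i, hx i, x j, hx j, not_lt.1 hlt, dist_of_dcell_eq' _ _ _ huA⟩
    have hex : ∃ k, k0 ≤ k ∧ k ≤ n ∧ adj k (x i) (x j) ∧ (n ≤ k ∨ ¬ adj (k+1) (x i) (x j)) := by
      by_contra hno
      push Not at hno
      have : ∀ t, k0 + t ≤ n → adj (k0 + t) (x i) (x j) := by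
        intro t
        induction t with
        | zero => intro _; exact hadj
        | succ t ih =>
          intro ht
          exact (hno (k0+t) (by omega) (by omega) (ih (by omega))).2
      have h1 := this (n - k0) (by omega)
      have h2 := (hno (k0 + (n-k0)) (by omega) (by omega) h1).1
      omega
    obtain ⟨k, hk1, hk2, hk3, hk4⟩ := hex
    have hv : volume (A i j ∩ G) ≤ ENNReal.ofReal ((8 * 2^k / 2^n)^m) := by
      refine (measure_mono ?_).trans (vol_bound n k (x i) (x j) (hk4.imp id ?_))
      · rintro v ⟨h1, h2, -⟩
        exact ⟨h2, h1⟩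
      · intro h
        by_contra hlt
        exact h (adj_of_dist _ _ _ (not_le.1 hlt))
    refine hv.trans ?_
    have := Finset.single_le_sum (s := Finset.Ico k0 (n+1))
      (f := fun k => if adj k (x i) (x j) then ENNReal.ofReal ((8 * 2^k / 2^n)^m) else 0)
      (fun _ _ => zero_le) (a := k) (by rw [Finset.mem_Ico]; omega)
    simpa only [if_pos hk3] using this
  -- integrated inequality
  have hint : a^2 * (1/2) ≤ S.card * ∑' i, ∑' j, w i * w j * volume (A i j ∩ G) := by
    calc a^2 * (1/2) ≤ a^2 * volume G := by gcongr
      _ = ∫⁻ u in G, a^2 := by rw [setLIntegral_const]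
      _ ≤ ∫⁻ u in G, S.card * ∑' i, ∑' j, (A i j).indicator (fun _ => w i * w j) u := by
        refine setLIntegral_mono' hGm fun u hu => ?_
        rw [← hwa]
        refine (cs_tsum w (fun i => dcell n (sproj u (x i))) S (hSmem u hu.1)).trans ?_
        refine mul_le_mul_right (ENNReal.tsum_le_tsum fun i => ENNReal.tsum_le_tsum fun j => ?_) _
        by_cases hij : dcell n (sproj u (x i)) = dcell n (sproj u (x j))
        · rw [if_pos hij, Set.indicator_of_mem (show u ∈ A i j from hij)]
        · rw [if_neg hij]
          exact zero_le
      _ = _ := by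
        have hmi : ∀ i j, Measurable ((A i j).indicator (fun _ => w i * w j)) := fun i j =>
          measurable_const.indicator (hAm i j)
        rw [lintegral_const_mul' _ _ (ENNReal.natCast_ne_top _), lintegral_tsum]
        · congr 1
          refine tsum_congr fun i => ?_
          rw [lintegral_tsum]
          · refine tsum_congr fun j => ?_
            rw [lintegral_indicator_const (hAm i j), Measure.restrict_apply (hAm i j)]
          · exact fun j => (hmi i j).aemeasurable
        · exact fun i => (Measurable.tsum (hmi i)).aemeasurable
  have hdouble : (∑' i, ∑' j, w i * w j * volume (A i j ∩ G)) ≤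
      ∑ k ∈ Finset.Ico k0 (n+1), ENNReal.ofReal ((8 * 2^k / 2^n)^m) *
        ((Finset.Icc (-1 : Fin (m+1) → ℤ) 1).card * c k * a) := by
    calc _ ≤ ∑' i, ∑' j, ∑ k ∈ Finset.Ico k0 (n+1), ENNReal.ofReal ((8 * 2^k / 2^n)^m) *
          (if adj k (x i) (x j) then w i * w j else 0) := by
          refine ENNReal.tsum_le_tsum fun i => ENNReal.tsum_le_tsum fun j => ?_
          refine (mul_le_mul_right (hvol i j) _).trans (le_of_eq ?_)
          rw [Finset.mul_sum]
          refine Finset.sum_congr rfl fun k _ => ?_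
          split_ifs
          · rw [mul_comm]
          · simp
      _ = ∑ k ∈ Finset.Ico k0 (n+1), ENNReal.ofReal ((8 * 2^k / 2^n)^m) *
          ∑' i, ∑' j, (if adj k (x i) (x j) then w i * w j else 0) := by
          simp_rw [← ENNReal.tsum_mul_left]
          rw [← Summable.tsum_finsetSum (fun _ _ => ENNReal.summable)]
          refine tsum_congr fun i => ?_
          rw [← Summable.tsum_finsetSum (fun _ _ => ENNReal.summable)]
      _ ≤ _ := by
          refine Finset.sum_le_sum fun k hk => ?_
          rw [Finset.mem_Ico] at hk
          gcongr
          rw [← hwa]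
          exact adj_energy w x k (c k) (hw k (by omega) (by omega))
  have hfinal : a^2 * (1/2) ≤ ((Finset.Icc (-1 : Fin (m+1) → ℤ) 1).card * ENNReal.ofReal ((64 * L)^m) *
      ∑' k, ENNReal.ofReal ((2^(k + k0))^m) * c (k + k0)) * a := by
    refine (hint.trans (mul_le_mul' hScard hdouble)).trans ?_
    calc _ = ∑ k ∈ Finset.Ico k0 (n+1), (Finset.Icc (-1 : Fin (m+1) → ℤ) 1).card * 
            ENNReal.ofReal ((64 * L)^m) * (ENNReal.ofReal ((2^k)^m) * c k) * a := by
          rw [Finset.mul_sum]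
          refine Finset.sum_congr rfl fun k _ => ?_
          have : ENNReal.ofReal ((8 * L * 2^n)^m) * ENNReal.ofReal ((8 * 2^k / 2^n)^m)
              = ENNReal.ofReal ((64 * L)^m) * ENNReal.ofReal ((2^k)^m) := by
            rw [← ENNReal.ofReal_mul (by positivity), ← ENNReal.ofReal_mul (by positivity),
              ← mul_pow, ← mul_pow]
            congr 2
            field_simp
            ring
          rw [← mul_assoc, this]
          ring
      _ = (Finset.Icc (-1 : Fin (m+1) → ℤ) 1).card * ENNReal.ofReal ((64 * L)^m) *
          (∑ k ∈ Finset.Ico k0 (n+1), ENNReal.ofReal ((2^k)^m) * c k) * a := by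
          rw [Finset.mul_sum, Finset.sum_mul]
      _ ≤ _ := by
          gcongr
          rw [Finset.sum_Ico_eq_sum_range]
          simp_rw [add_comm k0]
          exact ENNReal.sum_le_tsum _
  rw [sq, mul_assoc, mul_comm] at hfinal
  exact (ENNReal.mul_le_mul_iff_left ha0 ha).1 hfinal

lemma geom_fin (m : ℕ) (s : ℝ) (hs : (m:ℝ) < s) :
    (∑' k : ℕ, ENNReal.ofReal ((2^k)^m) * (ENNReal.ofReal ((2^k)⁻¹))^s) ≠ ⊤ := by
  have h1 : ∀ k : ℕ, ENNReal.ofReal ((2^k)^m) * (ENNReal.ofReal ((2^k)⁻¹))^s =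
      (ENNReal.ofReal ((2:ℝ)^((m:ℝ) - s)))^k := by
    intro k
    rw [ENNReal.ofReal_rpow_of_pos (by positivity), ← ENNReal.ofReal_mul (by positivity),
      ← ENNReal.ofReal_pow (by positivity)]
    congr 1
    have h2 : (0:ℝ) ≤ 2 := by norm_num
    have h3 : (0:ℝ) < 2 := by norm_num
    rw [← Real.rpow_natCast 2 k, ← Real.rpow_neg h2, ← Real.rpow_natCast _ m, ← Real.rpow_mul h2,
      ← Real.rpow_mul h2, ← Real.rpow_natCast _ k, ← Real.rpow_mul h2, ← Real.rpow_add h3]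
    congr 1
    ring
  simp_rw [h1]
  rw [ENNReal.tsum_geometric]
  apply ENNReal.inv_ne_top.2
  rw [Ne, tsub_eq_zero_iff_le, not_le, ENNReal.ofReal_lt_one]
  exact Real.rpow_lt_one_of_one_lt_of_neg (by norm_num) (by linarith)

theorem slopeSet_pos {m : ℕ} (E : Set (Fin (m+1) → ℝ)) (hE : IsCompact E)
    (hdim : (m : ℝ≥0∞) < dimH E) : volume (slopeSet E) ≠ 0 := by
  intro h0
  obtain ⟨s, hs1, hs2⟩ := ENNReal.lt_iff_exists_nnreal_btwn.1 hdim
  have hs : (m:ℝ) < (s:ℝ) := by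
    have : ((m : NNReal) : ℝ≥0∞) < s := by simpa using hs1
    exact_mod_cast ENNReal.coe_lt_coe.1 this
  have hs0 : (0:ℝ) ≤ s := s.2
  have htop := hausdorffMeasure_of_lt_dimH hs2
  have hN : ∃ N : ℕ, OuterMeasure.mkMetric'.pre (fun A : Set (Fin (m+1) → ℝ) => ediam A ^ (s:ℝ))
      (N:ℝ≥0∞)⁻¹ E ≠ 0 := by
    by_contra hno
    push Not at hno
    have ht := OuterMeasure.mkMetric'.tendsto_pre_nat
      (fun A : Set (Fin (m+1) → ℝ) => ediam A ^ (s:ℝ)) E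
    simp_rw [hno] at ht
    have h1 := tendsto_nhds_unique ht tendsto_const_nhds
    have h2 : μH[(s:ℝ)] E = OuterMeasure.mkMetric (fun r => r ^ (s:ℝ)) E := by
      rw [OuterMeasure.coe_mkMetric]; rfl
    rw [h2] at htop
    have h3 : OuterMeasure.mkMetric (fun r => r ^ (s:ℝ)) E = 0 := h1
    rw [h3] at htop
    exact ENNReal.zero_ne_top htop
  obtain ⟨N, hN⟩ := hN
  set h := OuterMeasure.mkMetric'.pre (fun A : Set (Fin (m+1) → ℝ) => ediam A ^ (s:ℝ))
      (N:ℝ≥0∞)⁻¹ with hh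
  have hq : ∃ q0, h (E ∩ {x | dcell N x = q0}) ≠ 0 := by
    by_contra hno
    push Not at hno
    apply hN
    refine measure_mono_null (t := ⋃ q, E ∩ {x | dcell N x = q}) ?_ (measure_iUnion_null hno)
    intro x hx
    exact Set.mem_iUnion.2 ⟨dcell N x, hx, rfl⟩
  obtain ⟨q0, hq0⟩ := hq
  set F := E ∩ {x | dcell N x = q0} with hF
  set c : ℕ → ℝ≥0∞ := fun k => (ENNReal.ofReal ((2^k)⁻¹))^(s:ℝ) with hc
  have hcfin : ∀ k, c k ≠ ⊤ := fun k => ENNReal.rpow_ne_top_of_nonneg hs0 ENNReal.ofReal_ne_top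
  have hcell : ∀ k, N ≤ k → ∀ q, cellH h F k q ≤ c k := by
    intro k hk q
    have hd : ediam (F ∩ {x | dcell k x = q}) ≤ ENNReal.ofReal ((2^k)⁻¹) := by
      refine ediam_le fun x hx y hy => ?_
      rw [edist_dist]
      apply ENNReal.ofReal_le_ofReal
      have := dist_of_dcell_eq' k x y (hx.2.trans hy.2.symm)
      rw [← one_div, le_div_iff₀' (by positivity)]
      exact this
    refine (OuterMeasure.mkMetric'.pre_le (hd.trans ?_)).trans ?_
    · rw [ENNReal.ofReal_inv_of_pos (by positivity), ENNReal.inv_le_inv, ← ENNReal.ofReal_natCast]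
      apply ENNReal.ofReal_le_ofReal
      have h1 : N < 2^N := Nat.lt_two_pow_self
      have h2 : 2^N ≤ 2^k := Nat.pow_le_pow_right (by norm_num) hk
      exact_mod_cast h1.le.trans h2
    · exact ENNReal.rpow_le_rpow hd hs0
  have hFq : ∀ x ∈ F, dcell N x = q0 := fun x hx => hx.2
  have hFne : F.Nonempty := by
    rw [Set.nonempty_iff_ne_empty]
    intro he
    rw [he] at hq0
    simp at hq0
  have hFfin : h F ≠ ⊤ := by
    have h1 := hcell N le_rfl q0
    have h2 : F ∩ {x | dcell N x = q0} = F := Set.inter_eq_left.2 hFq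
    rw [cellH, h2] at h1
    exact (h1.trans_lt (hcfin N).lt_top).ne
  obtain ⟨R, hR⟩ := hE.isBounded.exists_norm_le
  obtain ⟨L, hL⟩ := exists_nat_ge (max R 1)
  have hL1 : 1 ≤ L := by exact_mod_cast (le_max_right R 1).trans hL
  have hLE : ∀ x ∈ E, ∀ i, |x i| ≤ L := fun x hx i =>
    (norm_le_pi_norm x i).trans ((hR x hx).trans ((le_max_left R 1).trans hL))
  have key : ∀ k0, N ≤ k0 → h F * (1/2) ≤
      (Finset.Icc (-1 : Fin (m+1) → ℤ) 1).card * ENNReal.ofReal ((64 * L)^m) *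
      ∑' k, ENNReal.ofReal ((2^(k + k0))^m) * c (k + k0) := by
    intro k0 hk0
    refine core_ineq E hE h0 L hL1 hLE k0 c (h F) hFfin hq0 ?_
    intro n hn
    obtain ⟨w, x, hx, hw, hwx⟩ := frostman_discrete h F N c hcfin hcell q0 hFq hFne n (hk0.trans hn)
    refine ⟨w, x, fun i => (hx i).1, hw, fun k hk hkn q => ?_⟩
    convert hwx k (hk0.trans hk) hkn q
  have ht := ENNReal.tendsto_sum_nat_add _ (geom_fin m s hs)
  have ht2 := ENNReal.Tendsto.const_mul (a := (Finset.Icc (-1 : Fin (m+1) → ℤ) 1).card *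
    ENNReal.ofReal ((64 * L)^m)) ht
    (Or.inr (ENNReal.mul_ne_top (ENNReal.natCast_ne_top _) ENNReal.ofReal_ne_top))
  rw [mul_zero] at ht2
  have := ge_of_tendsto ht2 (Filter.eventually_atTop.2 ⟨N, key⟩)
  have h2 : h F * (1/2) ≠ 0 := mul_ne_zero hq0 (by simp)
  exact h2 (le_antisymm this zero_le)

/-- Slope of a direction. -/
noncomputable def slopeMap {m : ℕ} (ω : EuclideanSpace ℝ (Fin (m+1))) : Fin m → ℝ :=
  fun i => ω i.succ / ω 0

lemma slopeMap_lip {m : ℕ} (N : ℕ) : ∃ K, LipschitzOnWith K (slopeMap (m := m))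
    {ω | ‖ω‖ ≤ 1 ∧ 1 ≤ (N:ℝ) * |ω 0|} := by
  refine ⟨2 * (N:NNReal)^2, LipschitzOnWith.of_dist_le_mul ?_⟩
  rintro x ⟨hx1, hx0⟩ y ⟨hy1, hy0⟩
  rw [dist_pi_le_iff (mul_nonneg NNReal.zero_le_coe dist_nonneg)]
  intro i
  simp only [slopeMap, NNReal.coe_mul, NNReal.coe_pow, NNReal.coe_natCast, NNReal.coe_ofNat]
  have hb : ∀ (z : EuclideanSpace ℝ (Fin (m+1))) j, |z j| ≤ ‖z‖ := fun z j => by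
    have := PiLp.norm_apply_le z j
    simpa using this
  have hd : ∀ j, |x j - y j| ≤ dist x y := fun j => by
    have := hb (x - y) j
    rw [dist_eq_norm]
    simpa using this
  have px : 0 < |x 0| := by
    by_contra hh
    have : |x 0| = 0 := le_antisymm (not_lt.1 hh) (abs_nonneg _)
    rw [this] at hx0
    norm_num at hx0
  have py : 0 < |y 0| := by
    by_contra hh
    have : |y 0| = 0 := le_antisymm (not_lt.1 hh) (abs_nonneg _)
    rw [this] at hy0
    norm_num at hy0
  have e1 := hd i.succ
  have e2 := hd 0
  have e3 := (hb y i.succ).trans hy1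
  have e4 := (hb y 0).trans hy1
  rw [Real.dist_eq, div_sub_div _ _ (abs_pos.1 px) (abs_pos.1 py), abs_div, abs_mul,
    div_le_iff₀ (mul_pos px py)]
  have hnum : |x i.succ * y 0 - x 0 * y i.succ| ≤ 2 * dist x y := by
    calc _ = |(x i.succ - y i.succ) * y 0 - (x 0 - y 0) * y i.succ| := by ring_nf
      _ ≤ |(x i.succ - y i.succ) * y 0| + |(x 0 - y 0) * y i.succ| := abs_sub _ _
      _ = |x i.succ - y i.succ| * |y 0| + |x 0 - y 0| * |y i.succ| := by rw [abs_mul, abs_mul]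
      _ ≤ dist x y * 1 + dist x y * 1 := by gcongr
      _ = _ := by ring
  refine hnum.trans ?_
  have hprod : 1 ≤ ((N:ℝ) * |x 0|) * (N * |y 0|) := by
    calc (1:ℝ) = 1 * 1 := by ring
      _ ≤ _ := by gcongr
  calc 2 * dist x y = 2 * dist x y * 1 := by ring
    _ ≤ 2 * dist x y * (((N:ℝ) * |x 0|) * (N * |y 0|)) := by gcongr
    _ = _ := by ring

lemma slopeSet_null {m : ℕ} (E : Set (EuclideanSpace ℝ (Fin (m+1))))
    (h : μH[(m:ℝ)] (directionSet E) = 0) :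
    volume (slopeSet (EuclideanSpace.equiv (Fin (m+1)) ℝ '' E)) = 0 := by
  have hv : (volume : Measure (Fin m → ℝ)) = μH[(m:ℝ)] := by
    rw [← hausdorffMeasure_pi_real, Fintype.card_fin]
  rw [hv]
  refine measure_mono_null (t := ⋃ N : ℕ, slopeMap '' (directionSet E ∩ {ω | ‖ω‖ ≤ 1 ∧ 1 ≤ (N:ℝ) * |ω 0|}))
    ?_ (measure_iUnion_null fun N => ?_)
  · rintro u ⟨_, ⟨x, hx, rfl⟩, _, ⟨y, hy, rfl⟩, hne, hu⟩
    have hxy : x ≠ y := fun h => hne (by rw [h])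
    have hi : ∀ i : Fin m, x i.succ - u i * x 0 = y i.succ - u i * y 0 := fun i => congrFun hu i
    have hx0 : x 0 - y 0 ≠ 0 := by
      intro h0
      apply hxy
      ext j
      refine Fin.cases ?_ (fun i => ?_) j
      · linarith
      · have := hi i
        have h1 : x 0 = y 0 := by linarith
        rw [h1] at this
        linarith
    have hn : 0 < ‖x - y‖ := norm_pos_iff.2 (sub_ne_zero.2 hxy)
    have hω0 : 0 < |(‖x - y‖⁻¹ • (x - y)) 0| := by
      rw [abs_pos]
      simp only [PiLp.smul_apply, PiLp.sub_apply, smul_eq_mul]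
      exact mul_ne_zero (inv_ne_zero hn.ne') hx0
    obtain ⟨N, hN⟩ := exists_nat_ge (1 / |(‖x - y‖⁻¹ • (x - y)) 0|)
    rw [div_le_iff₀ hω0] at hN
    rw [Set.mem_iUnion]
    refine ⟨N, ‖x - y‖⁻¹ • (x - y), ⟨⟨x, hx, y, hy, hxy, rfl⟩, ?_, hN⟩, ?_⟩
    · rw [norm_smul, norm_inv, norm_norm, inv_mul_cancel₀ hn.ne']
    · funext i
      simp only [slopeMap, PiLp.smul_apply, PiLp.sub_apply, smul_eq_mul]
      rw [mul_div_mul_left _ _ (inv_ne_zero hn.ne'), div_eq_iff hx0]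
      have := hi i
      linarith
  · obtain ⟨K, hK⟩ := slopeMap_lip (m := m) N
    have h1 := (hK.mono Set.inter_subset_right).hausdorffMeasure_image_le (s := directionSet E ∩ _)
      (d := (m:ℝ)) (Nat.cast_nonneg m)
    rw [measure_mono_null Set.inter_subset_left h, mul_zero] at h1
    exact le_antisymm h1 zero_le

theorem directions_of_large_dimH (d : ℕ) (hd : 2 ≤ d)
    (E : Set (EuclideanSpace ℝ (Fin d))) (hE : IsCompact E)
    (hdim : ((d : ℝ≥0∞) - 1) < dimH E) :
    0 < μH[((d : ℝ) - 1)] (directionSet E) := by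
  obtain ⟨m, rfl⟩ : ∃ m, d = m + 1 := ⟨d - 1, by omega⟩
  rw [pos_iff_ne_zero]
  intro h0
  have e1 : (((m+1 : ℕ) : ℝ) - 1) = (m:ℝ) := by push_cast; ring
  rw [e1] at h0
  have e2 : (((m+1 : ℕ) : ℝ≥0∞) - 1) = (m:ℝ≥0∞) := by
    push_cast
    exact ENNReal.add_sub_cancel_right ENNReal.one_ne_top
  rw [e2] at hdim
  refine slopeSet_pos (EuclideanSpace.equiv (Fin (m+1)) ℝ '' E) ?_ ?_ (slopeSet_null E h0)
  · exact hE.image (EuclideanSpace.equiv (Fin (m+1)) ℝ).continuous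
  · rwa [ContinuousLinearEquiv.dimH_image]
end

section
/- Let d ≥ 2, let s ∈ (d−1, d], and let μ be a Frostman probability measure with exponent s supported on a compact set E ⊆ ℝ^d. For Θ in the orthogonal group O(d), let μ^Θ be the pushforward of μ under Θ, let ν^Θ be the pushforward of μ^Θ × μ^Θ under the map (x,y) ↦ (x−y)/‖x−y‖ (which is defined off the diagonal; the diagonal is (μ^Θ×μ^Θ)-null), and for ω ∈ S^{d−1} and ε > 0 set ν^Θ_ε(ω) = ε^{−(d−1)} ν^Θ(B(ω,ε)), where B(ω,ε) is the ball of radius ε centered at ω. Then there exist a constant C > 0 and c₀ ∈ (0,1) such that: for every Θ ∈ O(d) there are measurable functions M^Θ : S^{d−1} → [0,∞) and R^Θ_ε : S^{d−1} → ℝ (for 0 < ε < c₀) with ν^Θ_ε(ω) = M^Θ(ω) + R^Θ_ε(ω) for all ω ∈ S^{d−1} and 0 < ε < c₀, with ∫_{S^{d−1}} sup_{0<ε<c} |R^Θ_ε(ω)| dσ(ω) ≤ C c^{s−(d−1)} for every c ∈ (0, c₀), and with ∫_{S^{d−1}} M^Θ(ω) dσ(ω) ≤ C; moreover there exists Θ₀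 ∈ O(d) such that ∫_{S^{d−1}} M^{Θ₀}(ω) dσ(ω) ≥ 1/C. -/
open MeasureTheory Metric

/-- The pushforward of `(μ∘Θ⁻¹) × (μ∘Θ⁻¹)` under the direction map
`(x, y) ↦ (x − y)/‖x − y‖`. -/
noncomputable def dirMeasure {d : ℕ} (μ : Measure (EuclideanSpace ℝ (Fin d)))
    (Θ : EuclideanSpace ℝ (Fin d) ≃ₗᵢ[ℝ] EuclideanSpace ℝ (Fin d)) :
    Measure (EuclideanSpace ℝ (Fin d)) :=
  Measure.map (fun p : EuclideanSpace ℝ (Fin d) × EuclideanSpace ℝ (Fin d) =>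
      ‖p.1 - p.2‖⁻¹ • (p.1 - p.2))
    ((μ.map Θ).prod (μ.map Θ))

/-- Surface measure on the unit sphere `S^{d−1}`: the `(d−1)`-dimensional Hausdorff
measure restricted to the sphere. -/
noncomputable def sphereMeasure (d : ℕ) : Measure (EuclideanSpace ℝ (Fin d)) :=
  (μH[((d : ℝ) - 1)]).restrict (sphere (0 : EuclideanSpace ℝ (Fin d)) 1)



abbrev Eu (d : ℕ) := EuclideanSpace ℝ (Fin d)

noncomputable def S0 (d : ℕ) : Measure (Eu d) :=
  Measure.map Subtype.val (volume : Measure (Eu d)).toSphere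

instance S0_finite (d : ℕ) : IsFiniteMeasure (S0 d) := by
  unfold S0; infer_instance

lemma S0_polar (d : ℕ) (F : Eu d → ENNReal) (hF : Measurable F) (hd : 2 ≤ d) :
    ∫⁻ x, F x = ∫⁻ ω, (∫⁻ r in Set.Ioi (0:ℝ), ENNReal.ofReal (r ^ (d-1)) * F (r • ω)) ∂(S0 d) := by
  have : Nontrivial (Eu d) := by
    have : Nonempty (Fin d) := ⟨⟨0, by omega⟩⟩
    infer_instance
  have hmp := (volume : Measure (Eu d)).measurePreserving_homeomorphUnitSphereProd
  have h1 : ∫⁻ x, F x = ∫⁻ x : ({(0 : Eu d)}ᶜ : Set (Eu d)), F x.1 ∂(Measure.comap Subtype.val volume) := by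
    rw [lintegral_subtype_comap (measurableSet_singleton _).compl F, restrict_compl_singleton]
  have h2 : ∫⁻ x : ({(0 : Eu d)}ᶜ : Set (Eu d)), F x.1 ∂(Measure.comap Subtype.val volume)
      = ∫⁻ p, F (p.2.1 • p.1.1) ∂((volume : Measure (Eu d)).toSphere.prod
        (Measure.volumeIoiPow (Module.finrank ℝ (Eu d) - 1))) := by
    rw [← hmp.lintegral_comp_emb (Homeomorph.measurableEmbedding _)]
    refine lintegral_congr fun x => ?_
    congr 1
    have hx : ‖x.1‖ ≠ 0 := norm_ne_zero_iff.2 x.2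
    simp [smul_inv_smul₀ hx]
  rw [h1, h2, lintegral_prod _ (by fun_prop), S0, lintegral_map _ measurable_subtype_coe]
  · refine lintegral_congr fun ω => ?_
    rw [Measure.volumeIoiPow, lintegral_withDensity_eq_lintegral_mul _ (by fun_prop) (by fun_prop)]
    simp only [Pi.mul_apply, finrank_euclideanSpace, Fintype.card_fin]
    exact lintegral_subtype_comap measurableSet_Ioi
      (fun r : ℝ => ENNReal.ofReal (r^(d-1)) * F (r • ω.1))
  · apply Measurable.lintegral_prod_right
    fun_prop

lemma S0_compl (d : ℕ) : S0 d (sphere 0 1)ᶜ = 0 := by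
  rw [S0, Measure.map_apply measurable_subtype_coe isClosed_sphere.measurableSet.compl]
  convert measure_empty (μ := (volume : Measure (Eu d)).toSphere)
  ext x
  have := x.2
  simpa using this

lemma S0_ae (d : ℕ) : ∀ᵐ ω ∂(S0 d), ω ∈ sphere (0 : Eu d) 1 := S0_compl d

/-- cone formula -/
lemma S0_apply (d : ℕ) (A : Set (Eu d)) (hA : MeasurableSet A) (hd : 2 ≤ d) :
    S0 d A = d * volume {x : Eu d | x ≠ 0 ∧ ‖x‖ < 1 ∧ ‖x‖⁻¹ • x ∈ A} := by
  rw [S0, Measure.map_apply measurable_subtype_coe hA,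
    Measure.toSphere_apply' _ (measurable_subtype_coe hA)]
  simp only [finrank_euclideanSpace, Fintype.card_fin]
  congr 2
  ext x
  simp only [Set.mem_smul, Set.mem_image, Set.mem_preimage, Set.mem_ofPred_eq]
  constructor
  · rintro ⟨r, hr, y, ⟨z, hz, rfl⟩, rfl⟩
    have hz1 : ‖z.1‖ = 1 := by simpa using z.2
    have hn : ‖r • z.1‖ = r := by rw [norm_smul, hz1, Real.norm_of_nonneg hr.1.le, mul_one]
    refine ⟨?_, by rw [hn]; exact hr.2, ?_⟩
    · rw [← norm_ne_zero_iff, hn]; exact hr.1.ne'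
    · rw [hn, inv_smul_smul₀ hr.1.ne']; exact hz
  · rintro ⟨h0, h1, h2⟩
    have hp : 0 < ‖x‖ := norm_pos_iff.2 h0
    refine ⟨‖x‖, ⟨hp, h1⟩, ‖x‖⁻¹ • x, ⟨⟨‖x‖⁻¹ • x, ?_⟩, h2, rfl⟩, smul_inv_smul₀ hp.ne' x⟩
    simp [norm_smul, hp.ne']

lemma S0_iso (d : ℕ) (hd : 2 ≤ d) (Θ : Eu d ≃ₗᵢ[ℝ] Eu d) (a : Eu d) (r : ℝ) :
    S0 d (ball (Θ a) r) = S0 d (ball a r) := by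
  rw [S0_apply d _ measurableSet_ball hd, S0_apply d _ measurableSet_ball hd]
  congr 1
  rw [← Θ.measurePreserving.measure_preimage_equiv (f := Θ.toMeasurableEquiv)]
  congr 1
  ext x
  simp only [Set.mem_preimage, Set.mem_ofPred_eq, mem_ball]
  have : Θ.toMeasurableEquiv x = Θ x := rfl
  rw [this]
  simp only [LinearIsometryEquiv.norm_map, ← map_smul, Θ.dist_map]
  simp

lemma exists_iso (d : ℕ) (a b : Eu d) (h : ‖a‖ = ‖b‖) : ∃ Θ : Eu d ≃ₗᵢ[ℝ] Eu d, Θ a = b :=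
  ⟨_, Submodule.reflection_sub h⟩

lemma S0_ball_eq (d : ℕ) (hd : 2 ≤ d) (a b : Eu d) (ha : ‖a‖ = 1) (hb : ‖b‖ = 1) (r : ℝ) :
    S0 d (ball a r) = S0 d (ball b r) := by
  obtain ⟨Θ, rfl⟩ := exists_iso d a b (by rw [ha, hb])
  rw [S0_iso d hd]

lemma S0_univ_pos (d : ℕ) (hd : 2 ≤ d) : 0 < S0 d Set.univ := by
  have : Nontrivial (Eu d) := by
    have : Nonempty (Fin d) := ⟨⟨0, by omega⟩⟩
    infer_instance
  rw [S0, Measure.map_apply measurable_subtype_coe .univ]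
  rw [Set.preimage_univ, pos_iff_ne_zero, Ne, Measure.measure_univ_eq_zero]
  exact Measure.toSphere_ne_zero _


lemma normalize_lip {F : Type*} [NormedAddCommGroup F] [NormedSpace ℝ F] :
    LipschitzOnWith 2 (fun x : F => ‖x‖⁻¹ • x) {x | 1 ≤ ‖x‖} := by
  refine LipschitzOnWith.of_dist_le_mul fun x hx y hy => ?_
  have hx' : 1 ≤ ‖x‖ := hx
  have hy' : 1 ≤ ‖y‖ := hy
  have hx0 : 0 < ‖x‖ := by linarith
  have hy0 : 0 < ‖y‖ := by linarith
  rw [dist_eq_norm, dist_eq_norm]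
  have e : ‖x‖⁻¹ • x - ‖y‖⁻¹ • y = ‖x‖⁻¹ • (x - y) + (‖x‖⁻¹ - ‖y‖⁻¹) • y := by
    rw [smul_sub, sub_smul]; abel
  rw [e]
  have h1 : ‖‖x‖⁻¹ • (x - y)‖ ≤ ‖x - y‖ := by
    rw [norm_smul, norm_inv, norm_norm]
    exact mul_le_of_le_one_left (norm_nonneg _) (inv_le_one_of_one_le₀ hx')
  have h2 : ‖(‖x‖⁻¹ - ‖y‖⁻¹) • y‖ ≤ ‖x - y‖ := by
    rw [norm_smul]
    have : ‖‖x‖⁻¹ - ‖y‖⁻¹‖ * ‖y‖ = ‖x‖⁻¹ * |‖y‖ - ‖x‖| := by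
      have : ‖x‖⁻¹ - ‖y‖⁻¹ = ‖x‖⁻¹ * (‖y‖ - ‖x‖) * ‖y‖⁻¹ := by field_simp
      rw [this, Real.norm_eq_abs, abs_mul, abs_mul, abs_of_pos (inv_pos.2 hx0), abs_of_pos (inv_pos.2 hy0)]
      field_simp
    rw [this]
    refine (mul_le_of_le_one_left (abs_nonneg _) (inv_le_one_of_one_le₀ hx')).trans ?_
    rw [abs_sub_comm]
    exact abs_norm_sub_norm_le x y
  calc _ ≤ _ := norm_add_le _ _
    _ ≤ ‖x - y‖ + ‖x - y‖ := add_le_add h1 h2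
    _ = _ := by push_cast; ring

lemma insertNth_lip (n : ℕ) (i : Fin (n+1)) (σ : ℝ) :
    LipschitzWith 1 (fun y : Fin n → ℝ => (Fin.insertNth (α := fun _ => ℝ) i σ y)) := by
  refine LipschitzWith.of_dist_le_mul fun y z => ?_
  rw [NNReal.coe_one, one_mul, dist_pi_le_iff dist_nonneg]
  intro j
  refine Fin.succAboveCases i ?_ ?_ j
  · simp
  · intro k
    simpa using dist_le_pi_dist y z k

lemma hausdorff_sphere_lt_top (n : ℕ) : μH[(n:ℝ)] (sphere (0 : Eu (n+1)) 1) < ⊤ := by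
  classical
  have hl := PiLp.lipschitzWith_toLp 2 (fun _ : Fin (n+1) => ℝ)
  let g : Fin (n+1) → ℝ → (Fin n → ℝ) → Eu (n+1) :=
    fun i σ y => WithLp.toLp 2 (Fin.insertNth (α := fun _ => ℝ) i σ y)
  have hg1 : ∀ i σ, |σ| = 1 → ∀ y, 1 ≤ ‖g i σ y‖ := by
    intro i σ hσ y
    have := PiLp.norm_apply_le (g i σ y) i
    simpa [g, hσ] using this
  let Q : Set (Fin n → ℝ) := Set.Icc (fun _ => -1) (fun _ => 1)
  have hfin : ∀ i σ, |σ| = 1 → μH[(n:ℝ)] ((fun y => ‖g i σ y‖⁻¹ • g i σ y) '' Q) < ⊤ := by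
    intro i σ hσ
    obtain ⟨K, hlip⟩ : ∃ K, LipschitzWith K (fun y => ‖g i σ y‖⁻¹ • g i σ y) := by
      have := normalize_lip (F := Eu (n+1)).comp
        ((hl.comp (insertNth_lip n i σ)).lipschitzOnWith (s := Set.univ)) (by intro y _; exact hg1 i σ hσ y)
      exact ⟨_, lipschitzOnWith_univ.1 this⟩
    refine (hlip.hausdorffMeasure_image_le (d := (n:ℝ)) (by positivity) Q).trans_lt ?_
    refine ENNReal.mul_lt_top (ENNReal.rpow_lt_top_of_nonneg (by positivity) (by simp)) ?_
    have := hausdorffMeasure_pi_real (ι := Fin n)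
    rw [Fintype.card_fin] at this
    rw [this]
    exact isCompact_Icc.measure_lt_top
  have hsub : sphere (0 : Eu (n+1)) 1 ⊆ ⋃ i : Fin (n+1), 
     (((fun y => ‖g i 1 y‖⁻¹ • g i 1 y) '' Q) ∪ ((fun y => ‖g i (-1) y‖⁻¹ • g i (-1) y) '' Q)) := by
    intro ω hω
    have hω1 : ‖ω‖ = 1 := by simpa using hω
    obtain ⟨i, -, hi⟩ := Finset.exists_max_image Finset.univ (fun i => |ω i|) ⟨0, Finset.mem_univ _⟩
    have hi0 : 0 < |ω i| := by
      by_contra h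
      have h0 : ω = 0 := by
        ext j
        have := hi j (Finset.mem_univ _)
        have h3 : |ω j| ≤ 0 := by linarith
        simpa using h3
      rw [h0] at hω1; simp at hω1
    rw [Set.mem_iUnion]
    refine ⟨i, ?_⟩
    have key : ∀ σ : ℝ, ω i = σ * |ω i| → ∃ y ∈ Q, ‖g i σ y‖⁻¹ • g i σ y = ω := by
      intro σ hσ
      refine ⟨fun j => ω (i.succAbove j) / |ω i|, ?_, ?_⟩
      · constructor <;> intro j
        · have := hi (i.succAbove j) (Finset.mem_univ _)
          show -1 ≤ ω (i.succAbove j) / |ω i|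
          rw [le_div_iff₀ hi0]
          have := neg_abs_le (ω (i.succAbove j)); linarith
        · have := hi (i.succAbove j) (Finset.mem_univ _)
          show ω (i.succAbove j) / |ω i| ≤ 1
          rw [div_le_iff₀ hi0]
          have := le_abs_self (ω (i.succAbove j)); linarith
      · have e : g i σ (fun j => ω (i.succAbove j) / |ω i|) = |ω i|⁻¹ • ω := by
          ext j
          refine Fin.succAboveCases i ?_ ?_ j
          · simp only [g, Fin.insertNth_apply_same, PiLp.smul_apply, smul_eq_mul]
            rw [← div_eq_inv_mul, eq_div_iff hi0.ne', ← hσ]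
          · intro k
            simp [g, div_eq_inv_mul]
        rw [e, norm_smul, hω1, norm_inv, Real.norm_eq_abs, abs_abs, mul_one, inv_inv, smul_inv_smul₀ hi0.ne']
    rcases abs_cases (ω i) with ⟨h, _⟩ | ⟨h, _⟩
    · left
      exact key 1 (by rw [h]; ring)
    · right
      exact key (-1) (by rw [h]; ring)
  refine (measure_mono hsub).trans_lt ?_
  refine (measure_iUnion_le _).trans_lt ?_
  rw [tsum_fintype]
  refine ENNReal.sum_lt_top.2 fun i _ => (measure_union_le _ _).trans_lt ?_
  exact ENNReal.add_lt_top.2 ⟨hfin i 1 (by simp), hfin i (-1) (by simp)⟩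

lemma hausdorff_sphere_pos (n : ℕ) : 0 < μH[(n:ℝ)] (sphere (0 : Eu (n+1)) 1) := by
  let p : Eu (n+1) → (Fin n → ℝ) := fun x j => x j.succ
  have hp : LipschitzWith 1 p := by
    refine LipschitzWith.of_dist_le_mul fun x y => ?_
    rw [NNReal.coe_one, one_mul, dist_pi_le_iff dist_nonneg]
    intro j
    rw [dist_eq_norm, dist_eq_norm]
    exact PiLp.norm_apply_le (x - y) j.succ
  have h := hp.hausdorffMeasure_image_le (d := (n:ℝ)) (by positivity) (sphere 0 1)
  have hv := hausdorffMeasure_pi_real (ι := Fin n)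
  rw [Fintype.card_fin] at hv
  simp only [ENNReal.coe_one, ENNReal.one_rpow, one_mul] at h
  refine lt_of_lt_of_le ?_ h
  rw [hv]
  have ho : IsOpen {y : Fin n → ℝ | ∑ j, y j ^ 2 < 1} := isOpen_lt (by fun_prop) (by fun_prop)
  refine (ho.measure_pos volume ⟨0, by simp⟩).trans_le (measure_mono ?_)
  intro y hy
  have hy' : ∑ j, y j ^ 2 < 1 := hy
  refine ⟨WithLp.toLp 2 (Fin.cons (√(1 - ∑ j, y j ^ 2)) y), ?_, ?_⟩
  · rw [mem_sphere_zero_iff_norm, EuclideanSpace.norm_eq, Real.sqrt_eq_one, Fin.sum_univ_succ]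
    simp only [Fin.cons_zero, Fin.cons_succ, Real.norm_eq_abs, sq_abs]
    rw [Real.sq_sqrt (by linarith)]; ring
  · ext j; simp [p]


lemma unif_aux {X : Type*} [MetricSpace X] [SecondCountableTopology X] [MeasurableSpace X] [BorelSpace X]
    (α β : Measure X) [IsFiniteMeasure α] [IsFiniteMeasure β] (K : Set X) (hK : IsCompact K)
    (hα : ∀ᵐ x ∂α, x ∈ K) (hβ : ∀ᵐ x ∂β, x ∈ K)
    (ha : ∀ r, ∀ x ∈ K, ∀ y ∈ K, α (ball x r) = α (ball y r))
    (hb : ∀ r, ∀ x ∈ K, ∀ y ∈ K, β (ball x r) = β (ball y r))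
    (f : X → NNReal) (hf : Continuous f) :
    β Set.univ * ∫⁻ x, f x ∂α ≤ α Set.univ * ∫⁻ x, f x ∂β := by
  rcases eq_or_ne (β Set.univ) 0 with hb0 | hb0
  · simp [hb0]
  have hbK : β K ≠ 0 := by
    intro h
    apply hb0
    rw [← Set.union_compl_self K]
    exact measure_union_null h hβ
  obtain ⟨x₀, hx₀⟩ : K.Nonempty := by
    rw [Set.nonempty_iff_ne_empty]; rintro rfl; simp at hbK
  -- main estimate
  have key : ∀ η : NNReal, 0 < η → β Set.univ * ∫⁻ x, f x ∂α ≤ α Set.univ * ∫⁻ x, f x ∂β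
      + η * (α Set.univ * β Set.univ) := by
    intro η hη
    have huc := hK.uniformContinuousOn_of_continuous hf.continuousOn
    obtain ⟨r, hr, hfr⟩ := Metric.uniformContinuousOn_iff.1 huc η (by exact_mod_cast hη)
    set h := α (ball x₀ r) with hh
    set h' := β (ball x₀ r) with hh'
    have hfle : ∀ x ∈ K, ∀ y ∈ K, dist x y < r → (f x : ENNReal) ≤ f y + η := by
      intro x hx y hy hxy
      have := hfr x hx y hy hxy
      rw [NNReal.dist_eq] at this
      have h2 : (f x : ℝ) ≤ f y + η := by have := (abs_lt.1 this).2; linarith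
      exact_mod_cast h2
    have hm : MeasurableSet {p : X × X | dist p.1 p.2 < r} :=
      (isOpen_lt (by fun_prop) (by fun_prop)).measurableSet
    have hind : Measurable (fun p : X × X => Set.indicator {p : X × X | dist p.1 p.2 < r} (fun _ => (1:ENNReal)) p) :=
      measurable_const.indicator hm
    have hI1 : ∀ x ∈ K, ∫⁻ y, Set.indicator {p : X × X | dist p.1 p.2 < r} (fun _ => (1:ENNReal)) (x, y) ∂β = h' := by
      intro x hx
      rw [hh', hb r x₀ hx₀ x hx, ← lintegral_indicator_one measurableSet_ball]
      refine lintegral_congr fun y => ?_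
      simp [Set.indicator, dist_comm]
    have hI2 : ∀ y ∈ K, ∫⁻ x, Set.indicator {p : X × X | dist p.1 p.2 < r} (fun _ => (1:ENNReal)) (x, y) ∂α = h := by
      intro x hx
      rw [hh, ha r x₀ hx₀ x hx, ← lintegral_indicator_one measurableSet_ball]
      refine lintegral_congr fun y => ?_
      simp [Set.indicator]
    set J : X → X → ENNReal := fun x y => Set.indicator {p : X × X | dist p.1 p.2 < r} (fun _ => (1:ENNReal)) (x, y) with hJ
    have hJm : Measurable (fun p : X × X => J p.1 p.2) := hind
    have hJ1 : ∀ x, Measurable (fun y => J x y) := fun x => hJm.comp measurable_prodMk_left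
    have hJ2 : ∀ y, Measurable (fun x => J x y) := fun x => hJm.comp measurable_prodMk_right
    have hfm : Measurable (fun x => (f x : ENNReal)) := (ENNReal.continuous_coe.comp hf).measurable
    have e0 : h' * α Set.univ = h * β Set.univ := by
      have e1 : ∫⁻ x, ∫⁻ y, J x y ∂β ∂α = h' * α Set.univ := by
        rw [lintegral_congr_ae (g := fun _ => h') (by filter_upwards [hα] with x hx using hI1 x hx), lintegral_const]
      have e2 : ∫⁻ y, ∫⁻ x, J x y ∂α ∂β = h * β Set.univ := by
        rw [lintegral_congr_ae (g := fun _ => h) (by filter_upwards [hβ] with x hx using hI2 x hx), lintegral_const]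
      rw [← e1, ← e2]
      exact lintegral_lintegral_swap hJm.aemeasurable
    have e3 : h' * ∫⁻ x, f x ∂α ≤ h * ∫⁻ x, f x ∂β + η * (h' * α Set.univ) := by
      calc h' * ∫⁻ x, f x ∂α = ∫⁻ x, ∫⁻ y, f x * J x y ∂β ∂α := by
            rw [← lintegral_const_mul _ hfm]
            refine lintegral_congr_ae ?_
            filter_upwards [hα] with x hx
            rw [lintegral_const_mul _ (hJ1 x), hI1 x hx, mul_comm]
        _ ≤ ∫⁻ x, ∫⁻ y, (f y + η) * J x y ∂β ∂α := by
            refine lintegral_mono_ae ?_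
            filter_upwards [hα] with x hx
            refine lintegral_mono_ae ?_
            filter_upwards [hβ] with y hy
            by_cases hxy : dist x y < r
            · exact mul_le_mul_left (hfle x hx y hy hxy) _
            · simp [J, hxy]
        _ = ∫⁻ y, ∫⁻ x, (f y + η) * J x y ∂α ∂β := lintegral_lintegral_swap (by fun_prop)
        _ = ∫⁻ y, (f y + η) * h ∂β := by
            refine lintegral_congr_ae ?_
            filter_upwards [hβ] with y hy
            rw [lintegral_const_mul _ (hJ2 y), hI2 y hy]
        _ = _ := by
            rw [lintegral_mul_const _ (by fun_prop), lintegral_add_left hfm, lintegral_const, e0]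
            ring
    have hh0 : h' ≠ 0 := by
      intro h0
      apply hbK
      refine hK.measure_zero_of_nhdsWithin fun x hx => ⟨ball x r, ?_, ?_⟩
      · exact mem_nhdsWithin_of_mem_nhds (ball_mem_nhds x hr)
      · rw [hb r x hx x₀ hx₀]; exact h0
    have hht : h' ≠ ⊤ := measure_ne_top _ _
    have e4 : h' * (β Set.univ * ∫⁻ x, f x ∂α) ≤ h' * (α Set.univ * ∫⁻ x, f x ∂β + η * (α Set.univ * β Set.univ)) := by
      calc h' * (β Set.univ * ∫⁻ x, f x ∂α) = β Set.univ * (h' * ∫⁻ x, f x ∂α) := by ring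
        _ ≤ β Set.univ * (h * ∫⁻ x, f x ∂β + η * (h' * α Set.univ)) := by gcongr
        _ = (h * β Set.univ) * ∫⁻ x, f x ∂β + η * (h' * α Set.univ) * β Set.univ := by ring
        _ = _ := by rw [← e0]; ring
    exact (ENNReal.mul_le_mul_iff_right hh0 hht).1 e4
  have hAB : α Set.univ * β Set.univ ≠ ⊤ := ENNReal.mul_ne_top (measure_ne_top _ _) (measure_ne_top _ _)
  refine ENNReal.le_of_forall_pos_le_add fun δ hδ _ => ?_
  set T := (α Set.univ * β Set.univ).toNNReal with hT
  have hT' : α Set.univ * β Set.univ = T := (ENNReal.coe_toNNReal hAB).symm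
  refine (key (δ / (T + 1)) (by positivity)).trans ?_
  gcongr
  rw [hT', ← ENNReal.coe_mul, ENNReal.coe_le_coe]
  rw [div_mul_eq_mul_div, div_le_iff₀ (by positivity)]
  gcongr
  simp

lemma unif_prop {X : Type*} [MetricSpace X] [SecondCountableTopology X] [MeasurableSpace X] [BorelSpace X]
    (α β : Measure X) [IsFiniteMeasure α] [IsFiniteMeasure β] (K : Set X) (hK : IsCompact K)
    (hα : ∀ᵐ x ∂α, x ∈ K) (hβ : ∀ᵐ x ∂β, x ∈ K)
    (ha : ∀ r, ∀ x ∈ K, ∀ y ∈ K, α (ball x r) = α (ball y r))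
    (hb : ∀ r, ∀ x ∈ K, ∀ y ∈ K, β (ball x r) = β (ball y r)) :
    β Set.univ • α = α Set.univ • β := by
  have : IsFiniteMeasure (β Set.univ • α) := ⟨by
    simp only [Measure.smul_apply, smul_eq_mul]
    exact ENNReal.mul_lt_top (measure_lt_top _ _) (measure_lt_top _ _)⟩
  refine ext_of_forall_lintegral_eq_of_IsFiniteMeasure fun f => ?_
  rw [lintegral_smul_measure, lintegral_smul_measure]
  exact le_antisymm (unif_aux α β K hK hα hβ ha hb f f.continuous) (unif_aux β α K hK hβ hα hb ha f f.continuous)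

lemma sphereMeasure_map (d : ℕ) (Θ : Eu d ≃ₗᵢ[ℝ] Eu d) :
    MeasurePreserving Θ (sphereMeasure d) (sphereMeasure d) := by
  have h := Θ.toIsometryEquiv.measurePreserving_hausdorffMeasure ((d:ℝ) - 1)
  have := h.restrict_preimage (s := sphere (0 : Eu d) 1) isClosed_sphere.measurableSet
  have e : (Θ.toIsometryEquiv : Eu d → Eu d) ⁻¹' sphere (0 : Eu d) 1 = sphere 0 1 := by
    ext x; simp
  rw [e] at this
  exact this

lemma sphereMeasure_univ (d : ℕ) (hd : 2 ≤ d) :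
    0 < sphereMeasure d Set.univ ∧ sphereMeasure d Set.univ < ⊤ := by
  obtain ⟨n, rfl⟩ : ∃ n, d = n + 1 := ⟨d - 1, by omega⟩
  rw [sphereMeasure, Measure.restrict_apply_univ]
  have : ((n + 1 : ℕ) : ℝ) - 1 = n := by push_cast; ring
  rw [this]
  exact ⟨hausdorff_sphere_pos n, hausdorff_sphere_lt_top n⟩

lemma sphereMeasure_eq (d : ℕ) (hd : 2 ≤ d) :
    ∃ c : ℝ, 0 < c ∧ sphereMeasure d = ENNReal.ofReal c • S0 d := by
  obtain ⟨hp, hf⟩ := sphereMeasure_univ d hd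
  have : IsFiniteMeasure (sphereMeasure d) := ⟨hf⟩
  have hp0 := S0_univ_pos d hd
  have := unif_prop (sphereMeasure d) (S0 d) (sphere 0 1) (isCompact_sphere _ _)
    (ae_restrict_mem isClosed_sphere.measurableSet) (S0_ae d) ?_ ?_
  · have hne : S0 d Set.univ ≠ ⊤ := measure_ne_top _ _
    refine ⟨(sphereMeasure d Set.univ / S0 d Set.univ).toReal, ENNReal.toReal_pos ?_ ?_, ?_⟩
    · exact (ENNReal.div_pos hp.ne' hne).ne'
    · exact ENNReal.div_ne_top hf.ne hp0.ne'
    · rw [ENNReal.ofReal_toReal (ENNReal.div_ne_top hf.ne hp0.ne'), ENNReal.div_eq_inv_mul, mul_smul, ← this,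
        ← mul_smul, ENNReal.inv_mul_cancel hp0.ne' hne, one_smul]
  · intro r x hx y hy
    obtain ⟨Θ, rfl⟩ := exists_iso d x y (by simp at hx hy; rw [hx, hy])
    rw [← (sphereMeasure_map d Θ).measure_preimage measurableSet_ball.nullMeasurableSet (s := ball (Θ x) r)]
    congr 1; ext z; simp
  · intro r x hx y hy
    exact S0_ball_eq d hd x y (by simpa using hx) (by simpa using hy) r


def coneT (n : ℕ) (a m : ℝ) : Set (Eu (n+1)) :=
  {x | 0 < x 0 ∧ x 0 < a ∧ ∑ j : Fin n, (x j.succ)^2 < m^2 * (x 0)^2}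

lemma coneT_vol (n : ℕ) (a m : ℝ) (ha : 0 < a) (hm : 0 < m) :
    volume (coneT n a m) = ENNReal.ofReal (a^(n+1) * m^n) * volume (coneT n 1 1) := by
  classical
  let v : Fin (n+1) → ℝ := Fin.cons a (fun _ => a * m)
  let L : Eu (n+1) →ₗ[ℝ] Eu (n+1) := Matrix.toEuclideanLin (Matrix.diagonal v)
  have hL : ∀ x j, (L x) j = v j * x j := by
    intro x j
    simp [L, Matrix.toEuclideanLin, Matrix.toLpLin, Matrix.mulVec_diagonal]
  have hdet : LinearMap.det L = a^(n+1) * m^n := by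
    simp only [L]
    rw [Matrix.toEuclideanLin_eq_toLin, LinearMap.det_toLin, Matrix.det_diagonal, Fin.prod_univ_succ]
    simp [v]; ring
  have hpos : 0 < a^(n+1) * m^n := by positivity
  have e : coneT n 1 1 = L ⁻¹' (coneT n a m) := by
    ext x
    simp only [coneT, Set.mem_ofPred_eq, Set.mem_preimage, hL, v, Fin.cons_zero, Fin.cons_succ]
    have h1 : ∑ j : Fin n, (a * m * x j.succ)^2 = (a*m)^2 * ∑ j : Fin n, (x j.succ)^2 := by
      rw [Finset.mul_sum]; simp [mul_pow]
    have h2 : m^2 * (a * x 0)^2 = (a*m)^2 * (1^2 * (x 0)^2) := by ring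
    rw [h1, h2, mul_lt_mul_iff_right₀ (by positivity), mul_pos_iff_of_pos_left ha]
    have : a * x 0 < a ↔ x 0 < 1 := by
      constructor <;> intro h <;> nlinarith
    rw [this]
  rw [e, Measure.addHaar_preimage_linearMap _ (by rw [hdet]; exact hpos.ne'), hdet, ← mul_assoc,
    ← ENNReal.ofReal_mul hpos.le, abs_of_pos (inv_pos.2 hpos), mul_inv_cancel₀ hpos.ne']
  simp

lemma norm_sq_split (n : ℕ) (x : Eu (n+1)) : ‖x‖^2 = (x 0)^2 + ∑ j : Fin n, (x j.succ)^2 := by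
  rw [EuclideanSpace.norm_sq_eq, Fin.sum_univ_succ]; simp

lemma coneT_fin (n : ℕ) : volume (coneT n 1 1) < ⊤ := by
  refine (measure_mono (t := ball 0 2) ?_).trans_lt measure_ball_lt_top
  rintro x ⟨h1, h2, h3⟩
  rw [mem_ball_zero_iff]
  have := norm_sq_split n x
  nlinarith [norm_nonneg x]

lemma coneT_pos (n : ℕ) : 0 < volume (coneT n 1 1) := by
  have ho : IsOpen (coneT n 1 1) := by
    have h0 : ∀ i, Continuous (fun x : Eu (n+1) => x i) := fun i => by fun_prop
    have h3 : IsOpen {x : Eu (n+1) | ∑ j : Fin n, (x j.succ)^2 < 1^2 * (x 0)^2} :=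
      isOpen_lt (by fun_prop) (by fun_prop)
    exact (isOpen_lt continuous_const (h0 0)).inter ((isOpen_lt (h0 0) continuous_const).inter h3)
  refine ho.measure_pos volume ⟨WithLp.toLp 2 (Fin.cons (1/2) 0), ?_⟩
  refine ⟨?_, ?_, ?_⟩ <;> simp <;> norm_num

lemma cap_asymp (d : ℕ) (hd : 2 ≤ d) :
    ∃ κ C : ℝ, 0 < κ ∧ 0 < C ∧ ∀ ε : ℝ, 0 < ε → ε < 1 → ∀ ω ∈ sphere (0 : Eu d) 1,
      |ε ^ (-((d : ℝ) - 1)) * (S0 d (ball ω ε)).toReal - κ| ≤ C * ε := by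
  obtain ⟨n, rfl⟩ : ∃ n, d = n + 1 := ⟨d - 1, by omega⟩
  set V := (volume (coneT n 1 1)).toReal with hV
  have hVpos : 0 < V := ENNReal.toReal_pos (coneT_pos n).ne' (coneT_fin n).ne
  refine ⟨(n+1) * V, (n+1) * V * (2^n * (n + 1)), by positivity, by positivity, ?_⟩
  intro ε hε hε1 ω hω
  let e0 : Eu (n+1) := EuclideanSpace.single 0 1
  have he0 : ‖e0‖ = 1 := by simp [e0]
  rw [S0_ball_eq (n+1) hd ω e0 (by simpa using hω) he0, S0_apply _ _ measurableSet_ball hd]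
  set A : Set (Eu (n+1)) := {x | x ≠ 0 ∧ ‖x‖ < 1 ∧ ‖x‖⁻¹ • x ∈ ball e0 ε} with hA
  set c := 1 - ε^2/2 with hc
  have hc2 : 1/2 < c := by rw [hc]; nlinarith
  have hc1 : c < 1 := by rw [hc]; nlinarith
  have hc0 : 0 < c := by linarith
  set m := √(1/c^2 - 1) with hm
  have hm2 : m^2 = 1/c^2 - 1 := Real.sq_sqrt (by
    rw [sub_nonneg, le_div_iff₀ (by positivity)]; nlinarith)
  have hmem : ∀ x : Eu (n+1), x ≠ 0 → (‖x‖⁻¹ • x ∈ ball e0 ε ↔ c * ‖x‖ < x 0) := by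
    intro x hx
    have hxp : 0 < ‖x‖ := norm_pos_iff.2 hx
    rw [mem_ball, dist_eq_norm]
    have h1 : ‖‖x‖⁻¹ • x - e0‖^2 = 2 - 2 * (‖x‖⁻¹ * x 0) := by
      rw [norm_sub_sq_real, norm_smul, norm_inv, norm_norm, inv_mul_cancel₀ hxp.ne', he0, real_inner_smul_left]
      have : inner ℝ x e0 = x 0 := by simp [e0, EuclideanSpace.inner_single_right]
      rw [this]; ring
    rw [← sq_lt_sq₀ (norm_nonneg _) hε.le, h1, ← div_eq_inv_mul]
    rw [← lt_div_iff₀ hxp, hc]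
    constructor <;> intro h <;> linarith
  have hcone : ∀ x : Eu (n+1), c * ‖x‖ < x 0 ↔ (0 < x 0 ∧ ∑ j : Fin n, (x j.succ)^2 < m^2 * (x 0)^2) := by
    intro x
    have hs := norm_sq_split n x
    rw [hm2]
    constructor
    · intro h
      have h0 : 0 < x 0 := lt_of_le_of_lt (by positivity) h
      refine ⟨h0, ?_⟩
      have h2 : (c * ‖x‖)^2 < (x 0)^2 := by
        rw [sq_lt_sq₀ (by positivity) h0.le]; exact h
      rw [mul_pow, hs] at h2
      rw [sub_mul, div_mul_eq_mul_div, one_mul, lt_sub_iff_add_lt, lt_div_iff₀ (by positivity)]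
      linarith
    · rintro ⟨h0, h⟩
      rw [sub_mul, div_mul_eq_mul_div, one_mul, lt_sub_iff_add_lt, lt_div_iff₀ (by positivity)] at h
      rw [← sq_lt_sq₀ (by positivity) h0.le, mul_pow, hs]
      linarith
  have hsub1 : coneT n c m ⊆ A := by
    rintro x ⟨h1, h2, h3⟩
    have hx : x ≠ 0 := by rintro rfl; simp at h1
    have h4 := (hcone x).2 ⟨h1, h3⟩
    refine ⟨hx, ?_, (hmem x hx).2 h4⟩
    nlinarith
  have hsub2 : A ⊆ coneT n 1 m := by
    rintro x ⟨hx, h1, h2⟩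
    have h3 := (hcone x).1 ((hmem x hx).1 h2)
    refine ⟨h3.1, ?_, h3.2⟩
    have := PiLp.norm_apply_le x 0
    rw [Real.norm_eq_abs] at this
    linarith [le_abs_self (x 0)]
  have hmε : ε ≤ m := by
    rw [hm]; apply Real.le_sqrt_of_sq_le
    rw [le_sub_iff_add_le, le_div_iff₀ (by positivity)]
    have : (ε^2 + 1) * c^2 = 1 - ε^4*(3/4) + ε^6/4 := by rw [hc]; ring
    rw [this]
    have : ε^6 ≤ ε^4 := pow_le_pow_of_le_one hε.le hε1.le (by norm_num)
    nlinarith [pow_pos hε 4]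
  have hmε2 : m ≤ ε / c := by
    rw [hm]; apply Real.sqrt_le_iff.2
    refine ⟨by positivity, ?_⟩
    rw [div_pow, sub_le_iff_le_add, div_le_iff₀ (by positivity), add_mul, div_mul_cancel₀ _ (by positivity), hc]
    nlinarith [sq_nonneg (ε^2)]
  have hm0 : 0 < m := by linarith
  have hAf : volume A < ⊤ := by
    refine (measure_mono hsub2).trans_lt ?_
    rw [coneT_vol n 1 m one_pos hm0]
    exact ENNReal.mul_lt_top ENNReal.ofReal_lt_top (coneT_fin n)
  have hlow : c^(n+1) * m^n * V ≤ (volume A).toReal := by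
    have := ENNReal.toReal_mono hAf.ne (measure_mono hsub1)
    rw [coneT_vol n c m hc0 hm0, ENNReal.toReal_mul, ENNReal.toReal_ofReal (by positivity)] at this
    exact this
  have hup : (volume A).toReal ≤ m^n * V := by
    have h2 : volume (coneT n 1 m) ≠ ⊤ := by
      rw [coneT_vol n 1 m one_pos hm0]
      exact (ENNReal.mul_lt_top ENNReal.ofReal_lt_top (coneT_fin n)).ne
    have := ENNReal.toReal_mono h2 (measure_mono hsub2)
    rw [coneT_vol n 1 m one_pos hm0, ENNReal.toReal_mul, ENNReal.toReal_ofReal (by positivity)] at this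
    simpa using this
  have hpow : ε ^ (-(((n+1 : ℕ) : ℝ) - 1)) = (ε^n)⁻¹ := by
    rw [Real.rpow_neg hε.le]; congr 1
    rw [← Real.rpow_natCast]; congr 1; push_cast; ring
  rw [hpow, ENNReal.toReal_mul]
  simp only [ENNReal.toReal_natCast]
  push_cast
  set W := (volume A).toReal
  have hεn : 0 < ε^n := by positivity
  set q := (ε^n)⁻¹ * W with hq
  have hq1 : c^(n+1) * V ≤ q := by
    rw [hq, ← div_eq_inv_mul, le_div_iff₀ hεn]
    refine le_trans ?_ hlow
    have : ε^n ≤ m^n := pow_le_pow_left₀ hε.le hmε n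
    calc c^(n+1) * V * ε^n ≤ c^(n+1) * V * m^n := by gcongr
      _ = _ := by ring
  have hq2 : q ≤ (c^n)⁻¹ * V := by
    rw [hq, ← div_eq_inv_mul, div_le_iff₀ hεn]
    refine hup.trans ?_
    have : m^n ≤ (ε/c)^n := pow_le_pow_left₀ hm0.le hmε2 n
    calc m^n * V ≤ (ε/c)^n * V := by gcongr
      _ = _ := by rw [div_pow]; field_simp
  have hB : ∀ k : ℕ, 1 - k * (ε^2/2) ≤ c^k := by
    intro k
    have := one_add_mul_le_pow (a := -(ε^2/2)) (by nlinarith) k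
    rw [hc, sub_eq_add_neg 1 (ε^2/2)]; linarith
  have hε2 : ε^2 ≤ ε := by nlinarith
  have hcn : (c^n)⁻¹ ≤ 2^n := by
    rw [← inv_pow]
    refine pow_le_pow_left₀ (by positivity) ?_ n
    rw [inv_le_comm₀ hc0 (by norm_num)]; linarith
  have hcn2 : (c^n)⁻¹ - 1 ≤ 2^n * (n * ε) := by
    have e : (c^n)⁻¹ - 1 = (c^n)⁻¹ * (1 - c^n) := by field_simp
    rw [e]
    have h1 : 1 - c^n ≤ n * ε := by
      have := hB n
      have : (n:ℝ) * (ε^2/2) ≤ n * ε := by gcongr; linarith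
      linarith
    calc (c^n)⁻¹ * (1 - c^n) ≤ (c^n)⁻¹ * (n * ε) := by gcongr
      _ ≤ _ := by gcongr
  have hcl : 1 - c^(n+1) ≤ 2^n * ((n+1) * ε) := by
    have := hB (n+1)
    push_cast at this
    have h3 : ((n:ℝ)+1) * (ε^2/2) ≤ (n+1) * ε := by gcongr; linarith
    have h4 : ((n:ℝ)+1) * ε ≤ 2^n * ((n+1) * ε) := le_mul_of_one_le_left (by positivity) (one_le_pow₀ (by norm_num))
    linarith
  have e : (ε^n)⁻¹ * ((n+1) * W) - (n+1) * V = (n+1) * (q - V) := by rw [hq]; ring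
  rw [e, abs_mul, abs_of_pos (by positivity : (0:ℝ) < n+1), mul_assoc, mul_assoc]
  refine mul_le_mul_of_nonneg_left ?_ (by positivity)
  rw [abs_le]
  constructor
  · have : V * (1 - c^(n+1)) ≤ V * (2^n * ((n+1) * ε)) := by gcongr
    nlinarith
  · have : V * ((c^n)⁻¹ - 1) ≤ V * (2^n * (n * ε)) := by gcongr
    have h5 : V * (2^n * (n * ε)) ≤ V * (2^n * ((n+1) * ε)) := by gcongr; linarith
    nlinarith


lemma gauss_int (d : ℕ) (b : ℝ) (hb : 0 < b) : Integrable (fun x : Eu d => Real.exp (-b * ‖x‖^2)) := by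
  have := (GaussianFourier.integrable_cexp_neg_mul_sq_norm_add (V := Eu d) (b := (b:ℂ)) (by simpa using hb) 0 0).norm
  refine this.congr (Filter.Eventually.of_forall fun x => ?_)
  simp only [Complex.norm_exp]
  simp [← Complex.ofReal_pow]

lemma one_div_eq (τ : ℝ) : ∫ t in Set.Ioi (0:ℝ), Complex.exp ((-1 + Complex.I * τ) * t) = 1 / (1 - Complex.I * τ) := by
  rw [integral_exp_mul_complex_Ioi (by simp)]
  have h1 : (-1 + Complex.I * τ : ℂ) = -(1 - Complex.I * τ) := by ring
  rw [h1]
  simp only [Complex.ofReal_zero, mul_zero, Complex.exp_zero]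
  rw [neg_div_neg_eq]

lemma band_aux (d : ℕ) (ξ : Eu d) (hξ : ξ ≠ 0) :
    ∫ x : Eu d, Real.exp (-‖x‖^2) / (1 + (inner ℝ ξ x)^2) ≤ Real.pi ^ ((d:ℝ)/2) * √Real.pi / ‖ξ‖ := by
  have hn : 0 < ‖ξ‖ := norm_pos_iff.2 hξ
  let G : Eu d → ℝ → ℂ := fun x t => Complex.exp (-‖x‖^2) * Complex.exp ((-1 + Complex.I * (inner ℝ ξ x : ℝ)) * t)
  have hGn : ∀ x t, ‖G x t‖ = Real.exp (-1 * ‖x‖^2) * Real.exp (-t) := by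
    intro x t
    simp only [G, norm_mul, Complex.norm_exp]
    simp [← Complex.ofReal_pow]
  have hGi : Integrable (Function.uncurry G) (volume.prod (volume.restrict (Set.Ioi (0:ℝ)))) := by
    have h1 := (gauss_int d 1 one_pos).mul_prod (integrableOn_exp_neg_Ioi 0)
    refine h1.mono' ?_ ?_
    · apply Continuous.aestronglyMeasurable
      simp only [G, Function.uncurry_def]
      fun_prop
    · exact Filter.Eventually.of_forall fun p => (hGn p.1 p.2).le
  have hswap := integral_integral_swap hGi
  have hL : ∀ x, ∫ t in Set.Ioi (0:ℝ), G x t = Complex.exp (-‖x‖^2) * (1 / (1 - Complex.I * (inner ℝ ξ x : ℝ))) := by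
    intro x
    simp only [G]
    rw [integral_const_mul, one_div_eq]
  have hR : ∀ t : ℝ, ∫ x, G x t = ((Real.exp (-t) * (Real.pi ^ ((d:ℝ)/2) * Real.exp (-(t^2 * ‖ξ‖^2 / 4))) : ℝ) : ℂ) := by
    intro t
    have := GaussianFourier.integral_cexp_neg_mul_sq_norm_add (V := Eu d) (b := 1) (by simp) (Complex.I * t) ξ
    have e : ∀ x, G x t = Complex.exp (-t) * Complex.exp (-1 * ‖x‖^2 + Complex.I * t * (inner ℝ ξ x : ℝ)) := by
      intro x; simp only [G]; rw [← Complex.exp_add, ← Complex.exp_add]; congr 1; ring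
    simp only [e]
    rw [integral_const_mul, this]
    push_cast
    rw [Complex.ofReal_cpow Real.pi_pos.le]
    congr 2
    · simp
    · congr 1; rw [mul_pow, Complex.I_sq]; ring
  simp only [hL, hR] at hswap
  have hre : ∫ x : Eu d, Real.exp (-‖x‖^2) / (1 + (inner ℝ ξ x)^2) =
      (∫ x : Eu d, Complex.exp (-‖x‖^2) * (1 / (1 - Complex.I * (inner ℝ ξ x : ℝ)))).re := by
    have hint : Integrable (fun x : Eu d => Complex.exp (-‖x‖^2) * (1 / (1 - Complex.I * (inner ℝ ξ x : ℝ)))) := by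
      have := hGi.integral_prod_left
      simpa only [Function.uncurry, hL] using this
    have := Complex.reCLM.integral_comp_comm hint
    simp only [Complex.reCLM_apply] at this
    rw [← this]
    refine integral_congr_ae (Filter.Eventually.of_forall fun x => ?_)
    simp only
    have h1 : Complex.exp (-‖x‖^2) = ((Real.exp (-‖x‖^2) : ℝ) : ℂ) := by push_cast; rfl
    rw [h1, Complex.re_ofReal_mul, one_div, Complex.inv_re]
    simp [Complex.normSq_apply, div_eq_mul_inv, sq]
  rw [hre, hswap, integral_complex_ofReal, Complex.ofReal_re]
  have hg : ∫ t in Set.Ioi (0:ℝ), Real.exp (-(‖ξ‖^2/4) * t^2) = √(Real.pi / (‖ξ‖^2/4)) / 2 := integral_gaussian_Ioi _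
  have hsq : √(Real.pi / (‖ξ‖^2/4)) / 2 = √Real.pi / ‖ξ‖ := by
    have : Real.pi / (‖ξ‖^2/4) = Real.pi / (‖ξ‖/2)^2 := by ring
    rw [this, Real.sqrt_div Real.pi_pos.le, Real.sqrt_sq (by positivity)]
    field_simp
  have hgi : Integrable (fun t : ℝ => Real.pi ^ ((d:ℝ)/2) * Real.exp (-(‖ξ‖^2/4) * t^2)) (volume.restrict (Set.Ioi 0)) :=
    ((integrable_exp_neg_mul_sq (by positivity)).const_mul _).integrableOn
  calc _ ≤ ∫ t in Set.Ioi (0:ℝ), Real.pi ^ ((d:ℝ)/2) * Real.exp (-(‖ξ‖^2/4) * t^2) := by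
        refine integral_mono_of_nonneg (Filter.Eventually.of_forall fun t => by positivity) hgi ?_
        filter_upwards [ae_restrict_mem measurableSet_Ioi] with t ht
        have ht' : (0:ℝ) < t := ht
        have e : -(t^2 * ‖ξ‖^2 / 4) = -(‖ξ‖^2/4) * t^2 := by ring
        rw [e]
        exact mul_le_of_le_one_left (by positivity) (Real.exp_le_one_iff.2 (by linarith))
    _ = _ := by rw [integral_const_mul, hg, hsq]; ring

lemma band (d : ℕ) (hd : 2 ≤ d) : ∃ C : ℝ, 0 < C ∧ ∀ ξ : Eu d,
    ENNReal.ofReal ‖ξ‖ * ∫⁻ ω, ENNReal.ofReal (1 / (1 + (inner ℝ ξ ω)^2)) ∂(S0 d) ≤ ENNReal.ofReal C := by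
  set K := ∫⁻ r in Set.Ioo (0:ℝ) 1, ENNReal.ofReal (r^(d-1) * Real.exp (-1)) with hK
  have hK0 : K ≠ 0 := by
    rw [hK, Ne, lintegral_eq_zero_iff (by fun_prop)]
    intro h
    have h2 : ∀ᵐ r ∂(volume.restrict (Set.Ioo (0:ℝ) 1)), False := by
      filter_upwards [h, ae_restrict_mem measurableSet_Ioo] with r hr hr2
      have : 0 < r^(d-1) * Real.exp (-1) := mul_pos (pow_pos hr2.1 _) (Real.exp_pos _)
      simp at hr
      have := this.not_ge
      exact this (by simpa using hr)
    have h3 := Filter.eventually_false_iff_eq_bot.1 h2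
    rw [ae_eq_bot, Measure.restrict_eq_zero] at h3
    simp at h3
  have hKt : K ≠ ⊤ := by
    refine (lt_of_le_of_lt (setLIntegral_mono (g := fun _ => 1) measurable_const ?_) (by simp)).ne
    intro r hr
    rw [← ENNReal.ofReal_one]
    apply ENNReal.ofReal_le_ofReal
    exact mul_le_one₀ (pow_le_one₀ hr.1.le hr.2.le) (Real.exp_pos _).le (Real.exp_le_one_iff.2 (by norm_num))
  set A := Real.pi ^ ((d:ℝ)/2) * √Real.pi with hA
  have hApos : 0 < A := by positivity
  have hKr : 0 < K.toReal := ENNReal.toReal_pos hK0 hKt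
  refine ⟨A / K.toReal, by positivity, fun ξ => ?_⟩
  rcases eq_or_ne ξ 0 with rfl | hξ
  · simp
  have hn : 0 < ‖ξ‖ := norm_pos_iff.2 hξ
  have hint : Integrable (fun x : Eu d => Real.exp (-‖x‖^2) / (1 + (inner ℝ ξ x)^2)) := by
    refine (gauss_int d 1 one_pos).mono' ?_ ?_
    · apply Continuous.aestronglyMeasurable
      refine Continuous.div (by fun_prop) (by fun_prop) fun x => by positivity
    · refine Filter.Eventually.of_forall fun x => ?_
      rw [Real.norm_of_nonneg (by positivity), neg_one_mul]
      exact div_le_self (Real.exp_pos _).le (by nlinarith [sq_nonneg (inner ℝ ξ x)])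
  have h1 : ∫⁻ x : Eu d, ENNReal.ofReal (Real.exp (-‖x‖^2) / (1 + (inner ℝ ξ x)^2)) ≤ ENNReal.ofReal (A / ‖ξ‖) := by
    rw [← ofReal_integral_eq_lintegral_ofReal hint (Filter.Eventually.of_forall fun x => by positivity)]
    exact ENNReal.ofReal_le_ofReal (band_aux d ξ hξ)
  have hmeas : Measurable (fun x : Eu d => ENNReal.ofReal (Real.exp (-‖x‖^2) / (1 + (inner ℝ ξ x)^2))) := by
    refine ENNReal.measurable_ofReal.comp ?_
    apply Continuous.measurable
    refine Continuous.div (by fun_prop) (by fun_prop) fun x => by positivity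
  rw [S0_polar d _ hmeas hd] at h1
  have hmeas2 : Measurable (fun ω : Eu d => ENNReal.ofReal (1 / (1 + (inner ℝ ξ ω)^2))) := by
    refine ENNReal.measurable_ofReal.comp ?_
    apply Continuous.measurable
    refine Continuous.div (by fun_prop) (by fun_prop) fun x => by positivity
  have h2 : K * ∫⁻ ω, ENNReal.ofReal (1 / (1 + (inner ℝ ξ ω)^2)) ∂(S0 d) ≤ ENNReal.ofReal (A / ‖ξ‖) := by
    refine le_trans ?_ h1
    rw [← lintegral_const_mul _ hmeas2]
    refine lintegral_mono_ae ?_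
    filter_upwards [S0_ae d] with ω hω
    have hω1 : ‖ω‖ = 1 := by simpa using hω
    rw [hK, ← lintegral_mul_const _ (by fun_prop)]
    refine le_trans ?_ (lintegral_mono_set (Set.Ioo_subset_Ioi_self (a := (1:ℝ)) (b := 0)))
    refine setLIntegral_mono' measurableSet_Ioo fun r hr => ?_
    have hr0 := hr.1
    have hr1 := hr.2
    rw [← ENNReal.ofReal_mul (by positivity), ← ENNReal.ofReal_mul (by positivity)]
    apply ENNReal.ofReal_le_ofReal
    rw [mul_assoc, div_eq_mul_one_div (Real.exp _), real_inner_smul_right, norm_smul, hω1, Real.norm_of_nonneg hr0.le, mul_one]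
    have hr2 : r^2 ≤ 1 := by nlinarith
    have hr3 : (r * inner ℝ ξ ω)^2 ≤ (inner ℝ ξ ω)^2 := by
      rw [mul_pow]
      exact mul_le_of_le_one_left (sq_nonneg _) hr2
    have hr4 : 1 / (1 + (inner ℝ ξ ω)^2) ≤ 1 / (1 + (r * inner ℝ ξ ω)^2) :=
      one_div_le_one_div_of_le (by positivity) (by linarith)
    have hr5 : Real.exp (-1) ≤ Real.exp (-r^2) := Real.exp_le_exp.2 (by linarith)
    exact mul_le_mul_of_nonneg_left (mul_le_mul hr5 hr4 (by positivity) (by positivity)) (by positivity)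
  have h3 : ENNReal.ofReal ‖ξ‖ * (K * ∫⁻ ω, ENNReal.ofReal (1 / (1 + (inner ℝ ξ ω)^2)) ∂(S0 d)) ≤ ENNReal.ofReal A := by
    refine (mul_le_mul_right h2 _).trans ?_
    rw [← ENNReal.ofReal_mul hn.le, mul_div_cancel₀ _ hn.ne']
  rw [ENNReal.ofReal_div_of_pos hKr, ENNReal.ofReal_toReal hKt, ENNReal.le_div_iff_mul_le (Or.inl hK0) (Or.inl hKt)]
  calc _ = _ := by ring
    _ ≤ _ := h3


lemma osc_bound (L B : ℝ) (hL : 0 ≤ L) (W W1 W2 : ℝ → ℂ) (h1 : ∀ t, HasDerivAt W (W1 t) t)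
    (h2 : ∀ t, HasDerivAt W1 (W2 t) t) (hc : Continuous W2) (h0 : W 0 = 0) (hL0 : W L = 0) (hL1 : W1 L = 0)
    (b0 : ∀ t ∈ Set.Icc 0 L, ‖W t‖ ≤ B) (b1 : ‖W1 0‖ ≤ B) (b2 : ∀ t ∈ Set.Icc 0 L, ‖W2 t‖ ≤ B) (τ : ℝ) :
    ‖∫ t in (0:ℝ)..L, W t * Complex.exp (Complex.I * τ * t)‖ ≤ (B * (1 + 2 * L)) / (1 + τ^2) := by
  have hWc : Continuous W := continuous_iff_continuousAt.2 fun t => (h1 t).continuousAt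
  have hW1c : Continuous W1 := continuous_iff_continuousAt.2 fun t => (h2 t).continuousAt
  set J := ∫ t in (0:ℝ)..L, W t * Complex.exp (Complex.I * τ * t) with hJ
  have hv : ∀ t : ℝ, HasDerivAt (fun t : ℝ => Complex.exp (Complex.I * τ * t)) (Complex.I * τ * Complex.exp (Complex.I * τ * t)) t := by
    intro t
    have : HasDerivAt (fun t : ℝ => Complex.I * τ * (t:ℂ)) (Complex.I * τ) t := by
      simpa using (Complex.ofRealCLM.hasDerivAt (x := t)).const_mul (Complex.I * (τ:ℂ))
    simpa [mul_comm] using this.cexp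
  have hen : ∀ t : ℝ, ‖Complex.exp (Complex.I * τ * t)‖ = 1 := by
    intro t; rw [Complex.norm_exp]; simp
  have e1 : Complex.I * τ * J = - ∫ t in (0:ℝ)..L, W1 t * Complex.exp (Complex.I * τ * t) := by
    have := intervalIntegral.integral_mul_deriv_eq_deriv_mul (a := 0) (b := L) (u := W) (u' := W1)
      (v := fun t : ℝ => Complex.exp (Complex.I * τ * t)) (v' := fun t : ℝ => Complex.I * τ * Complex.exp (Complex.I * τ * t))
      (fun t _ => h1 t) (fun t _ => hv t) (hW1c.intervalIntegrable _ _) (Continuous.intervalIntegrable (by fun_prop) _ _)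
    rw [h0, hL0] at this
    simp only [zero_mul, sub_zero, zero_sub] at this
    rw [← this, hJ, ← intervalIntegral.integral_const_mul]
    congr 1; ext t; ring
  have e2 : Complex.I * τ * (∫ t in (0:ℝ)..L, W1 t * Complex.exp (Complex.I * τ * t))
      = - W1 0 - ∫ t in (0:ℝ)..L, W2 t * Complex.exp (Complex.I * τ * t) := by
    have := intervalIntegral.integral_mul_deriv_eq_deriv_mul (a := 0) (b := L) (u := W1) (u' := W2)
      (v := fun t : ℝ => Complex.exp (Complex.I * τ * t)) (v' := fun t : ℝ => Complex.I * τ * Complex.exp (Complex.I * τ * t))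
      (fun t _ => h2 t) (fun t _ => hv t) (hc.intervalIntegrable _ _) (Continuous.intervalIntegrable (by fun_prop) _ _)
    rw [hL1] at this
    simp only [zero_mul, zero_sub, Complex.ofReal_zero, mul_zero, Complex.exp_zero, mul_one] at this
    rw [← this, ← intervalIntegral.integral_const_mul]
    congr 1; ext t; ring
  have n0 : ‖J‖ ≤ B * L := by
    have := intervalIntegral.norm_integral_le_of_norm_le_const (a := 0) (b := L) (C := B)
      (f := fun t => W t * Complex.exp (Complex.I * τ * t)) (by
        intro t ht; rw [Set.uIoc_of_le hL] at ht; rw [norm_mul, hen, mul_one]; exact b0 t ⟨ht.1.le, ht.2⟩)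
    simpa [abs_of_nonneg hL] using this
  have n2 : ‖∫ t in (0:ℝ)..L, W2 t * Complex.exp (Complex.I * τ * t)‖ ≤ B * L := by
    have := intervalIntegral.norm_integral_le_of_norm_le_const (a := 0) (b := L) (C := B)
      (f := fun t => W2 t * Complex.exp (Complex.I * τ * t)) (by
        intro t ht; rw [Set.uIoc_of_le hL] at ht; rw [norm_mul, hen, mul_one]; exact b2 t ⟨ht.1.le, ht.2⟩)
    simpa [abs_of_nonneg hL] using this
  have e3 : (τ:ℂ)^2 * J = - W1 0 - ∫ t in (0:ℝ)..L, W2 t * Complex.exp (Complex.I * τ * t) := by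
    rw [← e2]
    have : ∫ t in (0:ℝ)..L, W1 t * Complex.exp (Complex.I * τ * t) = - (Complex.I * τ * J) := by rw [e1, neg_neg]
    rw [this]
    linear_combination ((τ:ℂ)^2 * J) * Complex.I_sq
  have n3 : τ^2 * ‖J‖ ≤ B + B * L := by
    have : ‖(τ:ℂ)^2 * J‖ = τ^2 * ‖J‖ := by simp
    rw [← this, e3]
    refine (norm_sub_le _ _).trans ?_
    rw [norm_neg]; linarith
  rw [le_div_iff₀ (by positivity)]
  nlinarith

noncomputable def wfun (d : ℕ) (T : ℝ) (t : ℝ) : ℝ := t^(d-1) * Real.smoothTransition (T - t)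
noncomputable def what (d : ℕ) (T : ℝ) (τ : ℝ) : ℂ := ∫ t in (0:ℝ)..(T+1), (wfun d T t : ℂ) * Complex.exp (Complex.I * τ * t)

lemma wfun_cont (d : ℕ) (T : ℝ) : Continuous (wfun d T) := by
  unfold wfun
  exact (continuous_id.pow _).mul (Real.smoothTransition.continuous.comp (by fun_prop))

lemma wfun_nonneg (d : ℕ) (T t : ℝ) (ht : 0 ≤ t) : 0 ≤ wfun d T t :=
  mul_nonneg (pow_nonneg ht _) (Real.smoothTransition.nonneg _)

lemma wfun_zero (d : ℕ) (T t : ℝ) (ht : T ≤ t) : wfun d T t = 0 := by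
  unfold wfun; rw [Real.smoothTransition.zero_of_nonpos (by linarith), mul_zero]

lemma wfun_bd (d : ℕ) (hd : 2 ≤ d) (T : ℝ) (hT : 0 < T) : ∃ B : ℝ, 0 < B ∧ ∃ W W1 W2 : ℝ → ℂ, (∀ t, W t = wfun d T t) ∧ (∀ t, HasDerivAt W (W1 t) t) ∧
    (∀ t, HasDerivAt W1 (W2 t) t) ∧ Continuous W2 ∧ W 0 = 0 ∧ W (T+1) = 0 ∧ W1 (T+1) = 0 ∧
    (∀ t ∈ Set.Icc 0 (T+1), ‖W t‖ ≤ B ∧ ‖W1 t‖ ≤ B ∧ ‖W2 t‖ ≤ B) := by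
  have hcd : ContDiff ℝ 2 (fun t => (wfun d T t : ℂ)) := by
    have : ContDiff ℝ 2 (wfun d T) := by
      unfold wfun
      exact (contDiff_id.pow _).mul (Real.smoothTransition.contDiff.comp (by fun_prop))
    exact Complex.ofRealCLM.contDiff.comp this
  set W : ℝ → ℂ := fun t => (wfun d T t : ℂ) with hW
  have hcd1 : ContDiff ℝ 1 (deriv W) := by
    have : ContDiff ℝ (1+1) W := by simpa [one_add_one_eq_two] using hcd
    exact (contDiff_succ_iff_deriv.1 this).2.2
  have hd1 : ∀ t, HasDerivAt W (deriv W t) t := fun t => (hcd.differentiable (by norm_num) t).hasDerivAt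
  have hd2 : ∀ t, HasDerivAt (deriv W) (deriv (deriv W) t) t := fun t => (hcd1.differentiable (by norm_num) t).hasDerivAt
  have hc2 : Continuous (deriv (deriv W)) := hcd1.continuous_deriv (le_refl _)
  obtain ⟨B0, hB0⟩ := isCompact_Icc.exists_bound_of_continuousOn (s := Set.Icc 0 (T+1)) hcd.continuous.continuousOn
  obtain ⟨B1, hB1⟩ := isCompact_Icc.exists_bound_of_continuousOn (s := Set.Icc 0 (T+1)) hcd1.continuous.continuousOn
  obtain ⟨B2, hB2⟩ := isCompact_Icc.exists_bound_of_continuousOn (s := Set.Icc 0 (T+1)) hc2.continuousOn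
  refine ⟨|B0| + |B1| + |B2| + 1, by positivity, W, deriv W, deriv (deriv W), fun t => rfl, hd1, hd2, hc2, ?_, ?_, ?_, ?_⟩
  · simp only [hW, wfun]; rw [zero_pow (by omega)]; simp
  · simp only [hW, wfun_zero d T (T+1) (by linarith)]; simp
  · have : W =ᶠ[nhds (T+1)] fun _ => 0 := by
      filter_upwards [lt_mem_nhds (show T < T+1 by linarith)] with t ht
      simp [hW, wfun_zero d T t ht.le]
    rw [this.deriv_eq]; simp
  · intro t ht
    have := hB0 t ht; have := hB1 t ht; have := hB2 t ht
    have := le_abs_self B0; have := le_abs_self B1; have := le_abs_self B2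
    have := abs_nonneg B0; have := abs_nonneg B1; have := abs_nonneg B2
    refine ⟨?_, ?_, ?_⟩ <;> linarith

lemma what_bd (d : ℕ) (hd : 2 ≤ d) (T : ℝ) (hT : 0 < T) : ∃ A : ℝ, 0 < A ∧ (∀ τ, ‖what d T τ‖ ≤ A / (1 + τ^2)) ∧
    ∀ τ δ, ‖what d T τ - what d T (τ + δ)‖ ≤ A * (|δ| * (1 + |δ|)) / (1 + τ^2) := by
  obtain ⟨B, hB, W, W1, W2, hWw, h1, h2, hc, h0, hL0, hL1, hb⟩ := wfun_bd d hd T hT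
  have hLp : 0 ≤ T + 1 := by linarith
  have hWc : Continuous W := continuous_iff_continuousAt.2 fun t => (h1 t).continuousAt
  have hW1c : Continuous W1 := continuous_iff_continuousAt.2 fun t => (h2 t).continuousAt
  set L := T + 1 with hL
  refine ⟨B * (1 + 2 * L) * (2 * L + 4), by positivity, fun τ => ?_, fun τ δ => ?_⟩
  · have := osc_bound L B hLp W W1 W2 h1 h2 hc h0 hL0 hL1 (fun t ht => (hb t ht).1) (hb 0 ⟨le_refl _, hLp⟩).2.1 (fun t ht => (hb t ht).2.2) τ
    simp only [hWw] at this
    refine this.trans ?_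
    exact div_le_div_of_nonneg_right (le_mul_of_one_le_right (by positivity) (by linarith)) (by positivity)
  · set D := |δ| * (1 + |δ|) with hD
    have hDn : 0 ≤ D := by positivity
    let v : ℝ → ℂ := fun t => Complex.exp (Complex.I * δ * t)
    have hv : ∀ t : ℝ, HasDerivAt v (Complex.I * δ * v t) t := by
      intro t
      have : HasDerivAt (fun t : ℝ => Complex.I * δ * (t:ℂ)) (Complex.I * δ) t := by
        simpa using (Complex.ofRealCLM.hasDerivAt (x := t)).const_mul (Complex.I * (δ:ℂ))
      exact this.cexp.congr_deriv (mul_comm _ _)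
    have hvc : Continuous v := by fun_prop
    have hvn : ∀ t : ℝ, ‖v t‖ = 1 := by
      intro t; simp only [v]; rw [Complex.norm_exp]; simp
    have hvd : ∀ t ∈ Set.Icc 0 L, ‖1 - v t‖ ≤ L * |δ| := by
      intro t ht
      have := Real.norm_exp_I_mul_ofReal_sub_one_le (x := δ * t)
      rw [norm_sub_rev]
      simp only [v]
      have e : Complex.I * δ * t = Complex.I * ((δ * t : ℝ):ℂ) := by push_cast; ring
      rw [e]
      refine this.trans ?_
      rw [Real.norm_eq_abs, abs_mul, abs_of_nonneg ht.1, mul_comm]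
      exact mul_le_mul_of_nonneg_right ht.2 (abs_nonneg _)
    have g1 : ∀ t, HasDerivAt (fun t => W t * (1 - v t)) (W1 t * (1 - v t) - W t * (Complex.I * δ * v t)) t := by
      intro t
      have := (h1 t).mul ((hv t).const_sub 1)
      exact HasDerivAt.congr_deriv this (by ring)
    have g2 : ∀ t, HasDerivAt (fun t => W1 t * (1 - v t) - W t * (Complex.I * δ * v t))
        (W2 t * (1 - v t) - 2 * (W1 t * (Complex.I * δ * v t)) - W t * (Complex.I * δ * (Complex.I * δ * v t))) t := by
      intro t
      have := ((h2 t).mul ((hv t).const_sub 1)).sub ((h1 t).mul ((hv t).const_mul (Complex.I * δ)))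
      exact HasDerivAt.congr_deriv this (by ring)
    have habs : |δ| ≤ D := by rw [hD]; exact le_mul_of_one_le_right (abs_nonneg _) (by linarith [abs_nonneg δ])
    have habs2 : |δ| * |δ| ≤ D := by rw [hD]; nlinarith [abs_nonneg δ]
    have hBD : 0 ≤ B * D := by positivity
    have key1 : ∀ t ∈ Set.Icc 0 L, ∀ z : ℂ, ‖z‖ ≤ B → ‖z * (1 - v t)‖ ≤ B * D * L := by
      intro t ht z hz
      rw [norm_mul]
      calc _ ≤ B * (L * |δ|) := mul_le_mul hz (hvd t ht) (norm_nonneg _) hB.le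
        _ ≤ B * (L * D) := by gcongr
        _ = _ := by ring
    have key2 : ∀ t, ∀ z : ℂ, ‖z‖ ≤ B → ‖z * (Complex.I * δ * v t)‖ ≤ B * D := by
      intro t z hz
      rw [norm_mul, norm_mul, norm_mul, hvn, Complex.norm_I, one_mul, mul_one, Complex.norm_real, Real.norm_eq_abs]
      exact mul_le_mul hz habs (abs_nonneg _) hB.le
    have key3 : ∀ t, ∀ z : ℂ, ‖z‖ ≤ B → ‖z * (Complex.I * δ * (Complex.I * δ * v t))‖ ≤ B * D := by
      intro t z hz
      rw [norm_mul, norm_mul, norm_mul, norm_mul, norm_mul, hvn, Complex.norm_I, one_mul, mul_one, Complex.norm_real, Real.norm_eq_abs]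
      exact mul_le_mul hz habs2 (by positivity) hB.le
    have hnat : B * D * L ≤ B * D * (2 * L + 4) := mul_le_mul_of_nonneg_left (by linarith) hBD
    have := osc_bound L (B * D * (2 * L + 4)) hLp _ _ _ g1 g2 (by fun_prop) (by simp [h0]) (by simp [hL0]) (by simp [hL0, hL1])
      (fun t ht => (key1 t ht _ (hb t ht).1).trans hnat)
      (by
        have : v 0 = 1 := by simp [v]
        rw [h0, this]; simp; positivity)
      (fun t ht => by
        refine (norm_sub_le _ _).trans ?_
        have a1 := norm_sub_le (W2 t * (1 - v t)) (2 * (W1 t * (Complex.I * δ * v t)))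
        have a2 := key1 t ht _ (hb t ht).2.2
        have a3 := key2 t _ (hb t ht).2.1
        have a4 := key3 t _ (hb t ht).1
        have a5 : ‖(2:ℂ) * (W1 t * (Complex.I * δ * v t))‖ = 2 * ‖W1 t * (Complex.I * δ * v t)‖ := by rw [norm_mul]; simp
        have a6 : 0 ≤ B * D * L := by positivity
        nlinarith) τ
    have e : what d T τ - what d T (τ + δ) = ∫ t in (0:ℝ)..L, W t * (1 - v t) * Complex.exp (Complex.I * τ * t) := by
      simp only [what, ← hWw]
      rw [← intervalIntegral.integral_sub (Continuous.intervalIntegrable (by fun_prop) _ _) (Continuous.intervalIntegrable (by fun_prop) _ _)]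
      congr 1; ext t
      simp only [v]
      have : Complex.I * ((τ + δ : ℝ):ℂ) * t = Complex.I * δ * t + Complex.I * τ * t := by push_cast; ring
      rw [this, Complex.exp_add]; ring
    rw [e]
    refine this.trans (le_of_eq ?_)
    ring

lemma what_cont (d : ℕ) (T : ℝ) : Continuous (what d T) := by
  unfold what
  apply intervalIntegral.continuous_parametric_intervalIntegral_of_continuous'
  have := wfun_cont d T
  simp only [Function.uncurry_def]
  fun_prop


noncomputable def gk (d : ℕ) (u : ℝ) (z : Eu d) : ℝ :=
  ((2 * Real.pi)^d)⁻¹ * (Real.pi / u) ^ ((d:ℝ)/2) * Real.exp (-(1/(4*u)) * ‖z‖^2)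

lemma gk_nonneg (d : ℕ) (u : ℝ) (hu : 0 < u) (z : Eu d) : 0 ≤ gk d u z := by
  unfold gk; positivity

lemma gk_cont (d : ℕ) (u : ℝ) : Continuous (gk d u) := by
  unfold gk; fun_prop

lemma gk_le (d : ℕ) (u : ℝ) (hu : 0 < u) (z : Eu d) : gk d u z ≤ gk d u 0 := by
  unfold gk
  refine mul_le_mul_of_nonneg_left (Real.exp_le_exp.2 ?_) (by positivity)
  have : 0 ≤ 1 / (4*u) * ‖z‖^2 := by positivity
  simp; simpa using this

lemma gk_fourier (d : ℕ) (u : ℝ) (hu : 0 < u) (z : Eu d) :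
    (gk d u z : ℂ) = ((2 * Real.pi)^d)⁻¹ * ∫ ξ : Eu d, Complex.exp (-u * ‖ξ‖^2 + Complex.I * (inner ℝ z ξ : ℝ)) := by
  have := GaussianFourier.integral_cexp_neg_mul_sq_norm_add (V := Eu d) (b := (u:ℂ)) (by simpa using hu) Complex.I z
  rw [this]
  unfold gk
  push_cast
  rw [Complex.ofReal_cpow (by positivity), mul_assoc]
  congr 1
  congr 1
  · simp
  · congr 1
    rw [Complex.I_sq]; field_simp

lemma gk_integrable (d : ℕ) (u : ℝ) (hu : 0 < u) : Integrable (gk d u) :=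
  (gauss_int d (1/(4*u)) (by positivity)).const_mul _

lemma gk_integral (d : ℕ) (u : ℝ) (hu : 0 < u) : ∫ z, gk d u z = 1 := by
  unfold gk
  rw [integral_const_mul, GaussianFourier.integral_rexp_neg_mul_sq_norm (by positivity)]
  simp only [finrank_euclideanSpace, Fintype.card_fin]
  rw [mul_assoc, ← Real.mul_rpow (by positivity) (by positivity)]
  have : Real.pi / u * (Real.pi / (1 / (4*u))) = (2 * Real.pi)^2 := by field_simp; ring
  rw [this, ← Real.rpow_natCast, ← Real.rpow_natCast, ← Real.rpow_mul (by positivity)]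
  have : ((2:ℕ):ℝ) * ((d:ℝ)/2) = d := by push_cast; ring
  rw [this]
  exact inv_mul_cancel₀ (by positivity)

noncomputable def lam {d : ℕ} (Λ : Measure (Eu d)) (u : ℝ) (z : Eu d) : ℝ := ∫ y, gk d u (z - y) ∂Λ

lemma lam_integrable {d : ℕ} (Λ : Measure (Eu d)) [IsProbabilityMeasure Λ] (u : ℝ) (hu : 0 < u) (z : Eu d) :
    Integrable (fun y => gk d u (z - y)) Λ := by
  refine Integrable.of_bound (C := gk d u 0) ?_ ?_
  · exact ((gk_cont d u).comp (by fun_prop)).aestronglyMeasurable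
  · refine Filter.Eventually.of_forall fun y => ?_
    rw [Real.norm_of_nonneg (gk_nonneg d u hu _)]
    exact gk_le d u hu _

lemma lam_nonneg {d : ℕ} (Λ : Measure (Eu d)) (u : ℝ) (hu : 0 < u) (z : Eu d) : 0 ≤ lam Λ u z :=
  integral_nonneg fun y => gk_nonneg d u hu _

lemma lam_le {d : ℕ} (Λ : Measure (Eu d)) [IsProbabilityMeasure Λ] (u : ℝ) (hu : 0 < u) (z : Eu d) : lam Λ u z ≤ gk d u 0 := by
  have := integral_mono (lam_integrable Λ u hu z) (integrable_const (gk d u 0)) (fun y => gk_le d u hu _)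
  simpa [lam] using this

lemma lam_cont {d : ℕ} (Λ : Measure (Eu d)) [IsProbabilityMeasure Λ] (u : ℝ) (hu : 0 < u) : Continuous (lam Λ u) := by
  unfold lam
  refine continuous_of_dominated (bound := fun _ => gk d u 0) ?_ ?_ (integrable_const _) ?_
  · intro z; exact (lam_integrable Λ u hu z).aestronglyMeasurable
  · intro z
    refine Filter.Eventually.of_forall fun y => ?_
    rw [Real.norm_of_nonneg (gk_nonneg d u hu _)]
    exact gk_le d u hu _
  · exact Filter.Eventually.of_forall fun y => (gk_cont d u).comp (by fun_prop)

lemma lam_fourier {d : ℕ} (Λ : Measure (Eu d)) [IsProbabilityMeasure Λ] (φ : Eu d → ℝ) (hφ : ∀ ξ, charFun Λ ξ = φ ξ)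
    (u : ℝ) (hu : 0 < u) (z : Eu d) :
    (lam Λ u z : ℂ) = ((2 * Real.pi)^d)⁻¹ * ∫ ξ : Eu d, (Real.exp (-u * ‖ξ‖^2) * φ ξ : ℝ) * Complex.exp (Complex.I * (inner ℝ ξ z : ℝ)) := by
  unfold lam
  rw [← integral_complex_ofReal]
  simp only [gk_fourier d u hu]
  rw [integral_const_mul]
  congr 1
  let G : Eu d → Eu d → ℂ := fun y ξ => Complex.exp (-u * ‖ξ‖^2 + Complex.I * (inner ℝ (z - y) ξ : ℝ))
  have hGi : Integrable (Function.uncurry G) (Λ.prod volume) := by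
    have h1 := (integrable_const (1:ℝ) (μ := Λ)).mul_prod (gauss_int d u hu)
    refine h1.mono' ?_ ?_
    · apply Continuous.aestronglyMeasurable
      simp only [G, Function.uncurry_def]
      fun_prop
    · refine Filter.Eventually.of_forall fun p => ?_
      simp only [G, Function.uncurry, Complex.norm_exp]
      simp [← Complex.ofReal_pow]
  rw [show (∫ y, ∫ ξ, Complex.exp (-u * ‖ξ‖^2 + Complex.I * (inner ℝ (z - y) ξ : ℝ)) ∂volume ∂Λ) = ∫ y, ∫ ξ, G y ξ ∂volume ∂Λ from rfl,
    integral_integral_swap hGi]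
  refine integral_congr_ae (Filter.Eventually.of_forall fun ξ => ?_)
  simp only [G]
  have e : ∀ y : Eu d, Complex.exp (-u * ‖ξ‖^2 + Complex.I * (inner ℝ (z - y) ξ : ℝ)) =
      (Complex.exp (-u * ‖ξ‖^2) * Complex.exp (Complex.I * (inner ℝ ξ z : ℝ))) * Complex.exp ((inner ℝ y (-ξ) : ℝ) * Complex.I) := by
    intro y
    rw [← Complex.exp_add, ← Complex.exp_add]
    congr 1
    rw [inner_sub_left, inner_neg_right, real_inner_comm ξ z]; push_cast; ring
  simp only [e]
  rw [integral_const_mul, ← charFun_apply, charFun_neg, hφ, Complex.conj_ofReal]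
  push_cast; ring

lemma phi_cont {d : ℕ} (Λ : Measure (Eu d)) [IsProbabilityMeasure Λ] (φ : Eu d → ℝ) (hφ : ∀ ξ, charFun Λ ξ = φ ξ) : Continuous φ := by
  have h : φ = fun ξ => (charFun Λ ξ).re := by ext ξ; rw [hφ]; simp
  rw [h]
  exact Complex.continuous_re.comp continuous_charFun

lemma phi_le {d : ℕ} (Λ : Measure (Eu d)) [IsProbabilityMeasure Λ] (φ : Eu d → ℝ) (hφ : ∀ ξ, charFun Λ ξ = φ ξ) (ξ : Eu d) : |φ ξ| ≤ 1 := by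
  have := norm_charFun_le_one (μ := Λ) ξ
  rw [hφ] at this
  simpa using this

lemma phi_gauss_int {d : ℕ} (Λ : Measure (Eu d)) [IsProbabilityMeasure Λ] (φ : Eu d → ℝ) (hφ : ∀ ξ, charFun Λ ξ = φ ξ)
    (u : ℝ) (hu : 0 < u) : Integrable (fun ξ => Real.exp (-u * ‖ξ‖^2) * φ ξ) := by
  refine (gauss_int d u hu).mono' ?_ ?_
  · exact (Continuous.mul (by fun_prop) (phi_cont Λ φ hφ)).aestronglyMeasurable
  · refine Filter.Eventually.of_forall fun ξ => ?_
    rw [norm_mul, Real.norm_of_nonneg (Real.exp_pos _).le]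
    exact mul_le_of_le_one_right (Real.exp_pos _).le (phi_le Λ φ hφ ξ)

lemma gauss_frostman {d : ℕ} (s C₀ : ℝ) (hs0 : 0 ≤ s) (hs2 : s ≤ d) (hC₀ : 0 < C₀) : ∃ C, 0 < C ∧ ∀ (Λ : Measure (Eu d)),
    (∀ r : ℝ, 0 < r → Λ (ball 0 r) ≤ ENNReal.ofReal (C₀ * r ^ s)) → ∀ u : ℝ, 0 < u →
    ∫⁻ y, ENNReal.ofReal (Real.exp (-(1/(4*u)) * ‖y‖^2)) ∂Λ ≤ ENNReal.ofReal (C * u ^ (s/2)) := by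
  let a : ℕ → ℝ := fun n => Real.exp (1/4) * (((n+1:ℕ):ℝ)^d * Real.exp (-(1/4) * ((n+1:ℕ):ℝ)))
  have ha : Summable a := by
    refine Summable.mul_left _ ?_
    exact (summable_nat_add_iff 1).2 (Real.summable_pow_mul_exp_neg_nat_mul d (r := 1/4) (by norm_num))
  have ha0 : ∀ n, 0 < a n := fun n => by simp only [a]; positivity
  refine ⟨C₀ * ∑' n, a n, mul_pos hC₀ (ha.tsum_pos (fun n => (ha0 n).le) 0 (ha0 0)), fun Λ hΛ u hu => ?_⟩
  have hsu : 0 < √u := Real.sqrt_pos.2 hu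
  have hpt : ∀ y : Eu d, ENNReal.ofReal (Real.exp (-(1/(4*u)) * ‖y‖^2)) ≤
      ∑' n : ℕ, (ball (0:Eu d) ((n+1) * √u)).indicator (fun _ => ENNReal.ofReal (Real.exp (-(1/4) * n))) y := by
    intro y
    set n := ⌊‖y‖ / √u⌋₊ with hn
    have h1 : (n:ℝ) ≤ ‖y‖ / √u := Nat.floor_le (by positivity)
    have h2 : ‖y‖ / √u < n + 1 := Nat.lt_floor_add_one _
    refine le_trans ?_ (ENNReal.le_tsum n)
    rw [Set.indicator_of_mem (by rw [mem_ball_zero_iff]; exact (div_lt_iff₀ hsu).1 h2)]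
    refine ENNReal.ofReal_le_ofReal (Real.exp_le_exp.2 ?_)
    have h3 : (n:ℝ)^2 ≤ ‖y‖^2 / u := by
      have := pow_le_pow_left₀ (by positivity) h1 2
      rwa [div_pow, Real.sq_sqrt hu.le] at this
    have h4 : (n:ℝ) ≤ (n:ℝ)^2 := by exact_mod_cast Nat.le_self_pow (by norm_num) n
    have h5 : 1/(4*u) * ‖y‖^2 = (1/4) * (‖y‖^2/u) := by field_simp
    nlinarith
  refine (lintegral_mono hpt).trans ?_
  rw [lintegral_tsum (fun n => (measurable_const.indicator measurableSet_ball).aemeasurable)]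
  have hterm : ∀ n : ℕ, ∫⁻ y, (ball (0:Eu d) ((n+1) * √u)).indicator (fun _ => ENNReal.ofReal (Real.exp (-(1/4) * n))) y ∂Λ
      ≤ ENNReal.ofReal (C₀ * a n * u^(s/2)) := by
    intro n
    rw [lintegral_indicator_const measurableSet_ball]
    refine (mul_le_mul_right (hΛ _ (by positivity)) _).trans ?_
    rw [← ENNReal.ofReal_mul (by positivity)]
    apply ENNReal.ofReal_le_ofReal
    rw [Real.mul_rpow (by positivity) hsu.le, Real.sqrt_eq_rpow, ← Real.rpow_mul hu.le]
    have e1 : (1/2:ℝ) * s = s/2 := by ring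
    rw [e1]
    have e2 : ((n:ℝ)+1)^s ≤ ((n+1:ℕ):ℝ)^d := by
      rw [← Real.rpow_natCast]
      push_cast
      exact Real.rpow_le_rpow_of_exponent_le (by linarith [Nat.cast_nonneg (α := ℝ) n]) hs2
    have e3 : Real.exp (-(1/4) * (n:ℝ)) = Real.exp (1/4) * Real.exp (-(1/4) * ((n+1:ℕ):ℝ)) := by
      rw [← Real.exp_add]; congr 1; push_cast; ring
    calc _ = C₀ * (((n:ℝ)+1)^s * Real.exp (-(1/4) * (n:ℝ))) * u^(s/2) := by ring
      _ ≤ C₀ * (((n+1:ℕ):ℝ)^d * Real.exp (-(1/4) * (n:ℝ))) * u^(s/2) := by gcongr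
      _ = _ := by rw [e3]; simp only [a]; ring
  refine (ENNReal.tsum_le_tsum hterm).trans ?_
  rw [← ENNReal.ofReal_tsum_of_nonneg (fun n => by have := ha0 n; positivity) ((ha.mul_left C₀).mul_right _), tsum_mul_right, tsum_mul_left]

lemma energy {d : ℕ} (s C₀ : ℝ) (hs0 : 0 ≤ s) (hs2 : s ≤ d) (hC₀ : 0 < C₀) : ∃ C, 0 < C ∧ ∀ (Λ : Measure (Eu d)) [IsProbabilityMeasure Λ]
    (φ : Eu d → ℝ), (∀ ξ, charFun Λ ξ = φ ξ) → (∀ ξ, 0 ≤ φ ξ) →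
    (∀ r : ℝ, 0 < r → Λ (ball 0 r) ≤ ENNReal.ofReal (C₀ * r ^ s)) → ∀ u : ℝ, 0 < u →
    ∫⁻ ξ : Eu d, ENNReal.ofReal (Real.exp (-u * ‖ξ‖^2) * φ ξ) ≤ ENNReal.ofReal (C * u ^ ((s-d)/2)) := by
  obtain ⟨C, hC, h⟩ := gauss_frostman (d := d) s C₀ hs0 hs2 hC₀
  refine ⟨C * Real.pi ^ ((d:ℝ)/2), by positivity, fun Λ _ φ hφ hφ0 hΛ u hu => ?_⟩
  rw [← ofReal_integral_eq_lintegral_ofReal (phi_gauss_int Λ φ hφ u hu) (Filter.Eventually.of_forall fun ξ => mul_nonneg (Real.exp_pos _).le (hφ0 ξ))]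
  apply ENNReal.ofReal_le_ofReal
  have h1 := lam_fourier Λ φ hφ u hu 0
  simp only [inner_zero_right, Complex.ofReal_zero, mul_zero, Complex.exp_zero, mul_one] at h1
  rw [integral_complex_ofReal] at h1
  have h2 : lam Λ u 0 = ((2*Real.pi)^d)⁻¹ * ∫ ξ : Eu d, Real.exp (-u * ‖ξ‖^2) * φ ξ := by exact_mod_cast h1
  have h3 : lam Λ u 0 = ((2 * Real.pi)^d)⁻¹ * ((Real.pi / u) ^ ((d:ℝ)/2) * ∫ y, Real.exp (-(1/(4*u)) * ‖y‖^2) ∂Λ) := by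
    simp only [lam, gk, zero_sub, norm_neg]
    rw [integral_const_mul, mul_assoc]
  have h4 : ∫ ξ : Eu d, Real.exp (-u * ‖ξ‖^2) * φ ξ = (Real.pi / u) ^ ((d:ℝ)/2) * ∫ y, Real.exp (-(1/(4*u)) * ‖y‖^2) ∂Λ :=
    mul_left_cancel₀ (by positivity) (h2.symm.trans h3)
  have h5 : ∫ y, Real.exp (-(1/(4*u)) * ‖y‖^2) ∂Λ ≤ C * u^(s/2) := by
    rw [integral_eq_lintegral_of_nonneg_ae (Filter.Eventually.of_forall fun y => (Real.exp_pos _).le) (Continuous.aestronglyMeasurable (by fun_prop))]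
    exact ENNReal.toReal_le_of_le_ofReal (by positivity) (h Λ hΛ u hu)
  rw [h4]
  calc _ ≤ (Real.pi / u) ^ ((d:ℝ)/2) * (C * u^(s/2)) := by gcongr
    _ = _ := by
      rw [Real.div_rpow Real.pi_pos.le hu.le, sub_div, Real.rpow_sub hu]; field_simp


noncomputable def rho {d : ℕ} (Λ : Measure (Eu d)) (T u : ℝ) (ω : Eu d) : ℝ :=
  ∫ t in (0:ℝ)..(T+1), wfun d T t * lam Λ u (t • ω)

lemma rho_nonneg {d : ℕ} (Λ : Measure (Eu d)) (T u : ℝ) (hT : 0 < T) (hu : 0 < u) (ω : Eu d) : 0 ≤ rho Λ T u ω := by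
  unfold rho
  refine intervalIntegral.integral_nonneg (by linarith) fun t ht => ?_
  exact mul_nonneg (wfun_nonneg d T t ht.1) (lam_nonneg Λ u hu _)

lemma rho_cont {d : ℕ} (Λ : Measure (Eu d)) [IsProbabilityMeasure Λ] (T u : ℝ) (hu : 0 < u) : Continuous (rho Λ T u) := by
  unfold rho
  apply intervalIntegral.continuous_parametric_intervalIntegral_of_continuous'
  have := wfun_cont d T
  have := lam_cont Λ u hu
  simp only [Function.uncurry_def]
  fun_prop

lemma rho_fourier {d : ℕ} (Λ : Measure (Eu d)) [IsProbabilityMeasure Λ] (φ : Eu d → ℝ) (hφ : ∀ ξ, charFun Λ ξ = φ ξ)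
    (T u : ℝ) (hT : 0 < T) (hu : 0 < u) (ω : Eu d) :
    (rho Λ T u ω : ℂ) = ((2 * Real.pi)^d)⁻¹ * ∫ ξ : Eu d, (Real.exp (-u * ‖ξ‖^2) * φ ξ : ℝ) * what d T (inner ℝ ξ ω) := by
  have hw := wfun_cont d T
  have hp := phi_cont Λ φ hφ
  unfold rho
  rw [← intervalIntegral.integral_ofReal]
  have hL : (0:ℝ) ≤ T + 1 := by linarith
  have hint : Integrable (Function.uncurry fun (t : ℝ) (ξ : Eu d) => (wfun d T t : ℂ) * ((Real.exp (-u * ‖ξ‖^2) * φ ξ : ℝ) * Complex.exp (Complex.I * (inner ℝ ξ (t • ω) : ℝ))))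
      ((volume.restrict (Set.Ioc 0 (T+1))).prod volume) := by
    have hwi : Integrable (wfun d T) (volume.restrict (Set.Ioc 0 (T+1))) :=
      (hw.integrableOn_Icc (a := 0) (b := T+1)).mono_set Set.Ioc_subset_Icc_self
    refine (hwi.norm.mul_prod (phi_gauss_int Λ φ hφ u hu).norm).mono' ?_ ?_
    · apply Continuous.aestronglyMeasurable
      simp only [Function.uncurry_def]
      fun_prop
    · refine Filter.Eventually.of_forall fun p => ?_
      simp only [Function.uncurry]
      rw [norm_mul, norm_mul, Complex.norm_real, Complex.norm_real, mul_comm Complex.I, Complex.norm_exp_ofReal_mul_I, mul_one]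
  have h1 : ∀ t : ℝ, ((wfun d T t * lam Λ u (t • ω) : ℝ) : ℂ) = ((2 * Real.pi)^d)⁻¹ *
      ∫ ξ : Eu d, (wfun d T t : ℂ) * ((Real.exp (-u * ‖ξ‖^2) * φ ξ : ℝ) * Complex.exp (Complex.I * (inner ℝ ξ (t • ω) : ℝ))) := by
    intro t
    rw [Complex.ofReal_mul, lam_fourier Λ φ hφ u hu, integral_const_mul]; ring
  simp only [h1]
  rw [intervalIntegral.integral_const_mul]
  congr 1
  rw [intervalIntegral.integral_of_le hL, integral_integral_swap hint]
  refine integral_congr_ae (Filter.Eventually.of_forall fun ξ => ?_)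
  simp only [what]
  rw [intervalIntegral.integral_of_le hL, ← integral_const_mul]
  refine integral_congr_ae (Filter.Eventually.of_forall fun t => ?_)
  simp only [real_inner_smul_right]
  have : Complex.I * ((t * inner ℝ ξ ω : ℝ) : ℂ) = Complex.I * (inner ℝ ξ ω : ℝ) * t := by push_cast; ring
  rw [this]; ring

/-- The common majorant. -/
noncomputable def Nf {d : ℕ} (φ : Eu d → ℝ) (A ε : ℝ) (ω : Eu d) : ENNReal :=
  ∫⁻ ξ : Eu d, ENNReal.ofReal (A * (ε * ‖ξ‖) * (Real.exp (-(ε^2/8) * ‖ξ‖^2) * φ ξ) * (1 / (1 + (inner ℝ ξ ω)^2)))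

lemma Nf_meas_aux {d : ℕ} (φ : Eu d → ℝ) (hφ : Continuous φ) (A ε : ℝ) : Measurable (fun p : Eu d × Eu d =>
    ENNReal.ofReal (A * (ε * ‖p.2‖) * (Real.exp (-(ε^2/8) * ‖p.2‖^2) * φ p.2) * (1 / (1 + (inner ℝ p.2 p.1)^2)))) := by
  refine ENNReal.measurable_ofReal.comp (Continuous.measurable ?_)
  refine Continuous.mul (by fun_prop) (Continuous.div (by fun_prop) (by fun_prop) fun x => by positivity)

lemma Nf_meas {d : ℕ} (φ : Eu d → ℝ) (hφ : Continuous φ) (A ε : ℝ) : Measurable (Nf φ A ε) :=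
  (Nf_meas_aux φ hφ A ε).lintegral_prod_right'

lemma Nf_bound {d : ℕ} (hd : 2 ≤ d) (s C₀ A : ℝ) (hA : 0 < A) (hs0 : 0 ≤ s) (hs2 : s ≤ d) (hC₀ : 0 < C₀) : ∃ C, 0 < C ∧ ∀ (Λ : Measure (Eu d)) [IsProbabilityMeasure Λ]
    (φ : Eu d → ℝ), (∀ ξ, charFun Λ ξ = φ ξ) → (∀ ξ, 0 ≤ φ ξ) →
    (∀ r : ℝ, 0 < r → Λ (ball 0 r) ≤ ENNReal.ofReal (C₀ * r ^ s)) → ∀ ε : ℝ, 0 < ε →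
    ∫⁻ ω, Nf φ A ε ω ∂(S0 d) ≤ ENNReal.ofReal (C * ε ^ (s - ((d:ℝ)-1))) := by
  obtain ⟨Ce, hCe, he⟩ := energy (d := d) s C₀ hs0 hs2 hC₀
  obtain ⟨Cb, hCb, hb⟩ := band d hd
  refine ⟨A * Cb * (Ce * (1/8:ℝ)^((s-d)/2)), by positivity, fun Λ _ φ hφ hφ0 hΛ ε hε => ?_⟩
  have hp := phi_cont Λ φ hφ
  unfold Nf
  rw [lintegral_lintegral_swap (Nf_meas_aux φ hp A ε).aemeasurable]
  have hmeas2 : ∀ ξ : Eu d, Measurable (fun ω : Eu d => ENNReal.ofReal (1 / (1 + (inner ℝ ξ ω)^2))) := by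
    intro ξ
    refine ENNReal.measurable_ofReal.comp ?_
    apply Continuous.measurable
    refine Continuous.div (by fun_prop) (by fun_prop) fun x => by positivity
  have hstep : ∀ ξ : Eu d, ∫⁻ ω, ENNReal.ofReal (A * (ε * ‖ξ‖) * (Real.exp (-(ε^2/8) * ‖ξ‖^2) * φ ξ) * (1 / (1 + (inner ℝ ξ ω)^2))) ∂(S0 d)
      ≤ ENNReal.ofReal (A * Cb * ε) * ENNReal.ofReal (Real.exp (-(ε^2/8) * ‖ξ‖^2) * φ ξ) := by
    intro ξ
    have hx : 0 ≤ Real.exp (-(ε^2/8) * ‖ξ‖^2) * φ ξ := mul_nonneg (Real.exp_pos _).le (hφ0 ξ)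
    have : ∀ ω : Eu d, ENNReal.ofReal (A * (ε * ‖ξ‖) * (Real.exp (-(ε^2/8) * ‖ξ‖^2) * φ ξ) * (1 / (1 + (inner ℝ ξ ω)^2)))
        = (ENNReal.ofReal (A * ε) * ENNReal.ofReal (Real.exp (-(ε^2/8) * ‖ξ‖^2) * φ ξ) * ENNReal.ofReal ‖ξ‖) * ENNReal.ofReal (1 / (1 + (inner ℝ ξ ω)^2)) := by
      intro ω
      rw [← ENNReal.ofReal_mul (by positivity), ← ENNReal.ofReal_mul (by positivity), ← ENNReal.ofReal_mul (by positivity)]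
      congr 1; ring
    simp only [this]
    rw [lintegral_const_mul _ (hmeas2 ξ), mul_assoc]
    refine (mul_le_mul_right (hb ξ) _).trans (le_of_eq ?_)
    rw [← ENNReal.ofReal_mul (by positivity), ← ENNReal.ofReal_mul (by positivity), ← ENNReal.ofReal_mul (by positivity)]
    congr 1; ring
  refine (lintegral_mono hstep).trans ?_
  rw [lintegral_const_mul _ (by fun_prop)]
  refine (mul_le_mul_right (he Λ φ hφ hφ0 hΛ (ε^2/8) (by positivity)) _).trans (le_of_eq ?_)
  rw [← ENNReal.ofReal_mul (by positivity)]
  congr 1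
  have e1 : (ε^2/8)^((s-d)/2) = (1/8:ℝ)^((s-d)/2) * ε^(s-d) := by
    rw [show ε^2/8 = (1/8) * ε^2 by ring, Real.mul_rpow (by norm_num) (by positivity), ← Real.rpow_natCast, ← Real.rpow_mul hε.le]
    congr 2; push_cast; ring
  have e2 : ε ^ (s - ((d:ℝ)-1)) = ε * ε^(s-d) := by
    rw [show s - ((d:ℝ)-1) = 1 + (s - d) by ring, Real.rpow_add hε, Real.rpow_one]
  rw [e1, e2]; ring

lemma exp_aux (x : ℝ) (hx : 0 ≤ x) : x ≤ 2 * Real.exp (x^2/8) := by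
  have := Real.add_one_le_exp (x^2/8)
  nlinarith [sq_nonneg (x - 2)]

lemma rho_diff_le {d : ℕ} (A : ℝ) (Λ : Measure (Eu d)) [IsProbabilityMeasure Λ] (φ : Eu d → ℝ) (hφ : ∀ ξ, charFun Λ ξ = φ ξ)
    (T : ℝ) (hT : 0 < T) (ε u u' : ℝ) (hu : 0 < u) (hu' : 0 < u') (ω ω' ω₀ : Eu d)
    (hwint : ∀ u ω, 0 < u → Integrable (fun ξ : Eu d => ((Real.exp (-u * ‖ξ‖^2) * φ ξ : ℝ) : ℂ) * what d T (inner ℝ ξ ω)))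
    (h : ∀ ξ : Eu d, ‖((Real.exp (-u * ‖ξ‖^2) * φ ξ : ℝ) : ℂ) * what d T (inner ℝ ξ ω) - ((Real.exp (-u' * ‖ξ‖^2) * φ ξ : ℝ) : ℂ) * what d T (inner ℝ ξ ω')‖
      ≤ A * (ε * ‖ξ‖) * (Real.exp (-(ε^2/8) * ‖ξ‖^2) * φ ξ) * (1 / (1 + (inner ℝ ξ ω₀)^2))) :
    ENNReal.ofReal |rho Λ T u ω - rho Λ T u' ω'| ≤ Nf φ A ε ω₀ := by
  have h1 : ((rho Λ T u ω - rho Λ T u' ω' : ℝ) : ℂ) = ((2 * Real.pi)^d)⁻¹ * ∫ ξ : Eu d,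
      (((Real.exp (-u * ‖ξ‖^2) * φ ξ : ℝ) : ℂ) * what d T (inner ℝ ξ ω) - ((Real.exp (-u' * ‖ξ‖^2) * φ ξ : ℝ) : ℂ) * what d T (inner ℝ ξ ω')) := by
    rw [integral_sub (hwint u ω hu) (hwint u' ω' hu'), mul_sub, ← rho_fourier Λ φ hφ T u hT hu, ← rho_fourier Λ φ hφ T u' hT hu']
    push_cast; rfl
  have h2 : |rho Λ T u ω - rho Λ T u' ω'| ≤ ‖∫ ξ : Eu d,
      (((Real.exp (-u * ‖ξ‖^2) * φ ξ : ℝ) : ℂ) * what d T (inner ℝ ξ ω) - ((Real.exp (-u' * ‖ξ‖^2) * φ ξ : ℝ) : ℂ) * what d T (inner ℝ ξ ω'))‖ := by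
    rw [← Real.norm_eq_abs, ← Complex.norm_real, h1, norm_mul]
    refine mul_le_of_le_one_left (norm_nonneg _) ?_
    have : (1:ℝ) ≤ (2 * Real.pi)^d := one_le_pow₀ (by linarith [Real.pi_gt_three])
    rw [Complex.norm_real, Real.norm_of_nonneg (by positivity)]
    exact inv_le_one_of_one_le₀ this
  refine (ENNReal.ofReal_le_ofReal h2).trans ?_
  rw [ofReal_norm_eq_enorm]
  refine (enorm_integral_le_lintegral_enorm _).trans ?_
  unfold Nf
  refine lintegral_mono fun ξ => ?_
  rw [← ofReal_norm_eq_enorm]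
  exact ENNReal.ofReal_le_ofReal (h ξ)

lemma rho_key (d : ℕ) (hd : 2 ≤ d) (T : ℝ) (hT : 0 < T) : ∃ A : ℝ, 0 < A ∧ ∀ (Λ : Measure (Eu d)) [IsProbabilityMeasure Λ]
    (φ : Eu d → ℝ), (∀ ξ, charFun Λ ξ = φ ξ) → (∀ ξ, 0 ≤ φ ξ) → ∀ ε : ℝ, 0 < ε →
    (∀ ω, ENNReal.ofReal |rho Λ T (ε^2/4) ω - rho Λ T (ε^2) ω| ≤ Nf φ A ε ω) ∧
    (∀ ω ω', dist ω ω' ≤ ε → ENNReal.ofReal |rho Λ T (ε^2) ω - rho Λ T (ε^2) ω'| ≤ Nf φ A ε ω) := by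
  obtain ⟨A, hA, hA1, hA2⟩ := what_bd d hd T hT
  refine ⟨3 * A, by positivity, fun Λ _ φ hφ hφ0 ε hε => ?_⟩
  have hp := phi_cont Λ φ hφ
  have hwint : ∀ u ω, 0 < u → Integrable (fun ξ : Eu d => ((Real.exp (-u * ‖ξ‖^2) * φ ξ : ℝ) : ℂ) * what d T (inner ℝ ξ ω)) := by
    intro u ω hu
    have hwc := what_cont d T
    refine ((phi_gauss_int Λ φ hφ u hu).norm.mul_const A).mono' ?_ ?_
    · apply Continuous.aestronglyMeasurable
      fun_prop
    · refine Filter.Eventually.of_forall fun ξ => ?_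
      rw [norm_mul, Complex.norm_real]
      refine mul_le_mul_of_nonneg_left ((hA1 _).trans (div_le_self hA.le ?_)) (norm_nonneg _)
      nlinarith [sq_nonneg (inner ℝ ξ ω)]
  constructor
  · intro ω
    refine rho_diff_le (3*A) Λ φ hφ T hT ε _ _ (by positivity) (by positivity) ω ω ω hwint fun ξ => ?_
    rw [← sub_mul, ← Complex.ofReal_sub, norm_mul, Complex.norm_real, ← sub_mul, norm_mul, Real.norm_of_nonneg (hφ0 ξ)]
    set x := ε * ‖ξ‖ with hx
    have hx0 : 0 ≤ x := by positivity
    have e1 : -(ε^2/4) * ‖ξ‖^2 = -(x^2/4) := by rw [hx]; ring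
    have e2 : -(ε^2) * ‖ξ‖^2 = -(x^2) := by rw [hx]; ring
    have e3 : -(ε^2/8) * ‖ξ‖^2 = -(x^2/8) := by rw [hx]; ring
    rw [e1, e2, e3]
    have h1 : ‖Real.exp (-(x^2/4)) - Real.exp (-(x^2))‖ ≤ 3 * x * Real.exp (-(x^2/8)) := by
      have f1 : Real.exp (-x^2) = Real.exp (-(x^2/4)) * Real.exp (-(3*x^2/4)) := by rw [← Real.exp_add]; congr 1; ring
      have f2 := Real.add_one_le_exp (-(3*x^2/4))
      have f3 : Real.exp (-(3*x^2/4)) ≤ 1 := Real.exp_le_one_iff.2 (by nlinarith [sq_nonneg x])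
      have f4 := Real.exp_pos (-(x^2/4))
      have f5 : Real.exp (-(x^2/4)) * x ≤ 2 * Real.exp (-(x^2/8)) := by
        have : Real.exp (-(x^2/8)) = Real.exp (-(x^2/4)) * Real.exp (x^2/8) := by rw [← Real.exp_add]; congr 1; ring
        rw [this]; nlinarith [exp_aux x hx0]
      rw [f1, show Real.exp (-(x^2/4)) - Real.exp (-(x^2/4)) * Real.exp (-(3*x^2/4)) = Real.exp (-(x^2/4)) * (1 - Real.exp (-(3*x^2/4))) by ring]
      rw [Real.norm_of_nonneg (mul_nonneg f4.le (by linarith))]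
      calc _ ≤ Real.exp (-(x^2/4)) * (3*x^2/4) := mul_le_mul_of_nonneg_left (by linarith) f4.le
        _ = (Real.exp (-(x^2/4)) * x) * (3/4 * x) := by ring
        _ ≤ (2 * Real.exp (-(x^2/8))) * (3/4 * x) := mul_le_mul_of_nonneg_right f5 (by positivity)
        _ ≤ _ := by nlinarith [mul_nonneg hx0 (Real.exp_pos (-(x^2/8))).le]
    have h2 := hA1 (inner ℝ ξ ω)
    calc _ ≤ (3 * x * Real.exp (-(x^2/8)) * φ ξ) * (A / (1 + (inner ℝ ξ ω)^2)) :=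
          mul_le_mul (mul_le_mul_of_nonneg_right h1 (hφ0 ξ)) h2 (norm_nonneg _) (by have := hφ0 ξ; positivity)
      _ = _ := by ring
  · intro ω ω' hdist
    refine rho_diff_le (3*A) Λ φ hφ T hT ε _ _ (by positivity) (by positivity) ω ω' ω hwint fun ξ => ?_
    rw [← mul_sub, norm_mul, Complex.norm_real, Real.norm_of_nonneg (mul_nonneg (Real.exp_pos _).le (hφ0 ξ))]
    set x := ε * ‖ξ‖ with hx
    have hx0 : 0 ≤ x := by positivity
    have e2 : -(ε^2) * ‖ξ‖^2 = -(x^2) := by rw [hx]; ring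
    have e3 : -(ε^2/8) * ‖ξ‖^2 = -(x^2/8) := by rw [hx]; ring
    rw [e2, e3]
    have h2 := hA2 (inner ℝ ξ ω) (inner ℝ ξ ω' - inner ℝ ξ ω)
    rw [add_sub_cancel] at h2
    have hδ : |inner ℝ ξ ω' - inner ℝ ξ ω| ≤ x := by
      rw [← inner_sub_right]
      refine (abs_real_inner_le_norm _ _).trans ?_
      rw [hx, mul_comm]
      refine mul_le_mul_of_nonneg_right ?_ (norm_nonneg _)
      rwa [← dist_eq_norm, dist_comm]
    have h3 : A * (|inner ℝ ξ ω' - inner ℝ ξ ω| * (1 + |inner ℝ ξ ω' - inner ℝ ξ ω|)) / (1 + (inner ℝ ξ ω)^2) ≤ A * (x * (1 + x)) / (1 + (inner ℝ ξ ω)^2) := by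
      gcongr
    have h4 : Real.exp (-x^2) * (1 + x) ≤ 3 * Real.exp (-(x^2/8)) := by
      have f1 : Real.exp (-(x^2/8)) = Real.exp (-x^2) * Real.exp (7*x^2/8) := by rw [← Real.exp_add]; congr 1; ring
      have f2 : Real.exp (x^2/8) ≤ Real.exp (7*x^2/8) := Real.exp_le_exp.2 (by nlinarith [sq_nonneg x])
      have f3 : 1 ≤ Real.exp (7*x^2/8) := Real.one_le_exp (by positivity)
      rw [f1]
      nlinarith [exp_aux x hx0, Real.exp_pos (-x^2)]
    calc _ ≤ (Real.exp (-x^2) * φ ξ) * (A * (x * (1 + x)) / (1 + (inner ℝ ξ ω)^2)) :=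
          mul_le_mul_of_nonneg_left (h2.trans h3) (mul_nonneg (Real.exp_pos _).le (hφ0 ξ))
      _ = (Real.exp (-x^2) * (1 + x)) * (A * x * φ ξ / (1 + (inner ℝ ξ ω)^2)) := by ring
      _ ≤ (3 * Real.exp (-(x^2/8))) * (A * x * φ ξ / (1 + (inner ℝ ξ ω)^2)) := by
          refine mul_le_mul_of_nonneg_right h4 ?_
          have := hφ0 ξ; positivity
      _ = _ := by ring


open scoped BoundedContinuousFunction NNReal Topology in
lemma density_lemma {d : ℕ} (S ν : Measure (Eu d)) [IsFiniteMeasure S] [IsFiniteMeasure ν]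
    (r : ℕ → Eu d → ℝ) (hrm : ∀ k, Measurable (r k)) (hr0 : ∀ k ω, 0 ≤ r k ω)
    (N : ℕ → Eu d → ENNReal) (hNm : ∀ k, Measurable (N k))
    (hN : ∀ k ω, ENNReal.ofReal |r (k+1) ω - r k ω| ≤ N k ω)
    (C q : ℝ) (hC : 0 < C) (hq0 : 0 < q) (hq1 : q < 1) (hNi : ∀ k, ∫⁻ ω, N k ω ∂S ≤ ENNReal.ofReal (C * q^k))
    (hw : ∀ h : Eu d →ᵇ ℝ≥0, Filter.Tendsto (fun k => ∫⁻ ω, h ω * ENNReal.ofReal (r k ω) ∂S) Filter.atTop (𝓝 (∫⁻ ω, h ω ∂ν))) :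
    ∃ ρ : Eu d → ℝ, Measurable ρ ∧ (∀ ω, 0 ≤ ρ ω) ∧ ν = S.withDensity (fun ω => ENNReal.ofReal (ρ ω)) ∧
      (∀ k, ∀ᵐ ω ∂S, ENNReal.ofReal |ρ ω - r k ω| ≤ ∑' j, N (k + j) ω) ∧
      (∀ k, ∫⁻ ω, (∑' j, N (k + j) ω) ∂S ≤ ENNReal.ofReal (C / (1 - q) * q^k)) := by
  have htail : ∀ k, ∫⁻ ω, (∑' j, N (k + j) ω) ∂S ≤ ENNReal.ofReal (C / (1 - q) * q^k) := by
    intro k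
    rw [lintegral_tsum (fun j => (hNm _).aemeasurable)]
    refine (ENNReal.tsum_le_tsum (fun j => hNi (k+j))).trans ?_
    have hs : Summable (fun j => C * q^(k+j)) := by
      simp only [pow_add, ← mul_assoc]
      exact (summable_geometric_of_lt_one hq0.le hq1).mul_left _
    rw [← ENNReal.ofReal_tsum_of_nonneg (fun j => by positivity) hs]
    apply ENNReal.ofReal_le_ofReal
    simp only [pow_add, ← mul_assoc]
    rw [tsum_mul_left, tsum_geometric_of_lt_one hq0.le hq1]
    apply le_of_eq; ring
  have hfin : ∀ᵐ ω ∂S, (∑' j, N j ω) < ⊤ := by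
    refine ae_lt_top (by fun_prop) ?_
    have := htail 0
    simp only [zero_add] at this
    exact (this.trans_lt ENNReal.ofReal_lt_top).ne
  have hfin2 : ∀ᵐ ω ∂S, (∀ j, N j ω ≠ ⊤) ∧ Summable (fun j => (N j ω).toReal) := by
    filter_upwards [hfin] with ω hω
    have h1 := ENNReal.ne_top_of_tsum_ne_top hω.ne
    exact ⟨h1, ENNReal.summable_toReal hω.ne⟩
  have hdist : ∀ ω, (∀ j, N j ω ≠ ⊤) → ∀ n, dist (r n ω) (r (n.succ) ω) ≤ (N n ω).toReal := by
    intro ω h n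
    rw [dist_comm, Real.dist_eq]
    exact (ENNReal.ofReal_le_iff_le_toReal (h n)).1 (hN n ω)
  have hlim : ∀ᵐ ω ∂S, ∃ l, Filter.Tendsto (fun n => r n ω) Filter.atTop (𝓝 l) := by
    filter_upwards [hfin2] with ω hω
    exact cauchySeq_tendsto_of_complete (cauchySeq_of_dist_le_of_summable _ (hdist ω hω.1) hω.2)
  obtain ⟨f, hfm, hf⟩ := measurable_limit_of_tendsto_metrizable_ae (fun n => (hrm n).aemeasurable) hlim
  have hρ : ∀ᵐ ω ∂S, Filter.Tendsto (fun n => r n ω) Filter.atTop (𝓝 |f ω|) := by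
    filter_upwards [hf] with ω hω
    have : 0 ≤ f ω := ge_of_tendsto' hω fun n => hr0 n ω
    rwa [abs_of_nonneg this]
  have hbd : ∀ k, ∀ᵐ ω ∂S, ENNReal.ofReal |(|f ω|) - r k ω| ≤ ∑' j, N (k + j) ω := by
    intro k
    filter_upwards [hρ, hfin2] with ω h1 h2
    have := dist_le_tsum_of_dist_le_of_tendsto _ (hdist ω h2.1) h2.2 h1 k
    rw [dist_comm, Real.dist_eq] at this
    refine (ENNReal.ofReal_le_ofReal this).trans ?_
    rw [ENNReal.ofReal_tsum_of_nonneg (fun _ => ENNReal.toReal_nonneg) (h2.2.comp_injective (add_right_injective k))]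
    exact ENNReal.tsum_le_tsum fun j => ENNReal.ofReal_toReal_le
  have hρm : Measurable (fun ω => |f ω|) := by fun_prop
  refine ⟨fun ω => |f ω|, hρm, fun ω => abs_nonneg _, ?_, hbd, htail⟩
  apply ext_of_forall_lintegral_eq_of_IsFiniteMeasure
  intro h
  have hhm : Measurable (fun ω => (h ω : ENNReal)) := by
    have := h.continuous
    exact (ENNReal.continuous_coe.comp this).measurable
  rw [lintegral_withDensity_eq_lintegral_mul _ (by fun_prop) hhm]
  have hcomm : ∫⁻ ω, ((fun ω => ENNReal.ofReal |f ω|) * fun ω => (h ω : ENNReal)) ω ∂S = ∫⁻ ω, h ω * ENNReal.ofReal |f ω| ∂S := by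
    refine lintegral_congr fun ω => ?_
    simp only [Pi.mul_apply]; rw [mul_comm]
  rw [hcomm]
  set K : ENNReal := ((nndist h 0 : ℝ≥0) : ENNReal) with hK
  have hKb : ∀ ω, (h ω : ENNReal) ≤ K := by
    intro ω
    have := BoundedContinuousFunction.nndist_coe_le_nndist (f := h) (g := 0) ω
    rw [hK]
    exact_mod_cast (by simpa using this : h ω ≤ nndist h 0)
  have hTt : Filter.Tendsto (fun k => K * ENNReal.ofReal (C / (1 - q) * q^k)) Filter.atTop (𝓝 0) := by
    have h1 : Filter.Tendsto (fun k => ENNReal.ofReal (C / (1 - q) * q^k)) Filter.atTop (𝓝 0) := by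
      have := ((tendsto_pow_atTop_nhds_zero_of_lt_one hq0.le hq1).const_mul (C / (1-q)))
      have := (ENNReal.continuous_ofReal.tendsto _).comp this
      simpa [Function.comp_def] using this
    have := ENNReal.Tendsto.const_mul (a := K) h1 (Or.inr (by rw [hK]; exact ENNReal.coe_ne_top))
    simpa using this
  have hineq : ∀ (a b : Eu d → ℝ) (k : ℕ), Measurable a → (∀ᵐ ω ∂S, ENNReal.ofReal |b ω - a ω| ≤ ∑' j, N (k + j) ω) →
      ∫⁻ ω, h ω * ENNReal.ofReal (b ω) ∂S ≤ ∫⁻ ω, h ω * ENNReal.ofReal (a ω) ∂S + K * ENNReal.ofReal (C / (1 - q) * q^k) := by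
    intro a b k ha hab
    calc _ ≤ ∫⁻ ω, (h ω * ENNReal.ofReal (a ω) + K * ∑' j, N (k + j) ω) ∂S := by
          refine lintegral_mono_ae ?_
          filter_upwards [hab] with ω hω
          have : ENNReal.ofReal (b ω) ≤ ENNReal.ofReal (a ω) + ENNReal.ofReal |b ω - a ω| := by
            refine le_trans (ENNReal.ofReal_le_ofReal ?_) ENNReal.ofReal_add_le
            linarith [le_abs_self (b ω - a ω)]
          calc _ ≤ (h ω : ENNReal) * (ENNReal.ofReal (a ω) + ENNReal.ofReal |b ω - a ω|) := mul_le_mul_right this _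
            _ = _ := mul_add _ _ _
            _ ≤ _ := add_le_add le_rfl (mul_le_mul' (hKb ω) hω)
      _ = ∫⁻ ω, h ω * ENNReal.ofReal (a ω) ∂S + K * ∫⁻ ω, (∑' j, N (k + j) ω) ∂S := by
          rw [lintegral_add_left (by fun_prop), lintegral_const_mul _ (by fun_prop)]
      _ ≤ _ := add_le_add le_rfl (mul_le_mul_right (htail k) _)
  apply le_antisymm
  · have h1 : ∀ k, ∫⁻ ω, h ω * ENNReal.ofReal (r k ω) ∂S ≤ ∫⁻ ω, h ω * ENNReal.ofReal |f ω| ∂S + K * ENNReal.ofReal (C / (1 - q) * q^k) := by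
      intro k
      refine hineq _ _ k hρm ?_
      filter_upwards [hbd k] with ω hω
      rwa [abs_sub_comm]
    have := le_of_tendsto_of_tendsto' (hw h) (hTt.const_add (∫⁻ ω, h ω * ENNReal.ofReal |f ω| ∂S)) h1
    simpa using this
  · have h1 : ∀ k, ∫⁻ ω, h ω * ENNReal.ofReal |f ω| ∂S ≤ ∫⁻ ω, h ω * ENNReal.ofReal (r k ω) ∂S + K * ENNReal.ofReal (C / (1 - q) * q^k) :=
      fun k => hineq _ _ k (hrm k) (hbd k)
    have := ge_of_tendsto' ((hw h).add hTt) h1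
    simpa using this


lemma gk_scale (d : ℕ) (u : ℝ) (hu : 0 < u) (y : Eu d) (H : Eu d → ENNReal) (hH : Measurable H) :
    ∫⁻ z, H z * ENNReal.ofReal (gk d u (z - y)) = ∫⁻ v, H (y + √u • v) * ENNReal.ofReal (gk d 1 v) := by
  have hsu : 0 < √u := Real.sqrt_pos.2 hu
  have hgm : Measurable (gk d u) := (gk_cont d u).measurable
  have h1 : ∫⁻ z, H z * ENNReal.ofReal (gk d u (z - y)) = ∫⁻ z, H (y + z) * ENNReal.ofReal (gk d u z) := by
    rw [← lintegral_add_left_eq_self (μ := volume) (fun z => H z * ENNReal.ofReal (gk d u (z - y))) y]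
    simp
  rw [h1]
  have h2 : ∫⁻ v, (fun z => H (y + z) * ENNReal.ofReal (gk d u z)) (√u • v) =
      ENNReal.ofReal (((√u)^d)⁻¹) * ∫⁻ z, H (y + z) * ENNReal.ofReal (gk d u z) := by
    have hm := Measure.map_addHaar_smul (volume : Measure (Eu d)) hsu.ne'
    have := lintegral_map (μ := (volume : Measure (Eu d))) (f := fun z => H (y + z) * ENNReal.ofReal (gk d u z)) (g := fun v => √u • v)
      (by fun_prop) (by fun_prop)
    rw [← this]
    change ∫⁻ z, _ ∂(Measure.map (√u • ·) volume) = _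
    rw [hm, lintegral_smul_measure, finrank_euclideanSpace, Fintype.card_fin, abs_of_nonneg (by positivity), smul_eq_mul]
  have h3 : ∀ v : Eu d, gk d u (√u • v) = ((√u)^d)⁻¹ * gk d 1 v := by
    intro v
    unfold gk
    rw [norm_smul, Real.norm_of_nonneg hsu.le, mul_pow (√u) ‖v‖ 2, Real.sq_sqrt hu.le, Real.div_rpow Real.pi_pos.le hu.le]
    have e1 : u ^ ((d:ℝ)/2) = (√u)^d := by
      rw [Real.sqrt_eq_rpow, ← Real.rpow_natCast, ← Real.rpow_mul hu.le]; congr 1; ring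
    have e2 : -(1/(4*u)) * (u * ‖v‖^2) = -(1/(4*1)) * ‖v‖^2 := by field_simp
    rw [e1, e2, div_one]
    field_simp
  have h4 : ∫⁻ v, (fun z => H (y + z) * ENNReal.ofReal (gk d u z)) (√u • v) = ENNReal.ofReal (((√u)^d)⁻¹) * ∫⁻ v, H (y + √u • v) * ENNReal.ofReal (gk d 1 v) := by
    have hg1 : Measurable (gk d 1) := (gk_cont d 1).measurable
    rw [← lintegral_const_mul _ (by fun_prop)]
    refine lintegral_congr fun v => ?_
    simp only [h3]
    rw [ENNReal.ofReal_mul (by positivity)]; ring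
  rw [h4] at h2
  exact ((ENNReal.mul_right_inj (by simp; positivity) ENNReal.ofReal_ne_top).1 h2).symm

lemma rho_polar {d : ℕ} (hd : 2 ≤ d) (Λ : Measure (Eu d)) [IsProbabilityMeasure Λ] (T u : ℝ) (hT : 0 < T) (hu : 0 < u)
    (h : Eu d → ENNReal) (hh : Measurable h) :
    ∫⁻ ω, h ω * ENNReal.ofReal (rho Λ T u ω) ∂(S0 d) =
    ∫⁻ z, (h (‖z‖⁻¹ • z) * ENNReal.ofReal (Real.smoothTransition (T - ‖z‖))) * ENNReal.ofReal (lam Λ u z) := by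
  have hlc := lam_cont Λ u hu
  have hlm := hlc.measurable
  have hsm : Measurable Real.smoothTransition := Real.smoothTransition.continuous.measurable
  rw [S0_polar d _ (by fun_prop) hd]
  refine lintegral_congr_ae ?_
  filter_upwards [S0_ae d] with ω hω
  have hω1 : ‖ω‖ = 1 := by simpa using hω
  have hwc := wfun_cont d T
  have hc : Continuous (fun t : ℝ => wfun d T t * lam Λ u (t • ω)) := by fun_prop
  unfold rho
  rw [intervalIntegral.integral_of_le (by linarith), ofReal_integral_eq_lintegral_ofReal
    ((hc.integrableOn_Icc (a := 0) (b := T+1)).mono_set Set.Ioc_subset_Icc_self) ?_]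
  · rw [← lintegral_const_mul _ (by fun_prop), ← lintegral_indicator measurableSet_Ioc, ← lintegral_indicator measurableSet_Ioi]
    refine lintegral_congr fun t => ?_
    by_cases ht : 0 < t
    · have hn : ‖t • ω‖ = t := by rw [norm_smul, hω1, Real.norm_of_nonneg ht.le, mul_one]
      rw [Set.indicator_of_mem (s := Set.Ioi 0) ht]
      simp only [hn]
      rw [smul_smul, inv_mul_cancel₀ ht.ne', one_smul]
      have e : ENNReal.ofReal (t^(d-1)) * (h ω * ENNReal.ofReal (Real.smoothTransition (T - t)) * ENNReal.ofReal (lam Λ u (t • ω)))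
          = h ω * ENNReal.ofReal (wfun d T t * lam Λ u (t • ω)) := by
        rw [ENNReal.ofReal_mul (wfun_nonneg d T t ht.le), wfun, ENNReal.ofReal_mul (by positivity)]; ring
      rw [e]
      by_cases ht2 : t ≤ T + 1
      · rw [Set.indicator_of_mem (s := Set.Ioc 0 (T+1)) ⟨ht, ht2⟩]
      · rw [Set.indicator_of_notMem (s := Set.Ioc 0 (T+1)) (fun hx => ht2 hx.2), wfun_zero d T t (by linarith)]; simp
    · rw [Set.indicator_of_notMem (s := Set.Ioc 0 (T+1)) (fun hx => ht hx.1), Set.indicator_of_notMem (s := Set.Ioi 0) ht]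
  · filter_upwards [ae_restrict_mem measurableSet_Ioc] with t ht
    exact mul_nonneg (wfun_nonneg d T t ht.1.le) (lam_nonneg Λ u hu _)

open scoped BoundedContinuousFunction NNReal Topology in
lemma weak_conv {d : ℕ} (hd : 2 ≤ d) (Λ : Measure (Eu d)) [IsProbabilityMeasure Λ] (T : ℝ) (hT : 0 < T)
    (hΛ0 : Λ {0} = 0) (hΛT : ∀ᵐ y ∂Λ, ‖y‖ ≤ T - 1) (u : ℕ → ℝ) (hu : ∀ k, 0 < u k)
    (hut : Filter.Tendsto u Filter.atTop (𝓝 0)) (h : Eu d →ᵇ ℝ≥0) :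
    Filter.Tendsto (fun k => ∫⁻ ω, h ω * ENNReal.ofReal (rho Λ T (u k) ω) ∂(S0 d)) Filter.atTop
      (𝓝 (∫⁻ y, h (‖y‖⁻¹ • y) ∂Λ)) := by
  have hhc : Continuous (fun ω => (h ω : ENNReal)) := ENNReal.continuous_coe.comp h.continuous
  have hhm := hhc.measurable
  have hsm : Measurable Real.smoothTransition := Real.smoothTransition.continuous.measurable
  have hg1 : Measurable (gk d 1) := (gk_cont d 1).measurable
  set H : Eu d → ENNReal := fun z => h (‖z‖⁻¹ • z) * ENNReal.ofReal (Real.smoothTransition (T - ‖z‖)) with hH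
  have hHm : Measurable H := by
    refine Measurable.mul (hhm.comp (by fun_prop)) (by fun_prop)
  have hHc : ∀ z : Eu d, z ≠ 0 → ContinuousAt H z := by
    intro z hz
    have h1 : ContinuousAt (fun z : Eu d => (h (‖z‖⁻¹ • z) * Real.toNNReal (Real.smoothTransition (T - ‖z‖)) : ℝ≥0)) z := by
      refine ContinuousAt.mul ?_ ?_
      · refine h.continuous.continuousAt.comp ?_
        exact ContinuousAt.smul (continuous_norm.continuousAt.inv₀ (norm_ne_zero_iff.2 hz)) continuousAt_id
      · apply Continuous.continuousAt
        exact continuous_real_toNNReal.comp (Real.smoothTransition.continuous.comp (by fun_prop))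
    have h2 := ENNReal.continuous_coe.continuousAt.comp h1
    refine h2.congr (Filter.Eventually.of_forall fun x => ?_)
    simp only [Function.comp, hH, ENNReal.coe_mul]
    rfl
  set K : ENNReal := ((nndist h 0 : ℝ≥0) : ENNReal) with hK
  have hKb : ∀ z, H z ≤ K := by
    intro z
    have h1 := BoundedContinuousFunction.nndist_coe_le_nndist (f := h) (g := 0) (‖z‖⁻¹ • z)
    have h2 : (h (‖z‖⁻¹ • z) : ENNReal) ≤ K := by
      rw [hK]
      exact_mod_cast (by simpa using h1 : h (‖z‖⁻¹ • z) ≤ nndist h 0)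
    calc H z ≤ K * 1 := mul_le_mul' h2 (ENNReal.ofReal_le_one.2 (Real.smoothTransition.le_one _))
      _ = K := mul_one _
  have hgint : ∫⁻ v, ENNReal.ofReal (gk d 1 v) = 1 := by
    rw [← ofReal_integral_eq_lintegral_ofReal (gk_integrable d 1 one_pos) (Filter.Eventually.of_forall fun v => gk_nonneg d 1 one_pos v), gk_integral d 1 one_pos]
    simp
  have hrep : ∀ k, ∫⁻ ω, h ω * ENNReal.ofReal (rho Λ T (u k) ω) ∂(S0 d) =
      ∫⁻ p, H (p.1 + √(u k) • p.2) * ENNReal.ofReal (gk d 1 p.2) ∂(Λ.prod volume) := by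
    intro k
    have hgk : Measurable (gk d (u k)) := (gk_cont d (u k)).measurable
    rw [rho_polar hd Λ T (u k) hT (hu k) _ hhm, lintegral_prod _ (by fun_prop)]
    have e1 : ∀ z, H z * ENNReal.ofReal (lam Λ (u k) z) = ∫⁻ y, H z * ENNReal.ofReal (gk d (u k) (z - y)) ∂Λ := by
      intro z
      rw [lintegral_const_mul _ (by fun_prop), lam, ofReal_integral_eq_lintegral_ofReal (lam_integrable Λ (u k) (hu k) z)
        (Filter.Eventually.of_forall fun y => gk_nonneg d _ (hu k) _)]
    change ∫⁻ z, H z * ENNReal.ofReal (lam Λ (u k) z) = _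
    simp only [e1]
    rw [lintegral_lintegral_swap (Measurable.aemeasurable (by simp only [Function.uncurry_def]; fun_prop))]
    refine lintegral_congr fun y => ?_
    exact gk_scale d (u k) (hu k) y H hHm
  simp only [hrep]
  have hlimit : ∫⁻ y, h (‖y‖⁻¹ • y) ∂Λ = ∫⁻ p, H p.1 * ENNReal.ofReal (gk d 1 p.2) ∂(Λ.prod volume) := by
    rw [lintegral_prod _ (by fun_prop)]
    refine lintegral_congr_ae ?_
    filter_upwards [hΛT] with y hy
    rw [lintegral_const_mul _ (by fun_prop), hgint, mul_one, hH]
    simp only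
    rw [Real.smoothTransition.one_of_one_le (by linarith)]; simp
  rw [hlimit]
  refine tendsto_lintegral_of_dominated_convergence (fun p => K * ENNReal.ofReal (gk d 1 p.2)) (fun k => by fun_prop) ?_ ?_ ?_
  · intro k
    exact Filter.Eventually.of_forall fun p => mul_le_mul_left (hKb _) _
  · rw [lintegral_prod _ (by fun_prop)]
    simp only
    rw [lintegral_const_mul _ (by fun_prop), hgint]
    simp [hK]
  · have h0 : ∀ᵐ p ∂(Λ.prod (volume : Measure (Eu d))), p.1 ≠ 0 := by
      have : ∀ᵐ y ∂Λ, y ≠ 0 := by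
        rw [ae_iff]; simpa using hΛ0
      exact Measure.quasiMeasurePreserving_fst.ae this
    filter_upwards [h0] with p hp
    have h1 : Filter.Tendsto (fun k => p.1 + √(u k) • p.2) Filter.atTop (𝓝 p.1) := by
      have h2 : Filter.Tendsto (fun k => √(u k)) Filter.atTop (𝓝 0) := by
        have := (Real.continuous_sqrt.tendsto 0).comp hut
        simpa [Function.comp_def] using this
      have := (h2.smul_const p.2).const_add p.1
      simpa using this
    have h3 := (hHc p.1 hp).tendsto.comp h1
    exact ENNReal.Tendsto.mul_const h3 (Or.inr ENNReal.ofReal_ne_top)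


noncomputable def diffM {d : ℕ} (μ : Measure (Eu d)) : Measure (Eu d) :=
  Measure.map (fun p : Eu d × Eu d => p.1 - p.2) (μ.prod μ)

lemma diffM_prob {d : ℕ} (μ : Measure (Eu d)) [IsProbabilityMeasure μ] : IsProbabilityMeasure (diffM μ) := by
  unfold diffM
  exact Measure.isProbabilityMeasure_map (by fun_prop)

lemma diffM_charFun {d : ℕ} (μ : Measure (Eu d)) [IsProbabilityMeasure μ] (ξ : Eu d) :
    charFun (diffM μ) ξ = ((‖charFun μ ξ‖^2 : ℝ) : ℂ) := by
  have h1 : charFun (diffM μ) ξ = charFun μ ξ * charFun μ (-ξ) := by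
    rw [charFun_apply, charFun_apply, charFun_apply, diffM, integral_map (by fun_prop) (by fun_prop),
      ← integral_prod_mul]
    congr 1
    ext p
    rw [← Complex.exp_add]
    congr 1
    rw [inner_sub_left, inner_neg_right]
    push_cast
    ring
  rw [h1, charFun_neg, Complex.mul_conj, Complex.normSq_eq_norm_sq]

lemma diffM_frost {d : ℕ} (μ : Measure (Eu d)) [IsProbabilityMeasure μ] (b : ENNReal) (r : ℝ)
    (h : ∀ x, μ (ball x r) ≤ b) : diffM μ (ball 0 r) ≤ b := by
  have hm : Measurable (fun p : Eu d × Eu d => p.1 - p.2) := by fun_prop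
  rw [diffM, Measure.map_apply hm measurableSet_ball, Measure.prod_apply (hm measurableSet_ball)]
  calc _ ≤ ∫⁻ x, b ∂μ := by
        refine lintegral_mono fun x => ?_
        refine le_trans (measure_mono ?_) (h x)
        intro y hy
        simp only [Set.mem_preimage, mem_ball_zero_iff] at hy
        rw [mem_ball, dist_comm, dist_eq_norm]
        exact hy
    _ = b := by simp

lemma diffM_bdd {d : ℕ} (μ : Measure (Eu d)) [IsProbabilityMeasure μ] (E : Set (Eu d)) (hE : IsCompact E) (hs : μ Eᶜ = 0) :
    ∃ T : ℝ, 0 < T ∧ ∀ᵐ y ∂(diffM μ), ‖y‖ ≤ T - 1 := by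
  obtain ⟨B, hB⟩ := hE.isBounded.exists_norm_le
  refine ⟨2 * |B| + 1, by positivity, ?_⟩
  have hm : Measurable (fun p : Eu d × Eu d => p.1 - p.2) := by fun_prop
  have hE' : ∀ᵐ x ∂μ, x ∈ E := hs
  rw [diffM, ae_map_iff hm.aemeasurable (measurableSet_le (by fun_prop) (by fun_prop))]
  filter_upwards [Measure.quasiMeasurePreserving_fst.ae hE', Measure.quasiMeasurePreserving_snd.ae hE'] with p h1 h2
  have := hB _ h1
  have := hB _ h2
  have := le_abs_self B
  have := norm_sub_le p.1 p.2
  linarith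

lemma core {d : ℕ} (hd : 2 ≤ d) (s : ℝ) (hs1 : (d : ℝ) - 1 < s) (hs2 : s ≤ (d : ℝ))
    (E : Set (Eu d)) (hE : IsCompact E) (μ : Measure (Eu d)) [IsProbabilityMeasure μ]
    (hsupp : μ Eᶜ = 0) (C₀ : ℝ) (hC₀ : 0 < C₀)
    (hfrost : ∀ (x : Eu d) (r : ℝ), 0 < r → μ (ball x r) ≤ ENNReal.ofReal (C₀ * r ^ s)) (q : ℝ)
    (hq : q = (2:ℝ)^(-(s - ((d:ℝ)-1)))) :
    ∃ (ρ : Eu d → ℝ) (r : ℕ → Eu d → ℝ) (N L : ℕ → Eu d → ENNReal) (C : ℝ), 0 < C ∧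
      Measurable ρ ∧ (∀ ω, 0 ≤ ρ ω) ∧
      (diffM μ).map (fun y => ‖y‖⁻¹ • y) = (S0 d).withDensity (fun ω => ENNReal.ofReal (ρ ω)) ∧
      (∀ k, Measurable (r k)) ∧ (∀ k, Measurable (N k)) ∧ (∀ k, Measurable (L k)) ∧
      (∀ k, ∀ᵐ ω ∂(S0 d), ENNReal.ofReal |ρ ω - r k ω| ≤ L k ω) ∧
      (∀ k ω ω', dist ω ω' ≤ (1/2:ℝ)^k → ENNReal.ofReal |r k ω - r k ω'| ≤ N k ω) ∧
      (∀ k, ∫⁻ ω, N k ω ∂(S0 d) ≤ ENNReal.ofReal (C * q^k)) ∧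
      (∀ k, ∫⁻ ω, L k ω ∂(S0 d) ≤ ENNReal.ofReal (C * q^k)) := by
  have hd1 : (2:ℝ) ≤ d := by exact_mod_cast hd
  have hs0 : 0 < s := by linarith
  have hΛp := diffM_prob μ
  set Λ := diffM μ with hΛ
  obtain ⟨T, hT, hTb⟩ := diffM_bdd μ E hE hsupp
  set φ : Eu d → ℝ := fun ξ => ‖charFun μ ξ‖^2 with hφd
  have hφ : ∀ ξ, charFun Λ ξ = φ ξ := diffM_charFun μ
  have hφ0 : ∀ ξ, 0 ≤ φ ξ := fun ξ => by positivity
  have hF : ∀ r : ℝ, 0 < r → Λ (ball 0 r) ≤ ENNReal.ofReal (C₀ * r ^ s) := fun r hr =>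
    diffM_frost μ _ r (fun x => hfrost x r hr)
  have hΛ0 : Λ {0} = 0 := by
    have h1 : Filter.Tendsto (fun r : ℝ => ENNReal.ofReal (C₀ * r ^ s)) (nhdsWithin 0 (Set.Ioi 0)) (nhds 0) := by
      have : Filter.Tendsto (fun r : ℝ => ENNReal.ofReal (C₀ * r ^ s)) (nhds 0) (nhds (ENNReal.ofReal (C₀ * 0 ^ s))) := by
        refine ENNReal.tendsto_ofReal ?_
        exact ((Real.continuousAt_rpow_const 0 s (Or.inr hs0.le)).tendsto).const_mul C₀
      rw [Real.zero_rpow hs0.ne'] at this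
      simp only [mul_zero, ENNReal.ofReal_zero] at this
      exact this.mono_left nhdsWithin_le_nhds
    have h2 : Λ {0} ≤ 0 := by
      refine ge_of_tendsto h1 ?_
      filter_upwards [self_mem_nhdsWithin] with r hr
      refine (measure_mono ?_).trans (hF r hr)
      rw [Set.singleton_subset_iff]
      exact mem_ball_self hr
    exact le_antisymm h2 bot_le
  obtain ⟨A, hA, hkey⟩ := rho_key d hd T hT
  obtain ⟨C, hC, hNb⟩ := Nf_bound hd s C₀ A hA hs0.le hs2 hC₀
  have hε : ∀ k : ℕ, (0:ℝ) < (1/2:ℝ)^k := fun k => by positivity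
  have hq0 : 0 < q := by rw [hq]; positivity
  have hq1 : q < 1 := by
    rw [hq]; exact Real.rpow_lt_one_of_one_lt_of_neg (by norm_num) (by linarith)
  have hqk : ∀ k : ℕ, ((1/2:ℝ)^k) ^ (s - ((d:ℝ)-1)) = q^k := by
    intro k
    rw [hq, ← Real.rpow_natCast, ← Real.rpow_mul (by norm_num), ← Real.rpow_natCast, ← Real.rpow_mul (by norm_num),
      one_div, Real.inv_rpow (by norm_num), ← Real.rpow_neg (by norm_num)]
    congr 1; ring
  have hstep : ∀ k : ℕ, ((1/2:ℝ)^(k+1))^2 = ((1/2:ℝ)^k)^2/4 := by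
    intro k; rw [pow_succ]; ring
  have hNm : ∀ k : ℕ, Measurable (Nf φ A ((1/2:ℝ)^k)) := fun k => Nf_meas φ (phi_cont Λ φ hφ) A _
  have hNi : ∀ k : ℕ, ∫⁻ ω, Nf φ A ((1/2:ℝ)^k) ω ∂(S0 d) ≤ ENNReal.ofReal (C * q^k) := by
    intro k
    rw [← hqk]
    exact hNb Λ φ hφ hφ0 hF _ (hε k)
  have hdm : Measurable (fun y : Eu d => ‖y‖⁻¹ • y) := by fun_prop
  have hrm : ∀ k : ℕ, Measurable (rho Λ T (((1/2:ℝ)^k)^2)) := fun k => (rho_cont Λ T _ (by positivity)).measurable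
  obtain ⟨ρ, hρm, hρ0, hρd, hρL, hρi⟩ := density_lemma (S0 d) (Λ.map (fun y => ‖y‖⁻¹ • y))
    (fun k => rho Λ T (((1/2:ℝ)^k)^2)) hrm
    (fun k ω => rho_nonneg Λ T _ hT (by positivity) ω)
    (fun k => Nf φ A ((1/2:ℝ)^k)) hNm
    (fun k ω => by
      have := (hkey Λ φ hφ hφ0 ((1/2:ℝ)^k) (hε k)).1 ω
      rw [← hstep] at this
      exact this) C q hC hq0 hq1 hNi
    (fun h => by
      have := weak_conv hd Λ T hT hΛ0 hTb (fun k => ((1/2:ℝ)^k)^2) (fun k => by positivity) (by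
        have h1 := tendsto_pow_atTop_nhds_zero_of_lt_one (r := (1/2:ℝ)) (by norm_num) (by norm_num)
        have := h1.pow 2
        simpa using this) h
      rw [lintegral_map (f := fun ω => (h ω : ENNReal)) (ENNReal.continuous_coe.comp h.continuous).measurable hdm]
      exact this)
  refine ⟨ρ, _, _, fun k ω => ∑' j, Nf φ A ((1/2:ℝ)^(k+j)) ω, max C (C/(1-q)), by positivity, hρm, hρ0, hρd, hrm, hNm,
    fun k => Measurable.tsum fun j => hNm _, hρL, fun k ω ω' h => (hkey Λ φ hφ hφ0 _ (hε k)).2 ω ω' h,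
    fun k => (hNi k).trans (ENNReal.ofReal_le_ofReal ?_), fun k => (hρi k).trans (ENNReal.ofReal_le_ofReal ?_)⟩
  · gcongr; exact le_max_left _ _
  · gcongr; exact le_max_right _ _


/-- local integral of `L` over the ball of radius `r` -/
noncomputable def locI {d : ℕ} (L : Eu d → ENNReal) (r : ℝ) (ω : Eu d) : ENNReal :=
  ∫⁻ ω', ({p : Eu d × Eu d | dist p.2 p.1 < r}.indicator (fun p => L p.2)) (ω, ω') ∂(S0 d)

lemma locI_meas_aux {d : ℕ} (L : Eu d → ENNReal) (hL : Measurable L) (r : ℝ) :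
    Measurable ({p : Eu d × Eu d | dist p.2 p.1 < r}.indicator (fun p => L p.2)) :=
  (hL.comp measurable_snd).indicator (measurableSet_lt (by fun_prop) (by fun_prop))

lemma locI_meas {d : ℕ} (L : Eu d → ENNReal) (hL : Measurable L) (r : ℝ) : Measurable (locI L r) :=
  (locI_meas_aux L hL r).lintegral_prod_right'

lemma locI_eq {d : ℕ} (L : Eu d → ENNReal) (r : ℝ) (ω : Eu d) :
    locI L r ω = ∫⁻ ω' in ball ω r, L ω' ∂(S0 d) := by
  rw [locI, ← lintegral_indicator measurableSet_ball]
  rfl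

lemma locI_int {d : ℕ} (L : Eu d → ENNReal) (hL : Measurable L) (r : ℝ) (b : ENNReal)
    (hb : ∀ ω ∈ sphere (0 : Eu d) 1, S0 d (ball ω r) ≤ b) :
    ∫⁻ ω, locI L r ω ∂(S0 d) ≤ b * ∫⁻ ω, L ω ∂(S0 d) := by
  unfold locI
  rw [lintegral_lintegral_swap (f := fun ω ω' => ({p : Eu d × Eu d | dist p.2 p.1 < r}.indicator (fun p => L p.2)) (ω, ω')) (locI_meas_aux L hL r).aemeasurable, ← lintegral_const_mul _ hL]
  refine lintegral_mono_ae ?_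
  filter_upwards [S0_ae d] with ω' hω'
  have : ∫⁻ x, ({p : Eu d × Eu d | dist p.2 p.1 < r}.indicator (fun p => L p.2)) (x, ω') ∂(S0 d) =
      ∫⁻ x in ball ω' r, L ω' ∂(S0 d) := by
    rw [← lintegral_indicator measurableSet_ball]
    refine lintegral_congr fun x => ?_
    by_cases h : dist ω' x < r
    · have a1 : ω' ∈ ball x r := h
      have a2 : x ∈ ball ω' r := mem_ball_comm.1 a1
      rw [Set.indicator_of_mem a2]
      exact Set.indicator_of_mem (s := {p : Eu d × Eu d | dist p.2 p.1 < r}) (a := (x, ω')) h _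
    · have a2 : x ∉ ball ω' r := fun a1 => h (mem_ball_comm.1 a1)
      rw [Set.indicator_of_notMem a2]
      exact Set.indicator_of_notMem (s := {p : Eu d × Eu d | dist p.2 p.1 < r}) (a := (x, ω')) h _
  rw [this, setLIntegral_const, mul_comm]
  gcongr
  exact hb ω' hω'

/-- pointwise estimate -/
lemma ptwise {d : ℕ} (ρ r : Eu d → ℝ) (hρm : Measurable ρ) (hρ0 : ∀ ω, 0 ≤ ρ ω)
    (hint : ∫⁻ ω, ENNReal.ofReal (ρ ω) ∂(S0 d) = 1)
    (L : Eu d → ENNReal) (hLm : Measurable L) (n : ENNReal) (ω : Eu d) (ε η : ℝ) (hεη : ε ≤ η)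
    (hL : ∀ᵐ ω ∂(S0 d), ENNReal.ofReal |ρ ω - r ω| ≤ L ω)
    (hLω : ENNReal.ofReal |ρ ω - r ω| ≤ L ω)
    (hn : ∀ ω', dist ω ω' ≤ η → ENNReal.ofReal |r ω - r ω'| ≤ n) :
    ENNReal.ofReal |((S0 d).withDensity (fun ω => ENNReal.ofReal (ρ ω)) (ball ω ε)).toReal
      - ρ ω * (S0 d (ball ω ε)).toReal| ≤ locI L η ω + (n + L ω) * S0 d (ball ω ε) := by
  have hi : Integrable ρ (S0 d) := by
    refine ⟨hρm.aestronglyMeasurable, ?_⟩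
    rw [hasFiniteIntegral_iff_ofReal (Filter.Eventually.of_forall hρ0), hint]
    simp
  have e1 : ((S0 d).withDensity (fun ω => ENNReal.ofReal (ρ ω)) (ball ω ε)).toReal = ∫ ω' in ball ω ε, ρ ω' ∂(S0 d) := by
    rw [withDensity_apply _ measurableSet_ball, integral_eq_lintegral_of_nonneg_ae (Filter.Eventually.of_forall hρ0) hρm.aestronglyMeasurable]
  have e2 : ρ ω * (S0 d (ball ω ε)).toReal = ∫ ω' in ball ω ε, ρ ω ∂(S0 d) := by
    rw [setIntegral_const, smul_eq_mul, mul_comm]; rfl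
  rw [e1, e2, ← integral_sub hi.integrableOn (integrable_const _)]
  have h1 : ENNReal.ofReal |∫ ω' in ball ω ε, (ρ ω' - ρ ω) ∂(S0 d)| ≤ ∫⁻ ω' in ball ω ε, ENNReal.ofReal |ρ ω' - ρ ω| ∂(S0 d) := by
    have := enorm_integral_le_lintegral_enorm (μ := (S0 d).restrict (ball ω ε)) (fun ω' => ρ ω' - ρ ω)
    simpa only [Real.enorm_eq_ofReal_abs] using this
  refine h1.trans ?_
  have h2 : ∫⁻ ω' in ball ω ε, ENNReal.ofReal |ρ ω' - ρ ω| ∂(S0 d) ≤ ∫⁻ ω' in ball ω ε, (L ω' + (n + L ω)) ∂(S0 d) := by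
    refine lintegral_mono_ae ?_
    filter_upwards [ae_restrict_mem measurableSet_ball, ae_restrict_of_ae hL] with ω' hω' hL'
    have hd' : dist ω ω' ≤ η := by rw [dist_comm]; exact (mem_ball.1 hω').le.trans hεη
    have h3 : |ρ ω' - ρ ω| ≤ |ρ ω' - r ω'| + (|r ω - r ω'| + |ρ ω - r ω|) := by
      have a1 := abs_sub_le (ρ ω') (r ω') (ρ ω)
      have a2 := abs_sub_le (r ω') (r ω) (ρ ω)
      rw [abs_sub_comm (r ω') (r ω), abs_sub_comm (r ω) (ρ ω)] at a2
      linarith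
    refine (ENNReal.ofReal_le_ofReal h3).trans ?_
    rw [ENNReal.ofReal_add (by positivity) (by positivity), ENNReal.ofReal_add (by positivity) (by positivity)]
    gcongr
    exact hn _ hd'
  refine h2.trans ?_
  rw [lintegral_add_left hLm, setLIntegral_const, locI_eq]
  gcongr


/-- dyadic bound -/
lemma dyadic {d : ℕ} (hd : 2 ≤ d) (q : ℝ) (hqh : 1/2 ≤ q)
    (κ Cc : ℝ) (hκ : 0 < κ) (hCc : 0 < Cc)
    (hcap : ∀ ε : ℝ, 0 < ε → ε < 1 → ∀ ω ∈ sphere (0 : Eu d) 1, |ε^(-((d:ℝ)-1)) * (S0 d (ball ω ε)).toReal - κ| ≤ Cc*ε)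
    (ρ : Eu d → ℝ) (r : ℕ → Eu d → ℝ) (N L : ℕ → Eu d → ENNReal) (C : ℝ) (hC : 0 < C)
    (hρm : Measurable ρ) (hρ0 : ∀ ω, 0 ≤ ρ ω)
    (hint : ∫⁻ ω, ENNReal.ofReal (ρ ω) ∂(S0 d) = 1)
    (hNm : ∀ k, Measurable (N k)) (hLm : ∀ k, Measurable (L k))
    (hL : ∀ k, ∀ᵐ ω ∂(S0 d), ENNReal.ofReal |ρ ω - r k ω| ≤ L k ω)
    (hN : ∀ k ω ω', dist ω ω' ≤ (1/2:ℝ)^k → ENNReal.ofReal |r k ω - r k ω'| ≤ N k ω)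
    (hNi : ∀ k, ∫⁻ ω, N k ω ∂(S0 d) ≤ ENNReal.ofReal (C * q^k))
    (hLi : ∀ k, ∫⁻ ω, L k ω ∂(S0 d) ≤ ENNReal.ofReal (C * q^k)) :
    ∃ (G : ℕ → Eu d → ENNReal) (K : ℝ), 0 < K ∧ (∀ k, Measurable (G k)) ∧
      (∀ k, 1 ≤ k → ∫⁻ ω, G k ω ∂(S0 d) ≤ ENNReal.ofReal (K * q^k)) ∧
      (∀ᵐ ω ∂(S0 d), ∀ k, 1 ≤ k → ∀ ε : ℝ, (1/2:ℝ)^(k+1) < ε → ε ≤ (1/2:ℝ)^k →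
        ENNReal.ofReal |ε^(-((d:ℝ)-1)) * ((S0 d).withDensity (fun ω => ENNReal.ofReal (ρ ω)) (ball ω ε)).toReal - κ * ρ ω| ≤ G k ω) := by
  have hd1 : (2:ℝ) ≤ d := by exact_mod_cast hd
  set K1 := κ + Cc with hK1
  have hK1p : 0 < K1 := by positivity
  set D : ℝ := (d:ℝ) - 1 with hD
  have hDp : 0 < D := by linarith
  have hq0 : 0 < q := by linarith
  have hup : ∀ ε : ℝ, 0 < ε → ε < 1 → ∀ ω ∈ sphere (0 : Eu d) 1, ε^(-D) * (S0 d (ball ω ε)).toReal ≤ K1 := by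
    intro ε h0 h1 ω hω
    have := (abs_le.1 (hcap ε h0 h1 ω hω)).2
    nlinarith
  have hup2 : ∀ ε : ℝ, 0 < ε → ε < 1 → ∀ ω ∈ sphere (0 : Eu d) 1, S0 d (ball ω ε) ≤ ENNReal.ofReal (K1 * ε^D) := by
    intro ε h0 h1 ω hω
    have h2 := hup ε h0 h1 ω hω
    rw [← ENNReal.ofReal_toReal (measure_ne_top (S0 d) (ball ω ε))]
    refine ENNReal.ofReal_le_ofReal ?_
    rw [Real.rpow_neg h0.le, inv_mul_le_iff₀ (by positivity)] at h2
    linarith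
  have hpow1 : ∀ k : ℕ, 1 ≤ k → ((1/2:ℝ)^k) < 1 := fun k hk => pow_lt_one₀ (by norm_num) (by norm_num) (by omega)
  refine ⟨fun k ω => ENNReal.ofReal (((1/2:ℝ)^(k+1))^(-D)) * locI (L k) ((1/2:ℝ)^k) ω + ENNReal.ofReal K1 * (N k ω + L k ω)
    + ENNReal.ofReal (Cc * (1/2:ℝ)^k) * ENNReal.ofReal (ρ ω), (2:ℝ)^D * K1 * C + 2 * K1 * C + Cc, by positivity, ?_, ?_, ?_⟩
  · intro k
    have := locI_meas (L k) (hLm k) ((1/2:ℝ)^k)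
    have := hNm k
    have := hLm k
    fun_prop
  · intro k hk
    have hm1 := locI_meas (L k) (hLm k) ((1/2:ℝ)^k)
    have hm2 := hNm k
    have hm3 := hLm k
    rw [lintegral_add_left (by fun_prop), lintegral_add_left (by fun_prop), lintegral_const_mul _ hm1,
      lintegral_const_mul _ (by fun_prop), lintegral_const_mul _ (by fun_prop), lintegral_add_left hm2, hint, mul_one]
    have t1 : ENNReal.ofReal (((1/2:ℝ)^(k+1))^(-D)) * ∫⁻ ω, locI (L k) ((1/2:ℝ)^k) ω ∂(S0 d) ≤ ENNReal.ofReal ((2:ℝ)^D * K1 * C * q^k) := by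
      calc _ ≤ ENNReal.ofReal (((1/2:ℝ)^(k+1))^(-D)) * (ENNReal.ofReal (K1 * ((1/2:ℝ)^k)^D) * ENNReal.ofReal (C * q^k)) := by
            gcongr
            exact (locI_int (L k) hm3 _ _ (hup2 _ (by positivity) (hpow1 k hk))).trans (by gcongr; exact hLi k)
        _ = _ := by
            rw [← ENNReal.ofReal_mul (by positivity), ← ENNReal.ofReal_mul (by positivity)]
            congr 1
            rw [pow_succ, Real.mul_rpow (by positivity) (by positivity), Real.rpow_neg (by positivity), Real.rpow_neg (by norm_num : (0:ℝ) ≤ 1/2)]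
            have : ((1/2:ℝ)^D)⁻¹ = 2^D := by rw [one_div, Real.inv_rpow (by norm_num), inv_inv]
            rw [this]
            have : ((1/2:ℝ)^k)^D ≠ 0 := by positivity
            field_simp
    have t2 : ENNReal.ofReal K1 * (∫⁻ ω, N k ω ∂(S0 d) + ∫⁻ ω, L k ω ∂(S0 d)) ≤ ENNReal.ofReal (2 * K1 * C * q^k) := by
      calc _ ≤ ENNReal.ofReal K1 * (ENNReal.ofReal (C * q^k) + ENNReal.ofReal (C * q^k)) := by
            gcongr
            · exact hNi k
            · exact hLi k
        _ = _ := by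
            rw [← ENNReal.ofReal_add (by positivity) (by positivity), ← ENNReal.ofReal_mul (by positivity)]
            congr 1; ring
    have t3 : ENNReal.ofReal (Cc * (1/2:ℝ)^k) ≤ ENNReal.ofReal (Cc * q^k) := by
      refine ENNReal.ofReal_le_ofReal ?_
      gcongr
    refine (add_le_add (add_le_add t1 t2) t3).trans_eq ?_
    rw [← ENNReal.ofReal_add (by positivity) (by positivity), ← ENNReal.ofReal_add (by positivity) (by positivity)]
    congr 1; ring
  · filter_upwards [S0_ae d, ae_all_iff.2 hL] with ω hω hLω k hk ε hε1 hε2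
    have hε0 : 0 < ε := lt_trans (by positivity) hε1
    have hεlt : ε < 1 := hε2.trans_lt (hpow1 k hk)
    have hp := ptwise ρ (r k) hρm hρ0 hint (L k) (hLm k) (N k ω) ω ε ((1/2:ℝ)^k) hε2 (hL k) (hLω k) (hN k ω)
    set v := ((S0 d).withDensity (fun ω => ENNReal.ofReal (ρ ω)) (ball ω ε)).toReal
    set w := (S0 d (ball ω ε)).toReal with hw
    have h1 : |ε^(-D) * v - κ * ρ ω| ≤ ε^(-D) * |v - ρ ω * w| + (Cc * ε) * ρ ω := by
      have e : ε^(-D) * v - κ * ρ ω = ε^(-D) * (v - ρ ω * w) + (ε^(-D) * w - κ) * ρ ω := by ring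
      rw [e]
      refine (abs_add_le _ _).trans ?_
      rw [abs_mul, abs_mul, abs_of_nonneg (by positivity : 0 ≤ ε^(-D)), abs_of_nonneg (hρ0 ω)]
      gcongr
      · exact hρ0 ω
      · exact hcap ε hε0 hεlt ω hω
    refine (ENNReal.ofReal_le_ofReal h1).trans ?_
    have hr0 := hρ0 ω
    rw [ENNReal.ofReal_add (by positivity) (by positivity), ENNReal.ofReal_mul (by positivity), ENNReal.ofReal_mul (p := Cc * ε) (by positivity)]
    have h3 : ENNReal.ofReal (ε^(-D)) * ENNReal.ofReal |v - ρ ω * w| ≤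
        ENNReal.ofReal (((1/2:ℝ)^(k+1))^(-D)) * locI (L k) ((1/2:ℝ)^k) ω + ENNReal.ofReal K1 * (N k ω + L k ω) := by
      calc _ ≤ ENNReal.ofReal (ε^(-D)) * (locI (L k) ((1/2:ℝ)^k) ω + (N k ω + L k ω) * S0 d (ball ω ε)) := by gcongr
        _ = ENNReal.ofReal (ε^(-D)) * locI (L k) ((1/2:ℝ)^k) ω + (ENNReal.ofReal (ε^(-D)) * S0 d (ball ω ε)) * (N k ω + L k ω) := by ring
        _ ≤ _ := by
          refine add_le_add (mul_le_mul' (ENNReal.ofReal_le_ofReal ?_) le_rfl) (mul_le_mul' ?_ le_rfl)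
          · rw [Real.rpow_neg hε0.le, Real.rpow_neg (by positivity)]
            gcongr
          · rw [← ENNReal.ofReal_toReal (measure_ne_top (S0 d) (ball ω ε)), ← ENNReal.ofReal_mul (by positivity)]
            exact ENNReal.ofReal_le_ofReal (hup ε hε0 hεlt ω hω)
    gcongr


lemma dirMeasure_eq {d : ℕ} (μ : Measure (Eu d)) [IsProbabilityMeasure μ] (Θ : Eu d ≃ₗᵢ[ℝ] Eu d) :
    dirMeasure μ Θ = ((diffM μ).map (fun y => ‖y‖⁻¹ • y)).map Θ := by
  have hΘ : Measurable Θ := Θ.continuous.measurable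
  have hdm : Measurable (fun y : Eu d => ‖y‖⁻¹ • y) := by fun_prop
  unfold dirMeasure diffM
  rw [Measure.map_prod_map _ _ hΘ hΘ, Measure.map_map (by fun_prop) (by fun_prop), Measure.map_map hdm (by fun_prop),
    Measure.map_map hΘ (by fun_prop)]
  congr 1
  ext1 p
  simp only [Function.comp, Prod.map]
  rw [← map_sub, Θ.norm_map, map_smul]

lemma dirMeasure_ball {d : ℕ} (μ : Measure (Eu d)) [IsProbabilityMeasure μ] (Θ : Eu d ≃ₗᵢ[ℝ] Eu d) (ω : Eu d) (ε : ℝ) :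
    dirMeasure μ Θ (ball ω ε) = ((diffM μ).map (fun y => ‖y‖⁻¹ • y)) (ball (Θ.symm ω) ε) := by
  rw [dirMeasure_eq, Measure.map_apply Θ.continuous.measurable measurableSet_ball, Θ.preimage_ball]

lemma ball_meas {d : ℕ} (ν : Measure (Eu d)) [SFinite ν] (ε : ℝ) : Measurable (fun ω => ν (ball ω ε)) := by
  have h : MeasurableSet {p : Eu d × Eu d | dist p.2 p.1 < ε} := measurableSet_lt (by fun_prop) (by fun_prop)
  exact measurable_measure_prodMk_left h

/-- sup bound for the identity rotation -/
lemma sup_bound {d : ℕ} (q β : ℝ) (hβ0 : 0 < β) (hβ1 : β ≤ 1) (hq : q = (2:ℝ)^(-β))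
    (R : ℝ → Eu d → ℝ) (G : ℕ → Eu d → ENNReal) (K : ℝ) (hK : 0 < K) (hGm : ∀ k, Measurable (G k))
    (hGi : ∀ k, 1 ≤ k → ∫⁻ ω, G k ω ∂(S0 d) ≤ ENNReal.ofReal (K * q^k))
    (hR : ∀ᵐ ω ∂(S0 d), ∀ k, 1 ≤ k → ∀ ε : ℝ, (1/2:ℝ)^(k+1) < ε → ε ≤ (1/2:ℝ)^k → ENNReal.ofReal |R ε ω| ≤ G k ω)
    (c : ℝ) (hc0 : 0 < c) (hc1 : c < 1/2) :
    ∫ ω, (⨆ ε ∈ Set.Ioo (0 : ℝ) c, |R ε ω|) ∂(S0 d) ≤ 2 * K / (1 - q) * c^β := by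
  have hq0 : 0 < q := by rw [hq]; positivity
  have hq1 : q < 1 := by
    rw [hq]; exact Real.rpow_lt_one_of_one_lt_of_neg (by norm_num) (by linarith)
  obtain ⟨n, hn1, hn2⟩ := exists_nat_pow_near_of_lt_one hc0 (by linarith) (by norm_num : (0:ℝ) < 1/2) (by norm_num)
  have hn : 1 ≤ n := by
    by_contra h
    have : n = 0 := by omega
    subst this
    norm_num at hn1
    linarith
  set F : Eu d → ENNReal := fun ω => ∑' j, G (n+j) ω with hF
  have hFm : Measurable F := Measurable.tsum fun j => hGm _
  have hFi : ∫⁻ ω, F ω ∂(S0 d) ≤ ENNReal.ofReal (K / (1-q) * q^n) := by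
    rw [hF, lintegral_tsum (fun j => (hGm _).aemeasurable)]
    refine (ENNReal.tsum_le_tsum (fun j => hGi (n+j) (by omega))).trans ?_
    have hs : HasSum (fun j => K * q^(n+j)) (K / (1-q) * q^n) := by
      have := (hasSum_geometric_of_lt_one hq0.le hq1).mul_left (K * q^n)
      have e1 : (fun j => K * q^(n+j)) = fun j => K * q^n * q^j := by
        ext j; rw [pow_add]; ring
      have e2 : K / (1-q) * q^n = K * q^n * (1-q)⁻¹ := by ring
      rw [e1, e2]
      exact this
    rw [← ENNReal.ofReal_tsum_of_nonneg (fun j => by positivity) hs.summable, hs.tsum_eq]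
  have hFt : ∫⁻ ω, F ω ∂(S0 d) ≠ ⊤ := ne_top_of_le_ne_top ENNReal.ofReal_ne_top hFi
  have h1 : ∫ ω, (⨆ ε ∈ Set.Ioo (0 : ℝ) c, |R ε ω|) ∂(S0 d) ≤ ∫ ω, (F ω).toReal ∂(S0 d) := by
    refine integral_mono_of_nonneg (Filter.Eventually.of_forall fun ω => ?_) (integrable_toReal_of_lintegral_ne_top hFm.aemeasurable hFt) ?_
    · exact Real.iSup_nonneg fun ε => Real.iSup_nonneg fun _ => abs_nonneg _
    · filter_upwards [hR, ae_lt_top hFm hFt] with ω hω hfin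
      refine Real.iSup_le (fun ε => Real.iSup_le (fun hε => ?_) ENNReal.toReal_nonneg) ENNReal.toReal_nonneg
      obtain ⟨k, hk1, hk2⟩ := exists_nat_pow_near_of_lt_one hε.1 (by linarith [hε.2]) (by norm_num : (0:ℝ) < 1/2) (by norm_num)
      have hkn : n < k + 1 := by
        have : (1/2:ℝ)^(k+1) < (1/2:ℝ)^n := by linarith [hε.2]
        exact (pow_lt_pow_iff_right_of_lt_one₀ (by norm_num) (by norm_num)).1 this
      have h2 : ENNReal.ofReal |R ε ω| ≤ F ω := by
        refine (hω k (by omega) ε hk1 hk2).trans ?_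
        have := ENNReal.le_tsum (f := fun j => G (n+j) ω) (k - n)
        simpa [Nat.add_sub_cancel' (by omega : n ≤ k)] using this
      exact (ENNReal.ofReal_le_iff_le_toReal hfin.ne).1 h2
  refine h1.trans ?_
  rw [integral_toReal hFm.aemeasurable (ae_lt_top hFm hFt)]
  refine (ENNReal.toReal_le_of_le_ofReal (by have : 0 < 1 - q := by linarith
                                             positivity) hFi).trans ?_
  have h1q : 0 < 1 - q := by linarith
  have h3 : q^n ≤ 2 * c^β := by
    have e : q^n = ((1/2:ℝ)^n)^β := by
      rw [hq, ← Real.rpow_natCast, ← Real.rpow_mul (by norm_num), ← Real.rpow_natCast, ← Real.rpow_mul (by norm_num),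
        one_div, Real.inv_rpow (by norm_num), ← Real.rpow_neg (by norm_num)]
      congr 1; ring
    rw [e]
    calc ((1/2:ℝ)^n)^β ≤ (2*c)^β := by
          refine Real.rpow_le_rpow (by positivity) ?_ hβ0.le
          rw [pow_succ] at hn1; linarith
      _ = 2^β * c^β := Real.mul_rpow (by norm_num) hc0.le
      _ ≤ 2^(1:ℝ) * c^β := by gcongr; norm_num
      _ = 2 * c^β := by rw [Real.rpow_one]
  calc K / (1-q) * q^n ≤ K/(1-q) * (2 * c^β) := by gcongr
    _ = _ := by ring

theorem direction_measure_decomposition (d : ℕ) (hd : 2 ≤ d)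
    (s : ℝ) (hs1 : (d : ℝ) - 1 < s) (hs2 : s ≤ (d : ℝ))
    (E : Set (EuclideanSpace ℝ (Fin d))) (hE : IsCompact E)
    (μ : Measure (EuclideanSpace ℝ (Fin d))) [IsProbabilityMeasure μ]
    (hsupp : μ Eᶜ = 0) (C₀ : ℝ) (hC₀ : 0 < C₀)
    (hfrost : ∀ (x : EuclideanSpace ℝ (Fin d)) (r : ℝ), 0 < r →
      μ (ball x r) ≤ ENNReal.ofReal (C₀ * r ^ s)) :
    ∃ C : ℝ, 0 < C ∧ ∃ c₀ ∈ Set.Ioo (0 : ℝ) 1,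
      ∃ M : (EuclideanSpace ℝ (Fin d) ≃ₗᵢ[ℝ] EuclideanSpace ℝ (Fin d)) →
              EuclideanSpace ℝ (Fin d) → ℝ,
      ∃ R : (EuclideanSpace ℝ (Fin d) ≃ₗᵢ[ℝ] EuclideanSpace ℝ (Fin d)) →
              ℝ → EuclideanSpace ℝ (Fin d) → ℝ,
        (∀ Θ, Measurable (M Θ)) ∧
        (∀ Θ ω, 0 ≤ M Θ ω) ∧
        (∀ Θ ε, Measurable (R Θ ε)) ∧
        (∀ Θ (ε : ℝ), 0 < ε → ε < c₀ →
          ∀ ω ∈ sphere (0 : EuclideanSpace ℝ (Fin d)) 1,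
            ε ^ (-((d : ℝ) - 1)) * (dirMeasure μ Θ (ball ω ε)).toReal
              = M Θ ω + R Θ ε ω) ∧
        (∀ Θ (c : ℝ), 0 < c → c < c₀ →
          ∫ ω, (⨆ ε ∈ Set.Ioo (0 : ℝ) c, |R Θ ε ω|) ∂(sphereMeasure d)
            ≤ C * c ^ (s - ((d : ℝ) - 1))) ∧
        (∀ Θ, ∫ ω, M Θ ω ∂(sphereMeasure d) ≤ C) ∧
        (∃ Θ₀, 1 / C ≤ ∫ ω, M Θ₀ ω ∂(sphereMeasure d)) := by
  
  obtain ⟨cσ, hcσ, hσ⟩ := sphereMeasure_eq d hd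
  obtain ⟨κ, Cc, hκ, hCc, hcap⟩ := cap_asymp d hd
  set β : ℝ := s - ((d:ℝ) - 1) with hβ
  have hβ0 : 0 < β := by linarith
  have hβ1 : β ≤ 1 := by linarith
  set q : ℝ := (2:ℝ)^(-β) with hq
  have hqh : 1/2 ≤ q := by
    have h1 : (2:ℝ)^(-(1:ℝ)) ≤ q := Real.rpow_le_rpow_of_exponent_le (by norm_num) (by linarith)
    rw [Real.rpow_neg_one] at h1
    linarith
  have hq1 : q < 1 := Real.rpow_lt_one_of_one_lt_of_neg (by norm_num) (by linarith)
  obtain ⟨ρ, r, N, L, C, hC, hρm, hρ0, hρd, hrm, hNm, hLm, hL, hN, hNi, hLi⟩ :=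
    core hd s hs1 hs2 E hE μ hsupp C₀ hC₀ hfrost q rfl
  have hdp := diffM_prob μ
  have hdm : Measurable (fun y : Eu d => ‖y‖⁻¹ • y) := by fun_prop
  set ν : Measure (Eu d) := (diffM μ).map (fun y => ‖y‖⁻¹ • y) with hν
  have hνp : IsProbabilityMeasure ν := Measure.isProbabilityMeasure_map hdm.aemeasurable
  have hint : ∫⁻ ω, ENNReal.ofReal (ρ ω) ∂(S0 d) = 1 := by
    have h1 : ν Set.univ = 1 := measure_univ
    rw [hρd, withDensity_apply _ MeasurableSet.univ, Measure.restrict_univ] at h1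
    exact h1
  obtain ⟨G, K, hK, hGm, hGi, hG⟩ := dyadic hd q hqh κ Cc hκ hCc hcap ρ r N L C hC hρm hρ0 hint hNm hLm hL hN hNi hLi
  rw [← hρd] at hG
  set R₀ : ℝ → Eu d → ℝ := fun ε ω => ε ^ (-((d : ℝ) - 1)) * (ν (ball ω ε)).toReal - κ * ρ ω with hR₀
  have hR₀m : ∀ ε, Measurable (R₀ ε) := by
    intro ε
    exact ((ball_meas ν ε).ennreal_toReal.const_mul _).sub (hρm.const_mul κ)
  have hsup : ∀ c : ℝ, 0 < c → c < 1/2 →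
      ∫ ω, (⨆ ε ∈ Set.Ioo (0 : ℝ) c, |R₀ ε ω|) ∂(sphereMeasure d) ≤ cσ * (2 * K / (1 - q)) * c ^ β := by
    intro c hc0 hc1
    rw [hσ, integral_smul_measure, ENNReal.toReal_ofReal hcσ.le, smul_eq_mul, mul_assoc]
    have := sup_bound q β hβ0 hβ1 rfl R₀ G K hK hGm hGi hG c hc0 hc1
    gcongr
  have hρint : ∫ ω, κ * ρ ω ∂(sphereMeasure d) = cσ * κ := by
    rw [hσ, integral_smul_measure, ENNReal.toReal_ofReal hcσ.le, smul_eq_mul, integral_const_mul,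
      integral_eq_lintegral_of_nonneg_ae (Filter.Eventually.of_forall hρ0) hρm.aestronglyMeasurable, hint]
    simp
  have hcomp : ∀ (Θ : Eu d ≃ₗᵢ[ℝ] Eu d) (f : Eu d → ℝ), ∫ ω, f (Θ.symm ω) ∂(sphereMeasure d) = ∫ ω, f ω ∂(sphereMeasure d) :=
    fun Θ f => (sphereMeasure_map d Θ.symm).integral_comp Θ.symm.toHomeomorph.measurableEmbedding f
  have h1q : 0 < 1 - q := by linarith
  set Ct : ℝ := cσ * (2 * K / (1 - q)) + cσ * κ + 1 / (cσ * κ) with hCt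
  have p1 : 0 < cσ * (2 * K / (1 - q)) := by positivity
  have p2 : 0 < cσ * κ := by positivity
  have p3 : 0 < 1 / (cσ * κ) := by positivity
  have hCtp : 0 < Ct := by positivity
  have hsm : ∀ Θ : Eu d ≃ₗᵢ[ℝ] Eu d, Measurable Θ.symm := fun Θ => Θ.symm.continuous.measurable
  refine ⟨Ct, hCtp, 1/2, ⟨by norm_num, by norm_num⟩, fun Θ ω => κ * ρ (Θ.symm ω), fun Θ ε ω => R₀ ε (Θ.symm ω),
    fun Θ => (hρm.comp (hsm Θ)).const_mul κ, fun Θ ω => mul_nonneg hκ.le (hρ0 _), fun Θ ε => (hR₀m ε).comp (hsm Θ),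
    ?_, ?_, ?_, ?_⟩
  · intro Θ ε _ _ ω _
    rw [dirMeasure_ball]
    simp only [hR₀]
    ring
  · intro Θ c hc0 hc1
    rw [hcomp Θ (fun ω => ⨆ ε ∈ Set.Ioo (0 : ℝ) c, |R₀ ε ω|)]
    refine (hsup c hc0 hc1).trans ?_
    have : 0 ≤ c ^ β := by positivity
    gcongr
    linarith
  · intro Θ
    rw [hcomp Θ (fun ω => κ * ρ ω), hρint]
    linarith
  · refine ⟨LinearIsometryEquiv.refl ℝ _, ?_⟩
    rw [hcomp (LinearIsometryEquiv.refl ℝ _) (fun ω => κ * ρ ω), hρint, div_le_iff₀ hCtp]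
    have : cσ * κ * (1 / (cσ * κ)) = 1 := by field_simp
    have h5 : 0 < cσ * κ * (cσ * (2 * K / (1 - q)) + cσ * κ) := by positivity
    rw [hCt, mul_add, this]
    linarith
end
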